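/- There exist infinitely many α ∈ (0,1) with the following property: there are constants c > 0, C > 0 and a threshold n₀ such that for all integers n ≥ n₀, one has n + c·log(log n) ≤ N_α(n) ≤ n + C·n/log(log n). -/

import Mathlib

open scoped RealInnerProductSpace

/-- There exist `N` unit vectors in `ℝ^n` whose pairwise inner products all have
absolute value `α`, i.e. `N` equiangular lines in `ℝ^n` with common angle `arccos α`. -/
def HasEquiangularLines (α : ℝ) (n N : ℕ) : Prop :=
  ∃ v : Fin N → EuclideanSpace ℝ (Fin n),
    (∀ i, ‖v i‖ = 1) ∧ ∀ i j, i ≠ j → |⟪v i, v j⟫| = α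

/-- `N_α(n)`: the maximum number of equiangular lines in `ℝ^n` with common angle `arccos α`. -/
noncomputable def maxEquiangularLines (α : ℝ) (n : ℕ) : ℕ :=
  sSup {N | HasEquiangularLines α n N}



lemma eq_parseval {G I : Type*} [Fintype G] [AddCommGroup G] [DecidableEq G] [Fintype I]
    (χ : I → AddChar G ℂ)
    (hχ : ∀ x, ∑ c, χ c x = if x = 0 then (Fintype.card G : ℂ) else 0) (g h : G → ℝ) (s : G) :
    ∑ c, χ c s * (∑ x, (g x : ℂ) * χ c x) * (starRingEnd ℂ) (∑ x, (h x : ℂ) * χ c x)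
      = Fintype.card G * ∑ x, (g x : ℂ) * h (x + s) := by
  have h1 : ∀ c, χ c s * (∑ x, (g x : ℂ) * χ c x) * (starRingEnd ℂ) (∑ x, (h x : ℂ) * χ c x)
      = ∑ x, ∑ y, (g x : ℂ) * h y * χ c (s + x - y) := by
    intro c
    rw [map_sum, mul_assoc, Finset.sum_mul_sum, Finset.mul_sum]
    refine Finset.sum_congr rfl fun x _ => ?_
    rw [Finset.mul_sum]
    refine Finset.sum_congr rfl fun y _ => ?_
    rw [map_mul, Complex.conj_ofReal, ← AddChar.map_neg_eq_conj, sub_eq_add_neg,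
      AddChar.map_add_eq_mul, AddChar.map_add_eq_mul]
    ring
  rw [Finset.sum_congr rfl fun c _ => h1 c, Finset.sum_comm, Finset.mul_sum]
  refine Finset.sum_congr rfl fun x _ => ?_
  rw [Finset.sum_comm]
  have h2 : ∀ y, ∑ c, (g x : ℂ) * h y * χ c (s + x - y)
      = if y = x + s then (Fintype.card G : ℂ) * (g x * h (x + s)) else 0 := by
    intro y
    rw [← Finset.mul_sum, hχ]
    by_cases hy : y = x + s
    · subst hy
      simp [add_comm x s]
      ring
    · have : s + x - y ≠ 0 := by
        intro h0
        apply hy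
        rw [add_comm x s]
        exact (sub_eq_zero.mp h0).symm
      simp [this, hy]
  rw [Finset.sum_congr rfl fun y _ => h2 y]
  simp

/-- from a quadratic form bound to a norm bound, on mean zero functions -/
lemma eq_norm_of_quad {V : Type*} [Fintype V] (P : V → V → ℝ) (hs : ∀ u v, P u v = P v u)
    (p c : ℝ) (hc : 0 < c) (hrow : ∀ u, ∑ v, P u v = p)
    (hq : ∀ f : V → ℝ, ∑ v, f v = 0 → |∑ u, ∑ v, P u v * f u * f v| ≤ c * ∑ v, f v ^ 2)
    (f : V → ℝ) (hf : ∑ v, f v = 0) :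
    ∑ u, (∑ v, P u v * f v) ^ 2 ≤ c ^ 2 * ∑ v, f v ^ 2 := by
  set g : V → ℝ := fun u => (∑ v, P u v * f v) / c with hg
  have hg0 : ∑ v, g v = 0 := by
    simp only [hg]
    rw [← Finset.sum_div, Finset.sum_comm]
    have : ∀ y, ∑ x, P x y * f y = p * f y := by
      intro y
      rw [← Finset.sum_mul]
      simp_rw [hs _ y]
      rw [hrow]
    simp_rw [this]
    rw [← Finset.mul_sum, hf]; simp
  have h1 := (abs_le.mp (hq (fun v => f v + g v) (by rw [Finset.sum_add_distrib, hf, hg0, add_zero]))).2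
  have h2 := (abs_le.mp (hq (fun v => f v - g v) (by rw [Finset.sum_sub_distrib, hf, hg0, sub_zero]))).1
  have e1 : ∑ u, ∑ v, P u v * (f u + g u) * (f v + g v) - ∑ u, ∑ v, P u v * (f u - g u) * (f v - g v)
      = 4 * ∑ u, ∑ v, P u v * f v * g u := by
    have : ∑ u, ∑ v, P u v * f u * g v = ∑ u, ∑ v, P u v * f v * g u := by
      rw [Finset.sum_comm]
      refine Finset.sum_congr rfl fun x _ => Finset.sum_congr rfl fun y _ => ?_
      rw [hs]
    calc _ = 2 * ∑ u, ∑ v, P u v * f v * g u + 2 * ∑ u, ∑ v, P u v * f u * g v := by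
          simp only [Finset.mul_sum, ← Finset.sum_sub_distrib, ← Finset.sum_add_distrib]
          refine Finset.sum_congr rfl fun x _ => Finset.sum_congr rfl fun y _ => ?_
          ring
      _ = _ := by rw [this]; ring
  have e2 : ∑ u, ∑ v, P u v * f v * g u = (∑ u, (∑ v, P u v * f v) ^ 2) / c := by
    rw [Finset.sum_div]
    refine Finset.sum_congr rfl fun x _ => ?_
    rw [← Finset.sum_mul]
    simp only [hg]; ring
  have e3 : ∑ v, (f v + g v) ^ 2 + ∑ v, (f v - g v) ^ 2 = 2 * ∑ v, f v ^ 2 + 2 * ∑ v, g v ^ 2 := by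
    simp only [Finset.mul_sum, ← Finset.sum_add_distrib]
    refine Finset.sum_congr rfl fun x _ => ?_
    ring
  have e4 : ∑ v, g v ^ 2 = (∑ u, (∑ v, P u v * f v) ^ 2) / c ^ 2 := by
    rw [Finset.sum_div]
    refine Finset.sum_congr rfl fun x _ => ?_
    simp only [hg]; ring
  set S := ∑ u, (∑ v, P u v * f v) ^ 2
  have h3 : 4 * (S / c) ≤ c * (2 * ∑ v, f v ^ 2 + 2 * (S / c ^ 2)) := by
    rw [← e4, ← e3, ← e2, ← e1]; linarith
  have h4 : c * (2 * (S / c ^ 2)) = 2 * (S / c) := by field_simp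
  have h5 : S / c ≤ c * ∑ v, f v ^ 2 := by nlinarith
  rw [div_le_iff₀ hc] at h5
  nlinarith

noncomputable def gg_w (s t : ℕ) : ℝ := if s < t then 4/5 else if t < s then 5/4 else 1

lemma gg_w_pos (s t : ℕ) : 0 < gg_w s t := by unfold gg_w; split_ifs <;> norm_num
lemma gg_w_mul (s t : ℕ) : gg_w s t * gg_w t s = 1 := by
  unfold gg_w
  rcases lt_trichotomy s t with h | h | h
  · simp [h, h.not_gt]
  · simp [h]
  · simp [h, h.not_gt]
lemma gg_w_le (s t : ℕ) : gg_w s t ≤ 5/4 := by unfold gg_w; split_ifs <;> norm_num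
lemma gg_w_le_one {s t : ℕ} (h : s ≤ t) : gg_w s t ≤ 1 := by
  unfold gg_w; rw [if_neg h.not_gt]; split_ifs <;> norm_num
lemma gg_w_lt {s t : ℕ} (h : s < t) : gg_w s t ≤ 4/5 := by
  unfold gg_w; simp [h]

lemma gg_w_amgm (s t : ℕ) (x y : ℝ) : 2 * (x * y) ≤ gg_w s t * x ^ 2 + gg_w t s * y ^ 2 := by
  have h1 := gg_w_pos s t
  have h2 := gg_w_mul s t
  set a := gg_w s t
  set b := gg_w t s
  have : a * (a * x ^ 2 + b * y ^ 2 - 2 * (x * y)) = (a * x - y) ^ 2 := by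
    linear_combination y ^ 2 * h2
  have h3 : 0 ≤ a * (a * x ^ 2 + b * y ^ 2 - 2 * (x * y)) := by rw [this]; positivity
  have := nonneg_of_mul_nonneg_right h3 h1
  linarith

lemma gg_key (v w : ℤ) (hne : ¬ (v = 0 ∧ w = 0)) (x1 x2 x3 x4 : ℝ)
    (q1 : x1 ≤ 5/4) (q2 : x2 ≤ 5/4) (q3 : x3 ≤ 5/4) (q4 : x4 ≤ 5/4)
    (t1 : w.natAbs < (w + 2 * v).natAbs → x1 ≤ 4/5)
    (t2 : w.natAbs < (w + -2 * v).natAbs → x2 ≤ 4/5)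
    (t3 : v.natAbs < (v + 2 * w).natAbs → x3 ≤ 4/5)
    (t4 : v.natAbs < (v + -2 * w).natAbs → x4 ≤ 4/5)
    (u1 : w.natAbs ≤ (w + 2 * v).natAbs → x1 ≤ 1)
    (u2 : w.natAbs ≤ (w + -2 * v).natAbs → x2 ≤ 1)
    (u3 : v.natAbs ≤ (v + 2 * w).natAbs → x3 ≤ 1)
    (u4 : v.natAbs ≤ (v + -2 * w).natAbs → x4 ≤ 1) :
    x1 + x2 + x3 + x4 ≤ 73/20 := by
  rcases lt_trichotomy v.natAbs w.natAbs with h | h | h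
  · have := t3 (by omega)
    have := t4 (by omega)
    by_cases hz : v = 0
    · have := u1 (by omega)
      have := u2 (by omega)
      linarith
    · by_cases hs : w.natAbs < (w + 2 * v).natAbs
      · have := t1 hs; linarith
      · have := t2 (by omega); linarith
  · by_cases hs : w.natAbs < (w + 2 * v).natAbs
    · have := t1 hs
      have := u2 (by omega)
      have := t3 (by omega)
      have := u4 (by omega)
      linarith
    · have := t2 (by omega)
      have := u1 (by omega)
      have := t4 (by omega)
      have := u3 (by omega)
      linarith
  · have := t1 (by omega)
    have := t2 (by omega)
    by_cases hz : w = 0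
    · have := u3 (by omega)
      have := u4 (by omega)
      linarith
    · by_cases hs : v.natAbs < (v + 2 * w).natAbs
      · have := t3 hs; linarith
      · have := t4 (by omega); linarith

section GG
variable {k : ℕ} [NeZero k]

noncomputable def gg_n (a : ZMod k) : ℕ := a.valMinAbs.natAbs

lemma gg_n_cmp (a b : ZMod k) (w v : ℤ) (ha : a = v) (hb : b.valMinAbs = w) (e : ℤ)
    (he : e = 2 ∨ e = -2)
    (hd : 2 * (v.natAbs + w.natAbs) < k) :
    ((w.natAbs < (w + e * v).natAbs) → gg_n b < gg_n (b + (e : ZMod k) * a)) ∧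
    ((w.natAbs ≤ (w + e * v).natAbs) → gg_n b ≤ gg_n (b + (e : ZMod k) * a)) := by
  unfold gg_n
  rw [hb]
  obtain ⟨t, ht⟩ : ∃ t : ℤ, (b + (e : ZMod k) * a).valMinAbs = w + e * v + k * t := by
    have h1 : (((b + (e : ZMod k) * a).valMinAbs : ℤ) : ZMod k) = ((w + e * v : ℤ) : ZMod k) := by
      rw [ZMod.coe_valMinAbs, ← hb, ha]; push_cast; simp
    rw [ZMod.intCast_eq_intCast_iff_dvd_sub] at h1
    obtain ⟨t, ht⟩ := h1
    exact ⟨-t, by linarith⟩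
  rw [ht]
  rcases eq_or_ne t 0 with h0 | h0
  · subst h0; simp
  · have hk : (k : ℤ) ≤ |(k : ℤ) * t| := by
      rw [abs_mul, Nat.abs_cast]
      have : 1 ≤ |t| := Int.one_le_abs h0
      have hk0 : (0 : ℤ) ≤ k := by positivity
      nlinarith
    have : w.natAbs < (w + e * v + k * t).natAbs := by
      rw [Int.abs_eq_natAbs] at hk
      generalize (k : ℤ) * t = K at *
      rcases he with rfl | rfl <;> omega
    exact ⟨fun _ => this, fun _ => this.le⟩

noncomputable def gg_c (a : ZMod k) : ℝ := Real.cos (Real.pi * gg_n a / k)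

lemma gg_ang (a : ZMod k) : 0 ≤ Real.pi * gg_n a / k ∧ Real.pi * gg_n a / k ≤ Real.pi / 2 := by
  have hk : (0 : ℝ) < k := by exact_mod_cast Nat.pos_of_ne_zero (NeZero.ne k)
  have hpi := Real.pi_pos
  refine ⟨by positivity, ?_⟩
  have h := ZMod.natAbs_valMinAbs_le a
  have h2 : 2 * gg_n a ≤ k := by unfold gg_n; omega
  have h3 : (2 : ℝ) * gg_n a ≤ k := by exact_mod_cast h2
  rw [div_le_iff₀ hk]
  nlinarith

lemma gg_c_nonneg (a : ZMod k) : 0 ≤ gg_c a := by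
  have := gg_ang a
  exact Real.cos_nonneg_of_neg_pi_div_two_le_of_le (by linarith [Real.pi_pos]) this.2

lemma gg_c_le (a : ZMod k) : gg_c a ≤ 1 := Real.cos_le_one _

lemma gg_c_norm (a : ZMod k) : ‖1 + (ZMod.stdAddChar a : ℂ)‖ = 2 * gg_c a := by
  set v := a.valMinAbs with hv
  have h1 : (ZMod.stdAddChar a : ℂ) = Complex.exp (2 * Real.pi * Complex.I * v / k) := by
    rw [← ZMod.stdAddChar_coe, hv, ZMod.coe_valMinAbs]
  set θ : ℝ := Real.pi * v / k with hθ
  have h2 : 1 + Complex.exp (2 * Real.pi * Complex.I * v / k)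
      = Complex.exp (θ * Complex.I) * (2 * Complex.cos θ) := by
    rw [Complex.two_cos, mul_add, ← Complex.exp_add, ← Complex.exp_add]
    rw [show (θ : ℂ) * Complex.I + -θ * Complex.I = 0 by ring, Complex.exp_zero, add_comm]
    congr 2
    rw [hθ]; push_cast; ring
  rw [h1, h2, norm_mul, Complex.norm_exp_ofReal_mul_I, one_mul, norm_mul, ← Complex.ofReal_cos,
    Complex.norm_real, Complex.norm_two, Real.norm_eq_abs]
  have h3 : Real.cos θ = gg_c a := by
    unfold gg_c gg_n
    rw [hθ, ← hv]
    rcases abs_choice (v : ℝ) with h | h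
    · have : ((v.natAbs : ℕ) : ℝ) = v := by rw [Nat.cast_natAbs, Int.cast_abs, h]
      rw [this]
    · have : ((v.natAbs : ℕ) : ℝ) = -v := by rw [Nat.cast_natAbs, Int.cast_abs, h]
      rw [this, ← Real.cos_neg]; congr 1; ring
  rw [h3, abs_of_nonneg (gg_c_nonneg a)]

lemma gg_weight (a b : ZMod k) (h0 : ¬ (a = 0 ∧ b = 0)) :
    gg_c a * (gg_w (gg_n b) (gg_n (b + 2 * a)) + gg_w (gg_n b) (gg_n (b - 2 * a)))
    + gg_c b * (gg_w (gg_n a) (gg_n (a + 2 * b)) + gg_w (gg_n a) (gg_n (a - 2 * b))) ≤ 73/20 := by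
  have ca := gg_c_nonneg a
  have cb := gg_c_nonneg b
  have ca1 := gg_c_le a
  have cb1 := gg_c_le b
  by_cases hd : 2 * (gg_n a + gg_n b) < k
  · have p1 := gg_w_pos (gg_n b) (gg_n (b + 2 * a))
    have p2 := gg_w_pos (gg_n b) (gg_n (b - 2 * a))
    have p3 := gg_w_pos (gg_n a) (gg_n (a + 2 * b))
    have p4 := gg_w_pos (gg_n a) (gg_n (a - 2 * b))
    have q1 := gg_w_le (gg_n b) (gg_n (b + 2 * a))
    have q2 := gg_w_le (gg_n b) (gg_n (b - 2 * a))
    have q3 := gg_w_le (gg_n a) (gg_n (a + 2 * b))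
    have q4 := gg_w_le (gg_n a) (gg_n (a - 2 * b))
    set v := a.valMinAbs with hv
    set w := b.valMinAbs with hw
    have hav : a = (v : ZMod k) := (ZMod.coe_valMinAbs a).symm
    have hbw : b = (w : ZMod k) := (ZMod.coe_valMinAbs b).symm
    have hd1 : 2 * (v.natAbs + w.natAbs) < k := hd
    have hd2 : 2 * (w.natAbs + v.natAbs) < k := by omega
    have r1 := gg_n_cmp a b w v hav hw.symm 2 (Or.inl rfl) hd1
    have r2 := gg_n_cmp a b w v hav hw.symm (-2) (Or.inr rfl) hd1
    have r3 := gg_n_cmp b a v w hbw hv.symm 2 (Or.inl rfl) hd2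
    have r4 := gg_n_cmp b a v w hbw hv.symm (-2) (Or.inr rfl) hd2
    have s1 : b + ((2 : ℤ) : ZMod k) * a = b + 2 * a := by push_cast; ring
    have s2 : b + ((-2 : ℤ) : ZMod k) * a = b - 2 * a := by push_cast; ring
    have s3 : a + ((2 : ℤ) : ZMod k) * b = a + 2 * b := by push_cast; ring
    have s4 : a + ((-2 : ℤ) : ZMod k) * b = a - 2 * b := by push_cast; ring
    rw [s1] at r1; rw [s2] at r2; rw [s3] at r3; rw [s4] at r4
    have hne : ¬ (v = 0 ∧ w = 0) := by
      rintro ⟨e1, e2⟩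
      apply h0
      rw [hav, hbw, e1, e2]; simp
    have key : gg_w (gg_n b) (gg_n (b + 2 * a)) + gg_w (gg_n b) (gg_n (b - 2 * a))
        + gg_w (gg_n a) (gg_n (a + 2 * b)) + gg_w (gg_n a) (gg_n (a - 2 * b)) ≤ 73/20 :=
      gg_key v w hne _ _ _ _ q1 q2 q3 q4 (fun h => gg_w_lt (r1.1 h)) (fun h => gg_w_lt (r2.1 h))
        (fun h => gg_w_lt (r3.1 h)) (fun h => gg_w_lt (r4.1 h)) (fun h => gg_w_le_one (r1.2 h))
        (fun h => gg_w_le_one (r2.2 h)) (fun h => gg_w_le_one (r3.2 h)) (fun h => gg_w_le_one (r4.2 h))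
    have m1 := mul_le_mul_of_nonneg_right ca1 (add_pos p1 p2).le
    have m2 := mul_le_mul_of_nonneg_right cb1 (add_pos p3 p4).le
    linarith
  · have hk : (0 : ℝ) < k := by exact_mod_cast Nat.pos_of_ne_zero (NeZero.ne k)
    have hsum : gg_c a + gg_c b ≤ 1.42 := by
      have hA := gg_ang a
      have hB := gg_ang b
      have hAB : Real.pi / 2 - Real.pi * gg_n a / k ≤ Real.pi * gg_n b / k := by
        have : (k : ℝ) ≤ 2 * (gg_n a + gg_n b) := by exact_mod_cast not_lt.mp hd
        have e : Real.pi * gg_n a / k + Real.pi * gg_n b / k = Real.pi * (gg_n a + gg_n b) / k := by ring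
        have : Real.pi / 2 ≤ Real.pi * (gg_n a + gg_n b) / k := by
          rw [le_div_iff₀ hk]; nlinarith [Real.pi_pos]
        linarith
      have h1 : gg_c b ≤ Real.sin (Real.pi * gg_n a / k) := by
        rw [← Real.cos_pi_div_two_sub]
        unfold gg_c
        exact Real.cos_le_cos_of_nonneg_of_le_pi (by linarith) (by linarith [Real.pi_pos]) hAB
      have h2 := Real.sin_sq_add_cos_sq (Real.pi * gg_n a / k)
      have h3 : gg_c a = Real.cos (Real.pi * gg_n a / k) := rfl
      rw [h3]
      nlinarith [sq_nonneg (Real.sin (Real.pi * gg_n a / k) - Real.cos (Real.pi * gg_n a / k)),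
        sq_nonneg (Real.sin (Real.pi * gg_n a / k) + Real.cos (Real.pi * gg_n a / k))]
    have q1 := gg_w_le (gg_n b) (gg_n (b + 2 * a))
    have q2 := gg_w_le (gg_n b) (gg_n (b - 2 * a))
    have q3 := gg_w_le (gg_n a) (gg_n (a + 2 * b))
    have q4 := gg_w_le (gg_n a) (gg_n (a - 2 * b))
    nlinarith

end GG


section GG
variable {k : ℕ} [NeZero k]

lemma gg_comb (F : ZMod k → ZMod k → ℝ) (h0 : F 0 0 = 0) :
    ∑ a, ∑ b, 2 * gg_c a * (F a b * F a (b - 2 * a)) + ∑ a, ∑ b, 2 * gg_c b * (F a b * F (a - 2 * b) b)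
      ≤ 73/20 * ∑ a, ∑ b, F a b ^ 2 := by
  have hA : ∀ (G : ZMod k → ℝ) (a : ZMod k), ∑ b, 2 * (G b * G (b - 2 * a)) ≤
      ∑ b, (gg_w (gg_n b) (gg_n (b + 2 * a)) + gg_w (gg_n b) (gg_n (b - 2 * a))) * G b ^ 2 := by
    intro G a
    calc ∑ b, 2 * (G b * G (b - 2 * a)) ≤
        ∑ b, (gg_w (gg_n b) (gg_n (b - 2 * a)) * G b ^ 2
          + gg_w (gg_n (b - 2 * a)) (gg_n b) * G (b - 2 * a) ^ 2) :=
          Finset.sum_le_sum fun b _ => gg_w_amgm _ _ _ _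
      _ = ∑ b, gg_w (gg_n b) (gg_n (b - 2 * a)) * G b ^ 2
          + ∑ b, gg_w (gg_n b) (gg_n (b + 2 * a)) * G b ^ 2 := by
          rw [Finset.sum_add_distrib]
          congr 1
          refine Fintype.sum_equiv (Equiv.subRight (2 * a)) _ _ fun b => ?_
          simp
      _ = _ := by
          rw [← Finset.sum_add_distrib]
          refine Finset.sum_congr rfl fun b _ => ?_
          ring
  have h1 : ∑ a, ∑ b, 2 * gg_c a * (F a b * F a (b - 2 * a)) ≤
      ∑ a, ∑ b, gg_c a * (gg_w (gg_n b) (gg_n (b + 2 * a)) + gg_w (gg_n b) (gg_n (b - 2 * a))) * F a b ^ 2 := by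
    refine Finset.sum_le_sum fun a _ => ?_
    have := mul_le_mul_of_nonneg_left (hA (F a) a) (gg_c_nonneg a)
    rw [Finset.mul_sum, Finset.mul_sum] at this
    calc _ = _ := Finset.sum_congr rfl fun b _ => by ring
      _ ≤ _ := this
      _ = _ := Finset.sum_congr rfl fun b _ => by ring
  have h2 : ∑ a, ∑ b, 2 * gg_c b * (F a b * F (a - 2 * b) b) ≤
      ∑ a, ∑ b, gg_c b * (gg_w (gg_n a) (gg_n (a + 2 * b)) + gg_w (gg_n a) (gg_n (a - 2 * b))) * F a b ^ 2 := by
    rw [Finset.sum_comm]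
    conv_rhs => rw [Finset.sum_comm]
    refine Finset.sum_le_sum fun b _ => ?_
    have := mul_le_mul_of_nonneg_left (hA (fun a => F a b) b) (gg_c_nonneg b)
    rw [Finset.mul_sum, Finset.mul_sum] at this
    calc _ = _ := Finset.sum_congr rfl fun a _ => by ring
      _ ≤ _ := this
      _ = _ := Finset.sum_congr rfl fun a _ => by ring
  refine (add_le_add h1 h2).trans ?_
  rw [← Finset.sum_add_distrib, Finset.mul_sum]
  refine Finset.sum_le_sum fun a _ => ?_
  rw [← Finset.sum_add_distrib, Finset.mul_sum]
  refine Finset.sum_le_sum fun b _ => ?_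
  by_cases h : a = 0 ∧ b = 0
  · rw [h.1, h.2, h0]; simp
  · have := mul_le_mul_of_nonneg_right (gg_weight a b h) (sq_nonneg (F a b))
    linarith

noncomputable def gg_chi (ab : ZMod k × ZMod k) : AddChar (ZMod k × ZMod k) ℂ where
  toFun p := ZMod.stdAddChar (ab.1 * p.1 + ab.2 * p.2)
  map_zero_eq_one' := by simp
  map_add_eq_mul' := by
    intro x y
    rw [← AddChar.map_add_eq_mul]; congr 1; simp; ring

lemma gg_chi_apply (a b x y : ZMod k) : gg_chi (a, b) (x, y) = ZMod.stdAddChar (a * x + b * y) := rfl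

lemma gg_chi_sum (p : ZMod k × ZMod k) :
    ∑ c, gg_chi c p = if p = 0 then (Fintype.card (ZMod k × ZMod k) : ℂ) else 0 := by
  obtain ⟨x, y⟩ := p
  rw [Fintype.sum_prod_type]
  simp only [gg_chi_apply, AddChar.map_add_eq_mul]
  rw [← Finset.sum_mul_sum, AddChar.sum_mulShift _ (ZMod.isPrimitive_stdAddChar k),
    AddChar.sum_mulShift _ (ZMod.isPrimitive_stdAddChar k)]
  by_cases hx : x = 0 <;> by_cases hy : y = 0 <;> simp [hx, hy]

noncomputable def gg_h (f : ZMod k → ZMod k → ℝ) (a b : ZMod k) : ℂ :=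
  ∑ p : ZMod k × ZMod k, (f p.1 p.2 : ℂ) * gg_chi (a, b) p

lemma gg_h_shear (f : ZMod k → ZMod k → ℝ) (t a b : ZMod k) :
    gg_h (fun x y => f (x + 2 * y + t) y) a b = ZMod.stdAddChar (-(a * t)) * gg_h f a (b - 2 * a) := by
  unfold gg_h
  rw [Finset.mul_sum, Fintype.sum_prod_type_right, Fintype.sum_prod_type_right]
  refine Finset.sum_congr rfl fun y _ => ?_
  refine Fintype.sum_equiv (Equiv.addRight (2 * y + t)) _ _ fun x => ?_
  simp only [Equiv.coe_addRight, gg_chi_apply]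
  rw [mul_left_comm, ← AddChar.map_add_eq_mul, add_assoc]
  congr 2
  ring

lemma gg_h_swap (f : ZMod k → ZMod k → ℝ) (a b : ZMod k) :
    gg_h (fun x y => f y x) a b = gg_h f b a := by
  unfold gg_h
  refine Fintype.sum_equiv (Equiv.prodComm _ _) _ _ fun p => ?_
  obtain ⟨x, y⟩ := p
  simp [gg_chi_apply, add_comm]

lemma gg_pars (f g : ZMod k → ZMod k → ℝ) :
    ∑ a, ∑ b, gg_h f a b * (starRingEnd ℂ) (gg_h g a b) = (k : ℂ) ^ 2 * ∑ x, ∑ y, (f x y : ℂ) * g x y := by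
  have := eq_parseval gg_chi gg_chi_sum (fun p => f p.1 p.2) (fun p => g p.1 p.2) (0 : ZMod k × ZMod k)
  simp only [AddChar.map_zero_eq_one, one_mul, add_zero] at this
  rw [Fintype.sum_prod_type, Fintype.sum_prod_type] at this
  rw [show ((k : ℂ) ^ 2) = (Fintype.card (ZMod k × ZMod k) : ℂ) by simp [sq]]
  exact this

lemma gg_pars_sq (f : ZMod k → ZMod k → ℝ) :
    ∑ a, ∑ b, ‖gg_h f a b‖ ^ 2 = (k : ℝ) ^ 2 * ∑ x, ∑ y, f x y ^ 2 := by
  have := gg_pars f f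
  have h2 : ∀ a b, gg_h f a b * (starRingEnd ℂ) (gg_h f a b) = ((‖gg_h f a b‖ ^ 2 : ℝ) : ℂ) := by
    intro a b; rw [Complex.mul_conj, Complex.normSq_eq_norm_sq]
  simp_rw [h2] at this
  have h3 : ((∑ a, ∑ b, ‖gg_h f a b‖ ^ 2 : ℝ) : ℂ) = (((k : ℝ) ^ 2 * ∑ x, ∑ y, f x y ^ 2 : ℝ) : ℂ) := by
    push_cast
    push_cast at this
    rw [this]
    simp_rw [sq]
  exact_mod_cast h3

lemma gg_half (f : ZMod k → ZMod k → ℝ) :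
    (k : ℝ) ^ 2 * |∑ x, ∑ y, f x y * f (x + 2 * y + 0) y + ∑ x, ∑ y, f x y * f (x + 2 * y + 1) y|
      ≤ ∑ a, ∑ b, 2 * gg_c a * (‖gg_h f a b‖ * ‖gg_h f a (b - 2 * a)‖) := by
  have h1 := gg_pars f (fun x y => f (x + 2 * y + 0) y)
  have h2 := gg_pars f (fun x y => f (x + 2 * y + 1) y)
  have h3 : (((k : ℝ) ^ 2 * (∑ x, ∑ y, f x y * f (x + 2 * y + 0) y + ∑ x, ∑ y, f x y * f (x + 2 * y + 1) y) : ℝ) : ℂ)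
     = ∑ a, ∑ b, (starRingEnd ℂ) (1 + ZMod.stdAddChar (-a)) *
        (gg_h f a b * (starRingEnd ℂ) (gg_h f a (b - 2 * a))) := by
    push_cast
    rw [mul_add, ← h1, ← h2, ← Finset.sum_add_distrib]
    refine Finset.sum_congr rfl fun a _ => ?_
    rw [← Finset.sum_add_distrib]
    refine Finset.sum_congr rfl fun b _ => ?_
    rw [gg_h_shear, gg_h_shear]
    simp
    ring
  have h4 : (k : ℝ) ^ 2 * |∑ x, ∑ y, f x y * f (x + 2 * y + 0) y + ∑ x, ∑ y, f x y * f (x + 2 * y + 1) y|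
     = ‖(((k : ℝ) ^ 2 * (∑ x, ∑ y, f x y * f (x + 2 * y + 0) y + ∑ x, ∑ y, f x y * f (x + 2 * y + 1) y) : ℝ) : ℂ)‖ := by
    rw [Complex.norm_real, Real.norm_eq_abs, abs_mul, abs_of_nonneg (by positivity : (0:ℝ) ≤ (k:ℝ)^2)]
  rw [h4, h3]
  refine (norm_sum_le _ _).trans (Finset.sum_le_sum fun a _ => ?_)
  refine (norm_sum_le _ _).trans (Finset.sum_le_sum fun b _ => ?_)
  rw [norm_mul, norm_mul, RCLike.norm_conj, RCLike.norm_conj]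
  have : ‖1 + (ZMod.stdAddChar (-a) : ℂ)‖ = 2 * gg_c a := by
    rw [← gg_c_norm, AddChar.map_neg_eq_conj, ← RCLike.norm_conj (1 + (ZMod.stdAddChar a : ℂ))]
    simp
  rw [this]

lemma gg_quad (f : ZMod k → ZMod k → ℝ) (hf : ∑ x, ∑ y, f x y = 0) :
    |(∑ x, ∑ y, f x y * f (x + 2 * y + 0) y + ∑ x, ∑ y, f x y * f (x + 2 * y + 1) y)
     + (∑ x, ∑ y, f x y * f x (y + 2 * x + 0) + ∑ x, ∑ y, f x y * f x (y + 2 * x + 1))|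
      ≤ 73/20 * ∑ x, ∑ y, f x y ^ 2 := by
  have hk : (0 : ℝ) < (k : ℝ) ^ 2 := by
    have : (0 : ℝ) < k := by exact_mod_cast Nat.pos_of_ne_zero (NeZero.ne k)
    positivity
  have h1 := gg_half f
  have h2 := gg_half (fun x y => f y x)
  simp only [gg_h_swap] at h2
  have e1 : ∀ t : ZMod k, ∑ x, ∑ y, f y x * f y (x + 2 * y + t) = ∑ x, ∑ y, f x y * f x (y + 2 * x + t) :=
    fun t => Finset.sum_comm
  rw [e1, e1, Finset.sum_comm (s := (Finset.univ : Finset (ZMod k)))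
    (f := fun a b => 2 * gg_c a * (‖gg_h f b a‖ * ‖gg_h f (b - 2 * a) a‖))] at h2
  have h3 := gg_comb (fun a b => ‖gg_h f a b‖) (by
    have : gg_h f 0 0 = ((∑ x, ∑ y, f x y : ℝ) : ℂ) := by
      unfold gg_h
      rw [Fintype.sum_prod_type]
      simp [gg_chi_apply]
    simp only [this, hf]; simp)
  rw [gg_pars_sq] at h3
  have h4 := abs_add_le (∑ x, ∑ y, f x y * f (x + 2 * y + 0) y + ∑ x, ∑ y, f x y * f (x + 2 * y + 1) y)
     (∑ x, ∑ y, f x y * f x (y + 2 * x + 0) + ∑ x, ∑ y, f x y * f x (y + 2 * x + 1))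
  refine le_of_mul_le_mul_left ?_ hk
  have h5 := mul_le_mul_of_nonneg_left h4 hk.le
  linarith

def gg_S (t : ZMod k) : (ZMod k × ZMod k) ≃ (ZMod k × ZMod k) where
  toFun p := (p.1 + 2 * p.2 + t, p.2)
  invFun p := (p.1 - 2 * p.2 - t, p.2)
  left_inv p := by ext <;> simp; ring
  right_inv p := by ext <;> simp; ring

def gg_T (t : ZMod k) : (ZMod k × ZMod k) ≃ (ZMod k × ZMod k) where
  toFun p := (p.1, p.2 + 2 * p.1 + t)
  invFun p := (p.1, p.2 - 2 * p.1 - t)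
  left_inv p := by ext <;> simp; ring
  right_inv p := by ext <;> simp; ring

/-- adjacency counts of a permutation, symmetrized -/
def pm {V : Type*} [DecidableEq V] (g : V ≃ V) (u v : V) : ℕ :=
  (if g u = v then 1 else 0) + (if g v = u then 1 else 0)

lemma pm_symm {V : Type*} [DecidableEq V] (g : V ≃ V) (u v : V) : pm g u v = pm g v u := by
  unfold pm; rw [add_comm]

lemma pm_row {V : Type*} [Fintype V] [DecidableEq V] (g : V ≃ V) (u : V) : ∑ v, pm g u v = 2 := by
  unfold pm
  rw [Finset.sum_add_distrib]
  have : ∀ v, (if g v = u then 1 else 0) = if g.symm u = v then 1 else 0 := by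
    intro v; congr 1; rw [Equiv.symm_apply_eq]; simp [eq_comm]
  simp [this]

lemma pm_quad {V : Type*} [Fintype V] [DecidableEq V] (g : V ≃ V) (f : V → ℝ) :
    ∑ u, ∑ v, (pm g u v : ℝ) * f u * f v = 2 * ∑ u, f u * f (g u) := by
  unfold pm
  have h : ∑ u, ∑ v, (if g u = v then (1:ℝ) else 0) * f u * f v = ∑ u, f u * f (g u) := by
    refine Finset.sum_congr rfl fun u _ => ?_
    simp [ite_mul]
  have h' : ∑ u, ∑ v, (if g v = u then (1:ℝ) else 0) * f u * f v = ∑ u, f u * f (g u) := by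
    rw [Finset.sum_comm, ← h]
    refine Finset.sum_congr rfl fun u _ => Finset.sum_congr rfl fun v _ => ?_
    ring
  rw [two_mul]
  nth_rw 1 [← h]
  rw [← h', ← Finset.sum_add_distrib]
  refine Finset.sum_congr rfl fun u _ => ?_
  rw [← Finset.sum_add_distrib]
  refine Finset.sum_congr rfl fun v _ => ?_
  push_cast
  ring

def gg_P (u v : ZMod k × ZMod k) : ℕ := pm (gg_S 0) u v + pm (gg_S 1) u v + pm (gg_T 0) u v + pm (gg_T 1) u v

lemma gg_P_quad (f : ZMod k × ZMod k → ℝ) (hf : ∑ v, f v = 0) :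
    |∑ u, ∑ v, (gg_P u v : ℝ) * f u * f v| ≤ 73/10 * ∑ v, f v ^ 2 := by
  have h := gg_quad (fun x y => f (x, y)) (by rw [← hf, Fintype.sum_prod_type])
  have e : ∑ u, ∑ v, (gg_P u v : ℝ) * f u * f v = 2 * ((∑ u, f u * f (gg_S 0 u) + ∑ u, f u * f (gg_S 1 u))
      + (∑ u, f u * f (gg_T 0 u) + ∑ u, f u * f (gg_T 1 u))) := by
    rw [mul_add, mul_add, mul_add, ← pm_quad, ← pm_quad, ← pm_quad, ← pm_quad]
    simp only [← Finset.sum_add_distrib]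
    refine Finset.sum_congr rfl fun u _ => Finset.sum_congr rfl fun v _ => ?_
    unfold gg_P
    push_cast
    ring
  rw [e, abs_mul, abs_two]
  simp only [Fintype.sum_prod_type] at *
  have : ∀ a b : ℝ, a ≤ 73/20 * b → 2 * a ≤ 73/10 * b := fun a b h => by linarith
  exact this _ _ h
end GG

/-- expanders of every size `k ^ 2` -/
lemma expander_exists (μ : ℝ) (hμ : 0 < μ) : ∃ p : ℕ, 0 < p ∧ ∀ k : ℕ, 0 < k →
    ∃ P : (ZMod k × ZMod k) → (ZMod k × ZMod k) → ℕ, ∃ _ : Fintype (ZMod k),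
      (∀ u v, P u v = P v u) ∧ (∀ u, ∑ v, P u v = p) ∧
      ∀ f : ZMod k × ZMod k → ℝ, ∑ v, f v = 0 →
        ∑ u, (∑ v, (P u v : ℝ) * f v) ^ 2 ≤ μ ^ 2 * (p : ℝ) ^ 2 * ∑ v, f v ^ 2 := by
  obtain ⟨r, hr⟩ := exists_pow_lt_of_lt_one hμ (by norm_num : (73/80 : ℝ) < 1)
  refine ⟨8 ^ r, by positivity, fun k hk => ?_⟩
  haveI : NeZero k := ⟨hk.ne'⟩
  suffices H : ∀ r : ℕ, ∃ P : (ZMod k × ZMod k) → (ZMod k × ZMod k) → ℕ, 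
      (∀ u v, P u v = P v u) ∧ (∀ u v, ∑ w, P u w * gg_P w v = ∑ w, gg_P u w * P w v) ∧ (∀ u, ∑ v, P u v = 8 ^ r) ∧
      ∀ f : ZMod k × ZMod k → ℝ, ∑ v, f v = 0 →
        ∑ u, (∑ v, (P u v : ℝ) * f v) ^ 2 ≤ ((73/10) ^ r) ^ 2 * ∑ v, f v ^ 2 by
    obtain ⟨P, h1, h1', h2, h3⟩ := H r
    refine ⟨P, inferInstance, h1, h2, fun f hf => (h3 f hf).trans ?_⟩
    refine mul_le_mul_of_nonneg_right ?_ (Finset.sum_nonneg fun _ _ => sq_nonneg _)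
    rw [← mul_pow]
    refine pow_le_pow_left₀ (by positivity) ?_ 2
    push_cast
    have : (73/10 : ℝ) ^ r = (73/80) ^ r * 8 ^ r := by rw [← mul_pow]; norm_num
    rw [this]
    exact mul_le_mul_of_nonneg_right hr.le (by positivity)
  have gs : ∀ u v : ZMod k × ZMod k, gg_P u v = gg_P v u := by
    intro u v
    simp only [gg_P, pm_symm _ u v]
  have gr : ∀ u : ZMod k × ZMod k, ∑ v, gg_P u v = 8 := by
    intro u
    simp only [gg_P, Finset.sum_add_distrib, pm_row]
  intro r
  induction r with
  | zero =>
    refine ⟨fun u v => if u = v then 1 else 0, ?_, ?_, ?_, ?_⟩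
    · intro u v; simp [eq_comm]
    · intro u v; simp
    · intro u; simp
    · intro f hf; simp
  | succ r ih =>
    obtain ⟨P, h1, h1', h2, h3⟩ := ih
    refine ⟨fun u v => ∑ w, P u w * gg_P w v, ?_, ?_, ?_, ?_⟩
    · intro u v
      show ∑ w, P u w * gg_P w v = ∑ w, P v w * gg_P w u
      rw [h1' u v]
      refine Finset.sum_congr rfl fun w _ => ?_
      rw [h1 v w, gs w u, mul_comm]
    · intro u v
      simp_rw [h1' u, h1', Finset.sum_mul, Finset.mul_sum]
      rw [Finset.sum_comm]
      simp_rw [mul_assoc, ← Finset.mul_sum, h1']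
    · intro u
      rw [Finset.sum_comm]
      simp_rw [← Finset.mul_sum, gr, ← Finset.sum_mul, h2, pow_succ]
    · intro f hf
      have e : ∀ u, ∑ v, ((∑ w, P u w * gg_P w v : ℕ) : ℝ) * f v = ∑ w, (P u w : ℝ) * ∑ v, (gg_P w v : ℝ) * f v := by
        intro u
        push_cast
        simp_rw [Finset.sum_mul, Finset.mul_sum]
        rw [Finset.sum_comm]
        simp_rw [mul_assoc]
      simp_rw [e]
      have gs' : ∀ u v : ZMod k × ZMod k, (gg_P u v : ℝ) = gg_P v u := fun u v => by rw [gs]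
      have gr' : ∀ u : ZMod k × ZMod k, ∑ v, (gg_P u v : ℝ) = 8 := fun u => by exact_mod_cast gr u
      refine (h3 _ ?_).trans ?_
      · rw [Finset.sum_comm]
        simp_rw [← Finset.sum_mul, gs' _, gr', ← Finset.mul_sum, hf, mul_zero]
      · have := eq_norm_of_quad (fun u v => (gg_P u v : ℝ)) gs' 8 (73/10) (by norm_num) gr'
          (fun f hf => gg_P_quad f hf) f hf
        calc _ ≤ ((73/10 : ℝ) ^ r) ^ 2 * ((73/10) ^ 2 * ∑ v, f v ^ 2) :=
              mul_le_mul_of_nonneg_left this (by positivity)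
          _ = _ := by rw [pow_succ]; ring


section StB
lemma sb_contr {Y : Type*} [Fintype Y] (P : Y → Y → ℝ) (hP : ∀ u v, 0 ≤ P u v)
    (hs : ∀ u v, P u v = P v u) (p : ℝ) (hr : ∀ u, ∑ v, P u v = p) (F : Y → ℝ) :
    ∑ z, (∑ y, P z y * F y) ^ 2 ≤ p ^ 2 * ∑ y, F y ^ 2 := by
  have h1 : ∀ z, (∑ y, P z y * F y) ^ 2 ≤ p * ∑ y, P z y * F y ^ 2 := by
    intro z
    rw [← hr z]
    refine Finset.sum_sq_le_sum_mul_sum_of_sq_eq_mul _ (fun y _ => hP z y) (fun y _ => mul_nonneg (hP z y) (sq_nonneg _)) ?_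
    intro y _; ring
  calc _ ≤ ∑ z, p * ∑ y, P z y * F y ^ 2 := Finset.sum_le_sum fun z _ => h1 z
    _ = _ := by
      rw [← Finset.mul_sum, Finset.sum_comm]
      simp_rw [← Finset.sum_mul, hs _, hr, ← Finset.mul_sum]
      ring

lemma sb_gap {Y : Type*} [Fintype Y] [Nonempty Y] (P : Y → Y → ℝ)
    (hs : ∀ u v, P u v = P v u) (p μ ρ : ℝ) (hp : 0 ≤ p) (hμ : 0 ≤ μ) (hρ : 0 ≤ ρ) (hr : ∀ u, ∑ v, P u v = p)
    (hg : ∀ f : Y → ℝ, ∑ v, f v = 0 →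
        ∑ u, (∑ v, (P u v : ℝ) * f v) ^ 2 ≤ μ ^ 2 * (p : ℝ) ^ 2 * ∑ v, f v ^ 2)
    (w : Y → ℝ) (hw : ∀ z, |w z| ≤ 14) (hw' : |∑ z, w z| ≤ 14 * ρ * Fintype.card Y) (F : Y → ℝ) :
    ∑ z, w z * (∑ y, P z y * F y) ^ 2 ≤ 14 * p ^ 2 * (ρ + μ + μ ^ 2) * ∑ y, F y ^ 2 := by
  set n : ℝ := (Fintype.card Y : ℝ) with hn
  have hn0 : 0 < n := by rw [hn]; exact_mod_cast Fintype.card_pos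
  set c : ℝ := (∑ y, F y) / n with hc
  set F0 : Y → ℝ := fun y => F y - c with hF0
  have s0 : ∑ y, F0 y = 0 := by
    simp only [hF0, Finset.sum_sub_distrib, Finset.sum_const, Finset.card_univ, nsmul_eq_mul]
    rw [← hn, hc]; field_simp; ring
  have e1 : ∀ z, ∑ y, P z y * F y = p * c + ∑ y, P z y * F0 y := by
    intro z
    simp only [hF0, mul_sub, Finset.sum_sub_distrib, ← Finset.sum_mul, hr]
    ring
  set H : Y → ℝ := fun z => ∑ y, P z y * F0 y with hH
  have hH2 : ∑ z, H z ^ 2 ≤ μ ^ 2 * p ^ 2 * ∑ y, F0 y ^ 2 := hg F0 s0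
  have e2 : ∑ y, F y ^ 2 = n * c ^ 2 + ∑ y, F0 y ^ 2 := by
    have : ∀ y, F y ^ 2 = c ^ 2 + 2 * c * F0 y + F0 y ^ 2 := by intro y; simp only [hF0]; ring
    simp only [this, Finset.sum_add_distrib, ← Finset.mul_sum, s0]
    simp [hn]
  have hF0n : 0 ≤ ∑ y, F0 y ^ 2 := Finset.sum_nonneg fun _ _ => sq_nonneg _
  simp only [e1]
  -- termwise
  have hterm : ∀ z, w z * (p * c + H z) ^ 2 ≤ (p * c) ^ 2 * w z + 14 * (μ * (p * c) ^ 2) + 28 * |p * c * H z| - 14 * (μ * (p * c) ^ 2) + 14 * H z ^ 2 := by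
    intro z
    have := abs_le.1 (hw z)
    have h1 : w z * (2 * (p * c * H z)) ≤ 28 * |p * c * H z| := by
      calc w z * (2 * (p * c * H z)) ≤ |w z * (2 * (p * c * H z))| := le_abs_self _
        _ = |w z| * (2 * |p * c * H z|) := by rw [abs_mul, abs_mul, abs_two]
        _ ≤ 14 * (2 * |p * c * H z|) := by gcongr; exact hw z
        _ = _ := by ring
    nlinarith [sq_nonneg (H z)]
  have hcs : ∑ z, |p * c * H z| ≤ p * |c| * (Real.sqrt n * Real.sqrt (∑ z, H z ^ 2)) := by
    have : ∑ z, (1:ℝ) * |H z| ≤ Real.sqrt (∑ z : Y, (1:ℝ) ^ 2) * Real.sqrt (∑ z, |H z| ^ 2) := Real.sum_mul_le_sqrt_mul_sqrt _ _ _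
    simp only [one_mul, one_pow, Finset.sum_const, Finset.card_univ, nsmul_eq_mul, mul_one, sq_abs, ← hn] at this
    simp only [abs_mul, abs_of_nonneg hp, ← Finset.mul_sum]
    gcongr
  have hsq : Real.sqrt (∑ z, H z ^ 2) ≤ μ * p * Real.sqrt (∑ y, F0 y ^ 2) := by
    rw [Real.sqrt_le_left (by positivity), mul_pow, mul_pow, Real.sq_sqrt hF0n]
    exact hH2
  set q := Real.sqrt (∑ y, F0 y ^ 2) with hq
  have hq2 : q ^ 2 = ∑ y, F0 y ^ 2 := Real.sq_sqrt hF0n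
  have hcs2 : ∑ z, |p * c * H z| ≤ p ^ 2 * μ * ((n * c ^ 2 + q ^ 2) / 2) := by
    refine hcs.trans ?_
    have : p * |c| * (Real.sqrt n * Real.sqrt (∑ z, H z ^ 2)) ≤ p * |c| * (Real.sqrt n * (μ * p * q)) := by gcongr
    refine this.trans ?_
    have h3 : |c| * Real.sqrt n * q ≤ (n * c ^ 2 + q ^ 2) / 2 := by
      have := sq_nonneg (|c| * Real.sqrt n - q)
      have h4 : (|c| * Real.sqrt n) ^ 2 = n * c ^ 2 := by
        rw [mul_pow, sq_abs, Real.sq_sqrt hn0.le]; ring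
      nlinarith
    calc _ = p ^ 2 * μ * (|c| * Real.sqrt n * q) := by ring
      _ ≤ _ := by gcongr
  have hfin : ∑ z, w z * (p * c + H z) ^ 2 ≤ (p * c) ^ 2 * ∑ z, w z + 28 * ∑ z, |p * c * H z| + 14 * ∑ z, H z ^ 2 := by
    rw [Finset.mul_sum, Finset.mul_sum, Finset.mul_sum, ← Finset.sum_add_distrib, ← Finset.sum_add_distrib]
    refine Finset.sum_le_sum fun z _ => (hterm z).trans (le_of_eq (by ring))
  have h5 : (p * c) ^ 2 * ∑ z, w z ≤ (p * c) ^ 2 * (14 * ρ * n) := by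
    gcongr; exact (le_abs_self _).trans hw'
  refine hfin.trans ?_
  rw [e2, ← hq2]
  rw [← hq2] at hH2
  have : 0 ≤ p ^ 2 * ((μ ^ 2) * (n * c ^ 2)) := by positivity
  have : 0 ≤ p ^ 2 * (ρ * q ^ 2) := by positivity
  nlinarith

noncomputable def sb_r (t : ZMod 5) : ℝ := (ZMod.stdAddChar t : ℂ).re

lemma sb_r_zero : sb_r 0 = 1 := by simp [sb_r]
lemma sb_r_neg (t : ZMod 5) : sb_r (-t) = sb_r t := by
  simp only [sb_r, AddChar.map_neg_eq_conj, Complex.conj_re]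

lemma sb_r_eq (t : ZMod 5) (ht : t ≠ 0) : 4 * sb_r t ^ 2 + 2 * sb_r t - 1 = 0 := by
  set z : ℂ := ZMod.stdAddChar t with hz
  have hn : ‖z‖ = 1 := AddChar.norm_apply _ _
  have h1 : z ≠ 1 := by
    intro h
    apply ht
    apply ZMod.injective_stdAddChar
    rw [← hz, h]; simp
  have h5 : z ^ 5 = 1 := by
    rw [hz, ← AddChar.map_nsmul_eq_pow]
    have h5t : ∀ t : ZMod 5, (5 : ℕ) • t = 0 := by decide
    have : (5 : ℕ) • t = 0 := h5t t
    rw [this]; simp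
  have hs : z ^ 4 + z ^ 3 + z ^ 2 + z + 1 = 0 := by
    have : (z - 1) * (z ^ 4 + z ^ 3 + z ^ 2 + z + 1) = 0 := by linear_combination h5
    exact (mul_eq_zero.1 this).resolve_left (sub_ne_zero.2 h1)
  have hc : z * (starRingEnd ℂ) z = 1 := by
    rw [Complex.mul_conj, Complex.normSq_eq_norm_sq, hn]; simp
  set w := (starRingEnd ℂ) z with hw
  have h2 : z + w = 2 * (sb_r t : ℂ) := by
    rw [hw, Complex.add_conj]; simp [sb_r, ← hz]
  have h3 : (z + w) ^ 2 + (z + w) - 1 = 0 := by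
    have : z ^ 2 + w ^ 2 + 2 + z + w - 1 = 0 := by
      linear_combination w ^ 2 * hs - (z^3*w + z^2*w + z * w + z^2+z+w+1) * hc
    linear_combination this + 2 * hc
  rw [h2] at h3
  have h4 : ((4 * sb_r t ^ 2 + 2 * sb_r t - 1 : ℝ) : ℂ) = 0 := by push_cast; linear_combination h3
  exact_mod_cast h4

lemma sb_r_cases (t : ZMod 5) (ht : t ≠ 0) : sb_r t = (Real.sqrt 5 - 1) / 4 ∨ sb_r t = (- Real.sqrt 5 - 1) / 4 := by
  have h := sb_r_eq t ht
  have h5 : Real.sqrt 5 ^ 2 = 5 := Real.sq_sqrt (by norm_num)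
  have : (sb_r t - (Real.sqrt 5 - 1) / 4) * (sb_r t - (- Real.sqrt 5 - 1) / 4) = 0 := by
    linear_combination h / 4 - h5 / 16
  rcases mul_eq_zero.1 this with h | h
  · left; linarith
  · right; linarith

lemma sb_sqrt5 : (2.236 : ℝ) < Real.sqrt 5 ∧ Real.sqrt 5 < 2.2361 := by
  constructor
  · rw [Real.lt_sqrt (by norm_num)]; norm_num
  · rw [Real.sqrt_lt' (by norm_num)]; norm_num

def sb_th (t : ZMod 7) : ZMod 5 := if t = 0 then 0 else if t.val < 4 then 1 else -1

lemma sb_th_sum {M : Type*} [AddCommMonoid M] (g : ZMod 5 → M) :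
    ∑ j : ZMod 7, g (sb_th j) = g 0 + 3 • (g 1 + g (-1)) := by
  have e : ∑ j : ZMod 7, g (sb_th j) = g (sb_th 0) + g (sb_th 1) + g (sb_th 2) + g (sb_th 3) + g (sb_th 4) + g (sb_th 5) + g (sb_th 6) := by
    exact Fin.sum_univ_seven (fun j : Fin 7 => g (sb_th j))
  rw [e]
  have h : sb_th 0 = 0 ∧ sb_th 1 = 1 ∧ sb_th 2 = 1 ∧ sb_th 3 = 1 ∧ sb_th 4 = -1 ∧ sb_th 5 = -1 ∧ sb_th 6 = -1 := by
    decide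
  obtain ⟨h0, h1, h2, h3, h4, h5, h6⟩ := h
  rw [h0, h1, h2, h3, h4, h5, h6]
  abel

lemma sb_th_shift {M : Type*} [AddCommMonoid M] (g : ZMod 5 → M) (b : ZMod 7) :
    ∑ j : ZMod 7, g (sb_th (j + b)) = g 0 + 3 • (g 1 + g (-1)) := by
  rw [← sb_th_sum]
  exact Fintype.sum_equiv (Equiv.addRight b) _ _ (fun _ => rfl)
end StB


section StB
variable {m : ℕ}
noncomputable def sb_chi (c : Fin m → ZMod 5) : AddChar (Fin m → ZMod 5) ℂ where
  toFun x := ZMod.stdAddChar (∑ i, c i * x i)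
  map_zero_eq_one' := by simp
  map_add_eq_mul' := by
    intro x y
    rw [← AddChar.map_add_eq_mul]; congr 1; simp [mul_add, Finset.sum_add_distrib]

lemma sb_chi_prod (c x : Fin m → ZMod 5) : sb_chi c x = ∏ i, (ZMod.stdAddChar (c i * x i) : ℂ) := by
  show ZMod.stdAddChar (∑ i, c i * x i) = _
  have : ∀ s : Finset (Fin m), (ZMod.stdAddChar (∑ i ∈ s, c i * x i) : ℂ) = ∏ i ∈ s, (ZMod.stdAddChar (c i * x i) : ℂ) := by
    intro s
    induction s using Finset.induction_on with
    | empty => simp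
    | insert i s hi ih => rw [Finset.sum_insert hi, Finset.prod_insert hi, AddChar.map_add_eq_mul, ih]
  exact this _

lemma sb_chi_sum (x : Fin m → ZMod 5) :
    ∑ c, sb_chi c x = if x = 0 then (Fintype.card (Fin m → ZMod 5) : ℂ) else 0 := by
  simp only [sb_chi_prod]
  have := (Finset.prod_univ_sum (fun _ : Fin m => (Finset.univ : Finset (ZMod 5))) (fun i c => (ZMod.stdAddChar (c * x i) : ℂ))).symm
  rw [Fintype.piFinset_univ] at this
  rw [this]
  simp only [AddChar.sum_mulShift _ (ZMod.isPrimitive_stdAddChar 5)]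
  by_cases hx : x = 0
  · simp [hx]
  · obtain ⟨i, hi⟩ := Function.ne_iff.1 hx
    rw [if_neg hx]
    exact Finset.prod_eq_zero (Finset.mem_univ i) (by simpa using hi)

noncomputable def sb_G (c : Fin m → ZMod 5) (t : Fin m → ZMod 7) : ℝ := (sb_chi c (fun i => sb_th (t i))).re
noncomputable def sb_w (c : Fin m → ZMod 5) (t : Fin m → ZMod 7) : ℝ := 2 * ∑ j : ZMod 7, sb_G c (fun i => j + t i)

lemma sb_G_abs (c : Fin m → ZMod 5) (t : Fin m → ZMod 7) : |sb_G c t| ≤ 1 := by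
  refine (Complex.abs_re_le_norm _).trans (le_of_eq ?_)
  exact AddChar.norm_apply _ _

lemma sb_w_zero (t : Fin m → ZMod 7) : sb_w 0 t = 14 := by
  have : ∀ t : Fin m → ZMod 7, sb_G 0 t = 1 := by
    intro t; simp [sb_G, sb_chi_prod]
  simp [sb_w, this]
  norm_num

lemma sb_w_abs (c : Fin m → ZMod 5) (t : Fin m → ZMod 7) : |sb_w c t| ≤ 14 := by
  unfold sb_w
  rw [abs_mul, abs_two]
  have : |∑ j : ZMod 7, sb_G c (fun i => j + t i)| ≤ ∑ j : ZMod 7, (1:ℝ) :=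
    (Finset.abs_sum_le_sum_abs _ _).trans (Finset.sum_le_sum fun j _ => sb_G_abs _ _)
  simp at this
  linarith

lemma sb_w_one (c : Fin m → ZMod 5) (i : Fin m) (hi : c i ≠ 0) (hc : ∀ k, k ≠ i → c k = 0) (t : Fin m → ZMod 7) :
    sb_w c t ≤ 3 * Real.sqrt 5 - 1 := by
  have h : ∀ t : Fin m → ZMod 7, sb_G c t = sb_r (c i * sb_th (t i)) := by
    intro t
    unfold sb_G sb_r
    rw [sb_chi_prod, Finset.prod_eq_single i]
    · intro k _ hk; simp [hc k hk]
    · simp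
  unfold sb_w
  simp only [h, add_comm _ (t i)]
  simp only [add_comm (t i)]
  rw [sb_th_shift (fun s => sb_r (c i * s))]
  simp only [mul_zero, mul_one, mul_neg, sb_r_neg, sb_r_zero, nsmul_eq_mul]
  have := sb_sqrt5
  rcases sb_r_cases _ hi with h | h <;> rw [h] <;> push_cast <;> linarith

lemma sb_G_sum (c : Fin m → ZMod 5) : ∑ t, sb_G c t = ∏ i, (1 + 6 * sb_r (c i)) := by
  have h : ∑ t : Fin m → ZMod 7, sb_chi c (fun i => sb_th (t i)) = ∏ i, ((1 + 6 * sb_r (c i) : ℝ) : ℂ) := by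
    simp only [sb_chi_prod]
    have := (Finset.prod_univ_sum (fun _ : Fin m => (Finset.univ : Finset (ZMod 7))) (fun i t => (ZMod.stdAddChar (c i * sb_th t) : ℂ))).symm
    rw [Fintype.piFinset_univ] at this
    rw [this]
    refine Finset.prod_congr rfl fun i _ => ?_
    rw [sb_th_sum (fun s => (ZMod.stdAddChar (c i * s) : ℂ))]
    simp only [mul_zero, mul_one, mul_neg, AddChar.map_neg_eq_conj, Complex.add_conj, nsmul_eq_mul, sb_r]
    simp
    ring
  unfold sb_G
  rw [← Complex.re_sum, h, ← Complex.ofReal_prod, Complex.ofReal_re]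

lemma sb_w_sum {Y : Type*} [Fintype Y] (a : Y → Fin m → ZMod 7)
    (ha : ∀ g : (Fin m → ZMod 7) → ℝ, (∑ z, g (a z)) * 7 ^ m = Fintype.card Y * ∑ t, g t) (c : Fin m → ZMod 5) :
    ∑ z, sb_w c (a z) = 14 * (∏ i, (1 + 6 * sb_r (c i)) / 7) * Fintype.card Y := by
  have h1 : ∀ j : ZMod 7, (∑ z, sb_G c (fun i => j + a z i)) * 7 ^ m = Fintype.card Y * ∏ i, (1 + 6 * sb_r (c i)) := by
    intro j
    rw [ha (fun t => sb_G c (fun i => j + t i)), ← sb_G_sum]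
    congr 1
    exact Fintype.sum_equiv (Equiv.addLeft (fun _ => j)) _ _ (fun _ => rfl)
  have h2 : (∑ z, sb_w c (a z)) * 7 ^ m = 14 * (Fintype.card Y * ∏ i, (1 + 6 * sb_r (c i))) := by
    unfold sb_w
    rw [← Finset.mul_sum, Finset.sum_comm, mul_assoc, Finset.sum_mul]
    simp only [h1]
    simp
    ring
  have h7 : (7:ℝ) ^ m ≠ 0 := by positivity
  rw [Finset.prod_div_distrib]
  simp only [Finset.prod_const, Finset.card_univ, Fintype.card_fin]
  field_simp
  linarith

noncomputable def sb_rho : ℝ := ((3 * Real.sqrt 5 + 1) / 14) ^ 2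

lemma sb_prod_le (c : Fin m → ZMod 5) (i k : Fin m) (hik : i ≠ k) (hi : c i ≠ 0) (hk : c k ≠ 0) :
    |∏ i, (1 + 6 * sb_r (c i)) / 7| ≤ sb_rho := by
  have h5 := sb_sqrt5
  have hle : ∀ i, |(1 + 6 * sb_r (c i)) / 7| ≤ 1 := by
    intro i
    by_cases h : c i = 0
    · rw [h, sb_r_zero]; norm_num
    · rw [abs_le]
      rcases sb_r_cases _ h with h | h <;> rw [h] <;> constructor <;> linarith
  have hne : ∀ i, c i ≠ 0 → |(1 + 6 * sb_r (c i)) / 7| ≤ (3 * Real.sqrt 5 + 1) / 14 := by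
    intro i h
    rw [abs_le]
    rcases sb_r_cases _ h with h | h <;> rw [h] <;> constructor <;> linarith
  rw [Finset.abs_prod, ← Finset.mul_prod_erase _ _ (Finset.mem_univ i),
    ← Finset.mul_prod_erase _ _ (Finset.mem_erase.2 ⟨hik.symm, Finset.mem_univ k⟩)]
  have h1 : ∏ x ∈ (Finset.univ.erase i).erase k, |(1 + 6 * sb_r (c x)) / 7| ≤ 1 :=
    Finset.prod_le_one (fun _ _ => abs_nonneg _) fun x _ => hle x
  have h2 : 0 ≤ ∏ x ∈ (Finset.univ.erase i).erase k, |(1 + 6 * sb_r (c x)) / 7| := Finset.prod_nonneg fun _ _ => abs_nonneg _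
  unfold sb_rho
  rw [sq]
  refine mul_le_mul (hne i hi) ?_ (by positivity) (by positivity)
  calc _ ≤ (3 * Real.sqrt 5 + 1) / 14 * 1 := mul_le_mul (hne k hk) h1 h2 (by positivity)
    _ = _ := mul_one _

/-- per-frequency bound -/
lemma sb_freq {Y : Type*} [Fintype Y] [Nonempty Y] (P : Y → Y → ℝ) (hP : ∀ u v, 0 ≤ P u v)
    (hs : ∀ u v, P u v = P v u) (p : ℝ) (hp : 0 ≤ p) (hr : ∀ u, ∑ v, P u v = p)
    (hg : ∀ f : Y → ℝ, ∑ v, f v = 0 →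
        ∑ u, (∑ v, (P u v : ℝ) * f v) ^ 2 ≤ (1/16) ^ 2 * (p : ℝ) ^ 2 * ∑ v, f v ^ 2)
    (a : Y → Fin m → ZMod 7)
    (ha : ∀ g : (Fin m → ZMod 7) → ℝ, (∑ z, g (a z)) * 7 ^ m = Fintype.card Y * ∑ t, g t) (c : Fin m → ZMod 5)
    (F : Y → ℝ) (hF : c = 0 → ∑ y, F y = 0) :
    ∑ z, sb_w c (a z) * (∑ y, P z y * F y) ^ 2 ≤ p ^ 2 * (3 * Real.sqrt 5 - 1) * ∑ y, F y ^ 2 := by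
  have h5 := sb_sqrt5
  have hF2 : 0 ≤ ∑ y, F y ^ 2 := Finset.sum_nonneg fun _ _ => sq_nonneg _
  by_cases hc : c = 0
  · subst hc
    simp only [sb_w_zero, ← Finset.mul_sum]
    have := hg F (hF rfl)
    have h6 : 14 * ((1/16:ℝ) ^ 2 * p ^ 2 * ∑ v, F v ^ 2) ≤ p ^ 2 * (3 * Real.sqrt 5 - 1) * ∑ y, F y ^ 2 := by
      have : 14 * (1/16:ℝ)^2 * (p ^ 2 * ∑ y, F y ^ 2) ≤ (3 * Real.sqrt 5 - 1) * (p ^ 2 * ∑ y, F y ^ 2) := by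
        apply mul_le_mul_of_nonneg_right _ (by positivity); linarith
      linarith
    linarith
  obtain ⟨i, hi⟩ := Function.ne_iff.1 hc
  by_cases h1 : ∀ k, k ≠ i → c k = 0
  · calc _ ≤ ∑ z, (3 * Real.sqrt 5 - 1) * (∑ y, P z y * F y) ^ 2 := by
          refine Finset.sum_le_sum fun z _ => ?_
          exact mul_le_mul_of_nonneg_right (sb_w_one c i hi h1 _) (sq_nonneg _)
      _ = (3 * Real.sqrt 5 - 1) * ∑ z, (∑ y, P z y * F y) ^ 2 := by rw [Finset.mul_sum]
      _ ≤ (3 * Real.sqrt 5 - 1) * (p ^ 2 * ∑ y, F y ^ 2) := 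
          mul_le_mul_of_nonneg_left (sb_contr P hP hs p hr F) (by linarith)
      _ = _ := by ring
  · push Not at h1
    obtain ⟨k, hki, hk⟩ := h1
    have := sb_gap P hs p (1/16) sb_rho hp (by norm_num) (by unfold sb_rho; positivity) hr hg (fun z => sb_w c (a z)) (fun z => sb_w_abs _ _)
      (by
        rw [sb_w_sum a ha, abs_mul, abs_mul, Nat.abs_cast, abs_of_nonneg (by norm_num : (0:ℝ) ≤ 14)]
        gcongr
        exact sb_prod_le c i k hki.symm hi hk) F
    refine this.trans ?_
    have h6 : 14 * (sb_rho + 1/16 + (1/16) ^ 2) ≤ 3 * Real.sqrt 5 - 1 := by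
      unfold sb_rho
      have : Real.sqrt 5 ^ 2 = 5 := Real.sq_sqrt (by norm_num)
      nlinarith
    calc _ = (14 * (sb_rho + 1/16 + (1/16) ^ 2)) * (p ^ 2 * ∑ y, F y ^ 2) := by ring
      _ ≤ (3 * Real.sqrt 5 - 1) * (p ^ 2 * ∑ y, F y ^ 2) := mul_le_mul_of_nonneg_right h6 (by positivity)
      _ = _ := by ring

/-- the block matrix -/
def sb_M (t : Fin m → ZMod 7) (x x' : Fin m → ZMod 5) : ℕ :=
  ∑ j : ZMod 7, pm (Equiv.addRight (fun i => sb_th (j + t i))) x x'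

lemma sb_M_symm (t : Fin m → ZMod 7) (x x' : Fin m → ZMod 5) : sb_M t x x' = sb_M t x' x := by
  unfold sb_M; simp only [pm_symm _ x]

lemma sb_M_row (t : Fin m → ZMod 7) (x : Fin m → ZMod 5) : ∑ x', sb_M t x x' = 14 := by
  unfold sb_M; rw [Finset.sum_comm]; simp only [pm_row]; simp

lemma sb_M_quad (t : Fin m → ZMod 7) (g : (Fin m → ZMod 5) → ℝ) :
    (Fintype.card (Fin m → ZMod 5)) * ∑ x, ∑ x', (sb_M t x x' : ℝ) * g x * g x' =
     ∑ c, sb_w c t * (Complex.normSq (∑ x, (g x : ℂ) * sb_chi c x)) := by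
  have h1 : ∀ s : Fin m → ZMod 5, (Fintype.card (Fin m → ZMod 5)) * ∑ x, g x * g (x + s) = 
      ∑ c, (sb_chi c s).re * (Complex.normSq (∑ x, (g x : ℂ) * sb_chi c x)) := by
    intro s
    have := eq_parseval sb_chi sb_chi_sum g g s
    have h2 := congrArg Complex.re this
    simp only [mul_assoc, Complex.mul_conj] at h2
    simp only [Complex.re_sum, Complex.re_mul_ofReal] at h2
    rw [h2]
    norm_cast
  have h3 : ∑ x, ∑ x', (sb_M t x x' : ℝ) * g x * g x' = ∑ j : ZMod 7, 2 * ∑ x, g x * g (x + (fun i => sb_th (j + t i))) := by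
    have := fun j : ZMod 7 => pm_quad (Equiv.addRight (fun i : Fin m => sb_th (j + t i))) g
    simp only [Equiv.coe_addRight] at this
    simp only [← this, sb_M]
    push_cast
    simp only [Finset.sum_mul]
    conv_rhs => rw [Finset.sum_comm]
    refine Finset.sum_congr rfl fun x _ => ?_
    rw [Finset.sum_comm]
  rw [h3, Finset.mul_sum]
  simp only [sb_w, sb_G]
  simp only [mul_left_comm _ (2:ℝ), h1]
  simp only [mul_assoc, ← Finset.mul_sum, Finset.sum_mul]
  rw [Finset.sum_comm]

lemma sb_pars (g : (Fin m → ZMod 5) → ℝ) :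
    (Fintype.card (Fin m → ZMod 5)) * ∑ x, g x ^ 2 =
     ∑ c, (Complex.normSq (∑ x, (g x : ℂ) * sb_chi c x)) := by
  have := eq_parseval sb_chi sb_chi_sum g g 0
  simp only [mul_assoc, Complex.mul_conj] at this
  simp only [AddChar.map_zero_eq_one, one_mul, add_zero] at this
  simp only [sq]
  exact_mod_cast this.symm
end StB


section StB
variable {m : ℕ} {Y : Type*} [Fintype Y]

def sb_A (P : Y → Y → ℕ) (a : Y → Fin m → ZMod 7) (u v : Y × (Fin m → ZMod 5)) : ℕ :=
  ∑ z, P u.1 z * (sb_M (a z) u.2 v.2 * P z v.1)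

lemma sb_A_apply (P : Y → Y → ℕ) (a : Y → Fin m → ZMod 7) (f : Y × (Fin m → ZMod 5) → ℝ) (u) :
    ∑ v, (sb_A P a u v : ℝ) * f v = ∑ z, (P u.1 z : ℝ) * ∑ x', (sb_M (a z) u.2 x' : ℝ) * ∑ y', (P z y' : ℝ) * f (y', x') := by
  unfold sb_A
  push_cast
  simp only [Finset.sum_mul, Finset.mul_sum]
  rw [Finset.sum_comm]
  refine Finset.sum_congr rfl fun z _ => ?_
  rw [Fintype.sum_prod_type, Finset.sum_comm]
  refine Finset.sum_congr rfl fun x _ => Finset.sum_congr rfl fun y _ => ?_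
  ring

lemma sb_A_quad (P : Y → Y → ℕ) (hs : ∀ u v, P u v = P v u) (a : Y → Fin m → ZMod 7) (f : Y × (Fin m → ZMod 5) → ℝ) :
    ∑ u, ∑ v, (sb_A P a u v : ℝ) * f u * f v = 
    ∑ z, ∑ x, ∑ x', (sb_M (a z) x x' : ℝ) * (∑ y, (P z y : ℝ) * f (y, x)) * (∑ y, (P z y : ℝ) * f (y, x')) := by
  have h : ∀ u, ∑ v, (sb_A P a u v : ℝ) * f u * f v = f u * ∑ v, (sb_A P a u v : ℝ) * f v := by
    intro u; rw [Finset.mul_sum]; refine Finset.sum_congr rfl fun v _ => by ring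
  simp only [h, sb_A_apply]
  rw [Fintype.sum_prod_type]
  have h2 : ∀ z x, ∑ x', (sb_M (a z) x x' : ℝ) * (∑ y, (P z y : ℝ) * f (y, x)) * (∑ y, (P z y : ℝ) * f (y, x'))
      = ∑ y, f (y, x) * ((P z y : ℝ) * ∑ x', (sb_M (a z) x x' : ℝ) * ∑ y', (P z y' : ℝ) * f (y', x')) := by
    intro z x
    rw [← Finset.sum_congr rfl fun y _ => mul_assoc (f (y, x)) (P z y : ℝ) _]
    rw [← Finset.sum_mul, Finset.mul_sum]
    refine Finset.sum_congr rfl fun x' _ => ?_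
    simp only [mul_comm (f _) _]; ring
  simp only [h2]
  have h3 : ∀ K : Y → (Fin m → ZMod 5) → ℝ, ∑ y, ∑ x, f (y, x) * ∑ z, (P y z : ℝ) * K z x = ∑ z, ∑ x, ∑ y, f (y, x) * ((P z y : ℝ) * K z x) := by
    intro K
    simp only [Finset.mul_sum]
    rw [Finset.sum_comm]
    rw [Finset.sum_congr rfl fun x _ => Finset.sum_comm]
    rw [Finset.sum_comm]
    refine Finset.sum_congr rfl fun z _ => Finset.sum_congr rfl fun x _ => Finset.sum_congr rfl fun y _ => ?_
    rw [hs y z]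
  exact h3 (fun z x => ∑ x', (sb_M (a z) x x' : ℝ) * ∑ y', (P z y' : ℝ) * f (y', x'))

lemma sb_A_symm (P : Y → Y → ℕ) (hs : ∀ u v, P u v = P v u) (a : Y → Fin m → ZMod 7) (u v) : sb_A P a u v = sb_A P a v u := by
  unfold sb_A
  refine Finset.sum_congr rfl fun z _ => ?_
  rw [hs u.1, hs z v.1, sb_M_symm]; ring

lemma sb_A_row (P : Y → Y → ℕ) (p : ℕ) (hr : ∀ u, ∑ v, P u v = p) (a : Y → Fin m → ZMod 7) (u) : ∑ v, sb_A P a u v = 14 * p ^ 2 := by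
  have h := sb_A_apply P a (fun _ => 1) u
  simp only [mul_one] at h
  have : ((∑ v, sb_A P a u v : ℕ) : ℝ) = ((14 * p ^ 2 : ℕ) : ℝ) := by
    push_cast
    rw [h]
    have h1 : ∀ u, ∑ v, (P u v : ℝ) = p := fun u => by exact_mod_cast hr u
    have h2 : ∀ t x, ∑ x' : Fin m → ZMod 5, (sb_M t x x' : ℝ) = 14 := fun t x => by exact_mod_cast sb_M_row t x
    simp only [h1, ← Finset.sum_mul, h2]
    ring
  exact_mod_cast this

lemma sb_A_bound [Nonempty Y] (P : Y → Y → ℕ) 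
    (hs : ∀ u v, P u v = P v u) (p : ℕ) (hr : ∀ u, ∑ v, P u v = p)
    (hg : ∀ f : Y → ℝ, ∑ v, f v = 0 →
        ∑ u, (∑ v, (P u v : ℝ) * f v) ^ 2 ≤ (1/16) ^ 2 * (p : ℝ) ^ 2 * ∑ v, f v ^ 2)
    (a : Y → Fin m → ZMod 7)
    (ha : ∀ g : (Fin m → ZMod 7) → ℝ, (∑ z, g (a z)) * 7 ^ m = Fintype.card Y * ∑ t, g t) 
    (f : Y × (Fin m → ZMod 5) → ℝ) (hf : ∑ u, f u = 0) :
    ∑ u, ∑ v, (sb_A P a u v : ℝ) * f u * f v ≤ (p:ℝ) ^ 2 * (3 * Real.sqrt 5 - 1) * ∑ u, f u ^ 2 := by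
  set n : ℝ := (Fintype.card (Fin m → ZMod 5) : ℝ) with hn
  have hn0 : 0 < n := by rw [hn]; exact_mod_cast Fintype.card_pos
  refine le_of_mul_le_mul_left ?_ hn0
  set fh : (Fin m → ZMod 5) → Y → ℂ := fun c y => ∑ x, (f (y, x) : ℂ) * sb_chi c x with hfh
  have hP : ∀ c z, ∑ x, ((∑ y, (P z y : ℝ) * f (y, x) : ℝ) : ℂ) * sb_chi c x = ∑ y, (P z y : ℂ) * fh c y := by
    intro c z
    push_cast
    simp only [hfh, Finset.mul_sum, Finset.sum_mul, mul_assoc]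
    rw [Finset.sum_comm]
  have hre : ∀ c z, (∑ y, (P z y : ℂ) * fh c y).re = ∑ y, (P z y : ℝ) * (fh c y).re := by
    intro c z
    rw [Complex.re_sum]
    refine Finset.sum_congr rfl fun y _ => by simp
  have him : ∀ c z, (∑ y, (P z y : ℂ) * fh c y).im = ∑ y, (P z y : ℝ) * (fh c y).im := by
    intro c z
    rw [Complex.im_sum]
    refine Finset.sum_congr rfl fun y _ => by simp
  rw [sb_A_quad P hs, Finset.mul_sum]
  simp only [hn, sb_M_quad, hP]
  rw [Finset.sum_comm]
  have hsq : (Fintype.card (Fin m → ZMod 5) : ℝ) * ((p:ℝ) ^ 2 * (3 * Real.sqrt 5 - 1) * ∑ u, f u ^ 2) = 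
      ∑ c, (p:ℝ) ^ 2 * (3 * Real.sqrt 5 - 1) * ∑ y, Complex.normSq (fh c y) := by
    rw [Fintype.sum_prod_type, mul_left_comm, Finset.mul_sum]
    simp only [sb_pars]
    rw [← Finset.mul_sum, Finset.sum_comm]
  rw [hsq]
  refine Finset.sum_le_sum fun c _ => ?_
  simp only [Complex.normSq_apply, ← sq, hre, him, mul_add, Finset.sum_add_distrib]
  have hr' : ∀ u, ∑ v, (P u v : ℝ) = p := fun u => by exact_mod_cast hr u
  have h0 : c = 0 → ∑ y, fh c y = 0 := by
    rintro rfl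
    have : ((∑ u, f u : ℝ) : ℂ) = 0 := by rw [hf]; simp
    rw [Fintype.sum_prod_type] at this
    push_cast at this
    simp only [hfh]
    rw [← this]
    simp [sb_chi_prod]
  have key := fun F hF => sb_freq (fun u v => (P u v : ℝ)) (fun _ _ => Nat.cast_nonneg _) (fun u v => by rw [hs]) p (Nat.cast_nonneg _) hr' hg a ha c F hF
  refine add_le_add (key _ fun hc => ?_) (key _ fun hc => ?_)
  · rw [← Complex.re_sum, h0 hc]; rfl
  · rw [← Complex.im_sum, h0 hc]; rfl

noncomputable def sb_phi (t : ZMod 5) : ℝ :=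
  (![2, (Real.sqrt 5 - 1) / 2, -(Real.sqrt 5 + 1) / 2, -(Real.sqrt 5 + 1) / 2, (Real.sqrt 5 - 1) / 2] : Fin 5 → ℝ) t

lemma sb_phi_rec (t : ZMod 5) : sb_phi (t + 1) + sb_phi (t - 1) = (Real.sqrt 5 - 1) / 2 * sb_phi t := by
  have h5 : Real.sqrt 5 ^ 2 = 5 := Real.sq_sqrt (by norm_num)
  have e0 : sb_phi 0 = 2 := rfl
  have e1 : sb_phi 1 = (Real.sqrt 5 - 1) / 2 := rfl
  have e2 : sb_phi 2 = -(Real.sqrt 5 + 1) / 2 := rfl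
  have e3 : sb_phi 3 = -(Real.sqrt 5 + 1) / 2 := rfl
  have e4 : sb_phi 4 = (Real.sqrt 5 - 1) / 2 := rfl
  have ht : t = 0 ∨ t = 1 ∨ t = 2 ∨ t = 3 ∨ t = 4 := by revert t; decide
  rcases ht with rfl | rfl | rfl | rfl | rfl
  · rw [show (0 + 1 : ZMod 5) = 1 by decide, show (0 - 1 : ZMod 5) = 4 by decide, e0, e1, e4]; ring
  · rw [show (1 + 1 : ZMod 5) = 2 by decide, show (1 - 1 : ZMod 5) = 0 by decide, e0, e1, e2]; linear_combination - h5 / 4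
  · rw [show (2 + 1 : ZMod 5) = 3 by decide, show (2 - 1 : ZMod 5) = 1 by decide, e3, e1, e2]; linear_combination h5 / 4
  · rw [show (3 + 1 : ZMod 5) = 4 by decide, show (3 - 1 : ZMod 5) = 2 by decide, e3, e4, e2]; linear_combination h5 / 4
  · rw [show (4 + 1 : ZMod 5) = 0 by decide, show (4 - 1 : ZMod 5) = 3 by decide, e3, e4, e0]; linear_combination - h5 / 4

lemma sb_pm_apply {V : Type*} [Fintype V] [DecidableEq V] (g : V ≃ V) (f : V → ℝ) (u : V) :
    ∑ v, (pm g u v : ℝ) * f v = f (g u) + f (g.symm u) := by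
  unfold pm
  have : ∀ v, (if g v = u then 1 else 0) = if g.symm u = v then 1 else 0 := by
    intro v; congr 1; rw [Equiv.symm_apply_eq]; simp [eq_comm]
  simp [this, add_mul, Finset.sum_add_distrib]

lemma sb_M_eig (t : Fin m → ZMod 7) (i : Fin m) (x : Fin m → ZMod 5) :
    ∑ x', (sb_M t x x' : ℝ) * sb_phi (x' i) = (3 * Real.sqrt 5 - 1) * sb_phi (x i) := by
  unfold sb_M
  push_cast
  simp only [Finset.sum_mul]
  rw [Finset.sum_comm]
  have h := fun j : ZMod 7 => sb_pm_apply (Equiv.addRight (fun i : Fin m => sb_th (j + t i))) (fun x => sb_phi (x i)) x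
  simp only [h]
  simp only [Equiv.coe_addRight, Equiv.addRight_symm, Pi.add_apply, Pi.neg_apply]
  rw [sb_th_shift (fun s => sb_phi (x i + s) + sb_phi (x i + -s)) (t i)]
  have := sb_phi_rec (x i)
  simp only [sub_eq_add_neg] at this
  simp only [neg_zero, neg_neg, add_zero, nsmul_eq_mul]
  push_cast
  linear_combination 6 * this

lemma sb_A_eig (P : Y → Y → ℕ) (p : ℕ) (hr : ∀ u, ∑ v, P u v = p) (a : Y → Fin m → ZMod 7) (i : Fin m) (u) :
    ∑ v, (sb_A P a u v : ℝ) * sb_phi (v.2 i) = (p:ℝ) ^ 2 * (3 * Real.sqrt 5 - 1) * sb_phi (u.2 i) := by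
  have h1 : ∀ u, ∑ v, (P u v : ℝ) = p := fun u => by exact_mod_cast hr u
  rw [sb_A_apply P a (fun v => sb_phi (v.2 i)) u]
  simp only [← Finset.sum_mul, h1]
  simp only [mul_left_comm _ (p:ℝ), ← Finset.mul_sum, sb_M_eig, ← Finset.sum_mul, h1]
  ring

lemma sb_indep [Nonempty Y] : LinearIndependent ℝ (fun (i : Fin m) (u : Y × (Fin m → ZMod 5)) => sb_phi (u.2 i)) := by
  rw [Fintype.linearIndependent_iff]
  intro g hg i
  obtain ⟨y⟩ := ‹Nonempty Y›
  have h0 := congrFun hg (y, 0)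
  have h1 := congrFun hg (y, Pi.single i 1)
  simp only [Finset.sum_apply, Pi.smul_apply, smul_eq_mul, Pi.zero_apply] at h0 h1
  have h2 : ∑ k, g k * (sb_phi 0 - sb_phi ((Pi.single i 1 : Fin m → ZMod 5) k)) = 0 := by
    simp only [mul_sub, Finset.sum_sub_distrib, h0, h1, sub_zero]
  rw [Finset.sum_eq_single i] at h2
  · rw [Pi.single_eq_same] at h2
    have e0 : sb_phi 0 = 2 := rfl
    have e1 : sb_phi 1 = (Real.sqrt 5 - 1) / 2 := rfl
    have := sb_sqrt5
    rcases mul_eq_zero.1 h2 with h | h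
    · exact h
    · rw [e0, e1] at h; linarith
  · intro k _ hk; rw [Pi.single_eq_of_ne hk]; simp
  · simp
end StB

/-- Stage B summary -/
lemma stageB : ∃ p : ℕ, 0 < p ∧ ∀ m j : ℕ, 0 < j → ∃ (V : Type) (_ : Fintype V) (_ : DecidableEq V) (A : V → V → ℕ) (e : Fin m → V → ℝ),
    Fintype.card V = 245 ^ m * j ^ 2 ∧ (∀ u v, A u v = A v u) ∧ (∀ u, ∑ v, A u v = 14 * p ^ 2) ∧
    (∀ f : V → ℝ, ∑ u, f u = 0 → ∑ u, ∑ v, (A u v : ℝ) * f u * f v ≤ (p:ℝ) ^ 2 * (3 * Real.sqrt 5 - 1) * ∑ u, f u ^ 2) ∧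
    LinearIndependent ℝ e ∧ (∀ i u, ∑ v, (A u v : ℝ) * e i v = (p:ℝ) ^ 2 * (3 * Real.sqrt 5 - 1) * e i u) := by
  obtain ⟨p, hp, h⟩ := expander_exists (1/16) (by norm_num)
  refine ⟨p, hp, fun m j hj => ?_⟩
  have hk : 0 < 7 ^ m * j := by positivity
  obtain ⟨P, hF, hs, hr, hg⟩ := h (7 ^ m * j) hk
  haveI : NeZero (7 ^ m * j) := ⟨hk.ne'⟩
  have hcard : Fintype.card (ZMod (7 ^ m * j) × ZMod (7 ^ m * j)) = (7 ^ m * j) ^ 2 := by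
    rw [Fintype.card_prod, ← Nat.card_eq_fintype_card, Nat.card_zmod, sq]
  have eq : Nonempty (ZMod (7 ^ m * j) × ZMod (7 ^ m * j) ≃ (Fin m → ZMod 7) × Fin (7 ^ m * j ^ 2)) := by
    rw [← Fintype.card_eq, hcard]
    simp
    ring
  obtain ⟨eqv⟩ := eq
  have ha : ∀ g : (Fin m → ZMod 7) → ℝ, (∑ z, g ((eqv z).1)) * 7 ^ m = Fintype.card (ZMod (7 ^ m * j) × ZMod (7 ^ m * j)) * ∑ t, g t := by
    intro g
    rw [Fintype.sum_equiv eqv (fun z => g (eqv z).1) (fun w => g w.1) (fun _ => rfl), Fintype.sum_prod_type, hcard]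
    simp [← Finset.mul_sum]
    ring
  refine ⟨(ZMod (7 ^ m * j) × ZMod (7 ^ m * j)) × (Fin m → ZMod 5), inferInstance, inferInstance, sb_A P (fun z => (eqv z).1), fun i u => sb_phi (u.2 i), ?_, ?_, ?_, ?_, ?_, ?_⟩
  · rw [Fintype.card_prod, hcard]
    simp
    have h245 : 245 ^ m = 5 ^ m * 7 ^ (m * 2) := by
      rw [mul_comm m 2, pow_mul, ← mul_pow]; norm_num
    rw [h245]
    ring
  · exact sb_A_symm P hs _
  · exact sb_A_row P p hr _
  · exact sb_A_bound P hs p hr hg _ ha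
  · exact sb_indep
  · intro i u; exact sb_A_eig P p hr _ i u


section StC
variable {q : ℕ} [Fact q.Prime]

noncomputable def sc_Q (σ : ZMod q) (h : ZMod q × ZMod q → ℝ) (w : ZMod q × ZMod q) : ℝ :=
  ∑ b', h (b', w.1 * b' + σ - w.2)

lemma sc_Q_sum (σ : ZMod q) (h : ZMod q × ZMod q → ℝ) : ∑ w, sc_Q σ h w = q * ∑ w, h w := by
  unfold sc_Q
  rw [Finset.sum_comm, Fintype.sum_prod_type h, Finset.mul_sum]
  refine Finset.sum_congr rfl fun b' _ => ?_
  rw [Fintype.sum_prod_type]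
  have : ∀ b : ZMod q, ∑ c, h (b', b * b' + σ - c) = ∑ c, h (b', c) := by
    intro b
    exact Fintype.sum_equiv (Equiv.subLeft (b * b' + σ)) _ _ (fun _ => rfl)
  simp [this, ZMod.card]

lemma sc_Q_sq (σ : ZMod q) (h : ZMod q × ZMod q → ℝ) (h0 : ∑ w, h w = 0) :
    ∑ w, sc_Q σ h w ^ 2 ≤ q * ∑ w, h w ^ 2 := by
  set H : ZMod q → ℝ := fun b => ∑ c, h (b, c) with hH
  have e1 : ∑ w, sc_Q σ h w ^ 2 = ∑ b1, ∑ b2, ∑ w : ZMod q × ZMod q, h (b1, w.1 * b1 + σ - w.2) * h (b2, w.1 * b2 + σ - w.2) := by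
    unfold sc_Q
    simp only [sq, Finset.sum_mul_sum]
    rw [Finset.sum_comm]
    refine Finset.sum_congr rfl fun b1 _ => ?_
    rw [Finset.sum_comm]
  have e2 : ∀ b1 b2, ∑ w : ZMod q × ZMod q, h (b1, w.1 * b1 + σ - w.2) * h (b2, w.1 * b2 + σ - w.2) = 
      H b1 * H b2 + if b1 = b2 then q * ∑ c, h (b1, c) ^ 2 - H b1 ^ 2 else 0 := by
    intro b1 b2
    split_ifs with hb
    · subst hb
      rw [Fintype.sum_prod_type]
      have : ∀ b : ZMod q, ∑ c, h (b1, b * b1 + σ - c) * h (b1, b * b1 + σ - c) = ∑ c, h (b1, c) ^ 2 := by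
        intro b
        exact Fintype.sum_equiv (Equiv.subLeft (b * b1 + σ)) _ _ (fun _ => (sq _).symm)
      simp only [this]
      simp [ZMod.card]
      ring
    · have hb' : b1 - b2 ≠ 0 := sub_ne_zero.2 hb
      rw [add_zero, hH]
      simp only [Finset.sum_mul_sum]
      rw [← Fintype.sum_prod_type']
      refine Fintype.sum_bijective (fun w : ZMod q × ZMod q => (w.1 * b1 + σ - w.2, w.1 * b2 + σ - w.2)) ?_ _ _ (fun _ => rfl)
      rw [Fintype.bijective_iff_injective_and_card]
      refine ⟨?_, rfl⟩
      rintro ⟨b, c⟩ ⟨b', c'⟩ hh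
      simp only [Prod.mk.injEq] at hh
      have h3 : (b - b') * (b1 - b2) = 0 := by linear_combination hh.1 - hh.2
      have h4 : b = b' := sub_eq_zero.1 ((mul_eq_zero.1 h3).resolve_right hb')
      subst h4
      simpa using hh.1
  rw [e1]
  simp only [e2, Finset.sum_add_distrib, Finset.sum_ite_eq, Finset.mem_univ, if_true, Finset.sum_sub_distrib]
  rw [← Finset.sum_mul_sum]
  have h1 : ∑ b, H b = 0 := by rw [← h0, Fintype.sum_prod_type]
  rw [h1, ← Finset.mul_sum, Fintype.sum_prod_type]
  have : 0 ≤ ∑ b, H b ^ 2 := Finset.sum_nonneg fun _ _ => sq_nonneg _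
  linarith

lemma sc_Q_pair (σ : ZMod q) (g h : ZMod q × ZMod q → ℝ) :
    ∑ w, g w * sc_Q σ h w ≤ (∑ w, g w) * (∑ w, h w) / q + Real.sqrt q / 2 * 
      ((∑ w, g w ^ 2 - (∑ w, g w) ^ 2 / q ^ 2) + (∑ w, h w ^ 2 - (∑ w, h w) ^ 2 / q ^ 2)) := by
  have hq : (0:ℝ) < q := by exact_mod_cast (Fact.out : q.Prime).pos
  have hcard : ((Fintype.card (ZMod q × ZMod q) : ℕ) : ℝ) = q ^ 2 := by
    rw [Fintype.card_prod, ZMod.card]; push_cast; ring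
  set G := ∑ w, g w with hG
  set H := ∑ w, h w with hH
  set g' : ZMod q × ZMod q → ℝ := fun w => g w - G / q ^ 2 with hg'
  set h' : ZMod q × ZMod q → ℝ := fun w => h w - H / q ^ 2 with hh'
  have sg : ∑ w, g' w = 0 := by
    simp only [hg', Finset.sum_sub_distrib, Finset.sum_const, Finset.card_univ, nsmul_eq_mul, hcard, ← hG]
    field_simp; ring
  have sh : ∑ w, h' w = 0 := by
    simp only [hh', Finset.sum_sub_distrib, Finset.sum_const, Finset.card_univ, nsmul_eq_mul, hcard, ← hH]
    field_simp; ring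
  have ng : ∑ w, g' w ^ 2 = ∑ w, g w ^ 2 - G ^ 2 / q ^ 2 := by
    have : ∀ w, g' w ^ 2 = g w ^ 2 - 2 * (G / q ^ 2) * g w + (G / q ^ 2) ^ 2 := fun w => by simp only [hg']; ring
    simp only [this, Finset.sum_add_distrib, Finset.sum_sub_distrib, ← Finset.mul_sum, Finset.sum_const, Finset.card_univ, nsmul_eq_mul, hcard, ← hG]
    field_simp; ring
  have nh : ∑ w, h' w ^ 2 = ∑ w, h w ^ 2 - H ^ 2 / q ^ 2 := by
    have : ∀ w, h' w ^ 2 = h w ^ 2 - 2 * (H / q ^ 2) * h w + (H / q ^ 2) ^ 2 := fun w => by simp only [hh']; ring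
    simp only [this, Finset.sum_add_distrib, Finset.sum_sub_distrib, ← Finset.mul_sum, Finset.sum_const, Finset.card_univ, nsmul_eq_mul, hcard, ← hH]
    field_simp; ring
  rw [← ng, ← nh]
  have eQ : ∀ w, sc_Q σ h w = sc_Q σ h' w + H / q := by
    intro w
    simp only [sc_Q, hh', Finset.sum_sub_distrib, Finset.sum_const, Finset.card_univ, nsmul_eq_mul, ZMod.card]
    field_simp; ring
  have e1 : ∑ w, g w * sc_Q σ h w = G * H / q + ∑ w, g' w * sc_Q σ h' w := by
    have : ∀ w, g w * sc_Q σ h w = H / q * g w + g' w * sc_Q σ h' w + G / q ^ 2 * sc_Q σ h' w := by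
      intro w; rw [eQ]; simp only [hg']; ring
    simp only [this, Finset.sum_add_distrib, ← Finset.mul_sum, sc_Q_sum, sh, ← hG]
    ring
  rw [e1]
  have hs := sc_Q_sq σ h' sh
  set s := Real.sqrt q with hsd
  have hs0 : 0 < s := Real.sqrt_pos.2 hq
  have hs2 : s ^ 2 = q := Real.sq_sqrt hq.le
  have h5 : ∑ w, g' w * sc_Q σ h' w ≤ ∑ w, (s / 2 * g' w ^ 2 + 1 / (2 * s) * sc_Q σ h' w ^ 2) := by
    refine Finset.sum_le_sum fun w _ => ?_
    have : s / 2 * g' w ^ 2 + 1 / (2 * s) * sc_Q σ h' w ^ 2 - g' w * sc_Q σ h' w = (s * g' w - sc_Q σ h' w) ^ 2 / (2 * s) := by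
      field_simp; ring
    have h6 : 0 ≤ (s * g' w - sc_Q σ h' w) ^ 2 / (2 * s) := by positivity
    linarith
  rw [Finset.sum_add_distrib, ← Finset.mul_sum, ← Finset.mul_sum] at h5
  have h7 : 1 / (2 * s) * ∑ w, sc_Q σ h' w ^ 2 ≤ s / 2 * ∑ w, h' w ^ 2 := by
    calc _ ≤ 1 / (2 * s) * (q * ∑ w, h' w ^ 2) := by gcongr
      _ = _ := by rw [← hs2]; field_simp
  linarith
end StC

lemma sc_quad_abs {V : Type*} [Fintype V] (A : V → V → ℕ) (hs : ∀ u v, A u v = A v u) (d : ℕ) (hr : ∀ u, ∑ v, A u v = d)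
    (f : V → ℝ) : - ∑ u, ∑ v, (A u v : ℝ) * f u * f v ≤ d * ∑ u, f u ^ 2 := by
  have hr' : ∀ u, ∑ v, (A u v : ℝ) = d := fun u => by exact_mod_cast hr u
  have e : d * ∑ u, f u ^ 2 = ∑ u, ∑ v, (A u v : ℝ) * ((f u ^ 2 + f v ^ 2) / 2) := by
    have h1 : ∑ u, ∑ v, (A u v : ℝ) * (f u ^ 2) = d * ∑ u, f u ^ 2 := by
      simp only [← Finset.sum_mul, hr', ← Finset.mul_sum]
    have h2 : ∑ u, ∑ v, (A u v : ℝ) * (f v ^ 2) = d * ∑ u, f u ^ 2 := by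
      rw [Finset.sum_comm, ← h1]
      refine Finset.sum_congr rfl fun u _ => Finset.sum_congr rfl fun v _ => by rw [hs]
    have h3 : ∀ u v, (A u v : ℝ) * ((f u ^ 2 + f v ^ 2) / 2) = (A u v : ℝ) * (f u ^ 2) / 2 + (A u v : ℝ) * (f v ^ 2) / 2 := fun u v => by ring
    simp only [h3, Finset.sum_add_distrib, ← Finset.sum_div, h1, h2]
    ring
  rw [e, ← Finset.sum_neg_distrib]
  refine Finset.sum_le_sum fun u _ => ?_
  rw [← Finset.sum_neg_distrib]
  refine Finset.sum_le_sum fun v _ => ?_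
  have : (0:ℝ) ≤ A u v := Nat.cast_nonneg _
  nlinarith [mul_nonneg this (sq_nonneg (f u + f v))]

/-- the complete-graph-on-four blowup -/
lemma sc_K4 {V : Type*} [Fintype V] (A : V → V → ℕ) (hs : ∀ u v, A u v = A v u) (d : ℕ) (hr : ∀ u, ∑ v, A u v = d)
    (l : ℝ) (hl : (d:ℝ) ≤ 3 * l)
    (hA : ∀ f : V → ℝ, ∑ u, f u = 0 → ∑ u, ∑ v, (A u v : ℝ) * f u * f v ≤ l * ∑ u, f u ^ 2)
    (F : V → Fin 4 → ℝ) (hF : ∑ u, ∑ i, F u i = 0) :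
    ∑ u, ∑ v, (A u v : ℝ) * ∑ i, ∑ j, (if i = j then 0 else F u i * F v j) ≤ 3 * l * ∑ u, ∑ i, F u i ^ 2 := by
  set S : V → ℝ := fun u => ∑ i, F u i with hS
  set T : Fin 4 → V → ℝ := fun i u => F u i - S u / 4 with hT
  have e1 : ∀ u v, ∑ i, ∑ j, (if i = j then 0 else F u i * F v j) = 3 / 4 * (S u * S v) - ∑ i, T i u * T i v := by
    intro u v
    simp only [hS, hT, Fin.sum_univ_four]
    simp
    ring
  have e2 : ∀ u, ∑ i, F u i ^ 2 = S u ^ 2 / 4 + ∑ i, T i u ^ 2 := by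
    intro u
    simp only [hS, hT, Fin.sum_univ_four]
    ring
  simp only [e1, e2]
  have h1 := hA S hF
  have h2 := fun i => sc_quad_abs A hs d hr (T i)
  have h3 : ∑ u, ∑ v, (A u v : ℝ) * (3 / 4 * (S u * S v) - ∑ i, T i u * T i v) = 
     3 / 4 * ∑ u, ∑ v, (A u v : ℝ) * S u * S v + ∑ i, (- ∑ u, ∑ v, (A u v : ℝ) * T i u * T i v) := by
    rw [Finset.sum_neg_distrib]
    simp only [Fin.sum_univ_four, Finset.mul_sum, ← Finset.sum_add_distrib, ← sub_eq_add_neg, ← Finset.sum_sub_distrib]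
    refine Finset.sum_congr rfl fun u _ => Finset.sum_congr rfl fun v _ => by ring
  rw [h3, Finset.sum_add_distrib, ← Finset.sum_div]
  have h4 : ∑ i, (- ∑ u, ∑ v, (A u v : ℝ) * T i u * T i v) ≤ ∑ i, d * ∑ u, T i u ^ 2 := Finset.sum_le_sum fun i _ => h2 i
  have h5 : ∑ i, d * ∑ u, T i u ^ 2 = d * ∑ u, ∑ i, T i u ^ 2 := by rw [← Finset.mul_sum, Finset.sum_comm]
  have h6 : (d:ℝ) * ∑ u, ∑ i, T i u ^ 2 ≤ 3 * l * ∑ u, ∑ i, T i u ^ 2 := by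
    refine mul_le_mul_of_nonneg_right hl ?_
    exact Finset.sum_nonneg fun _ _ => Finset.sum_nonneg fun _ _ => sq_nonneg _
  linarith


section StC
variable {q : ℕ} [Fact q.Prime] {V : Type} [Fintype V] [DecidableEq V]

noncomputable def sc_B (A : V → V → ℕ) (x y : (V × Fin 4) × (ZMod q × ZMod q)) : ℝ :=
  if x.1.2 = y.1.2 then 0 else
    ∑ σ ∈ Finset.range (A x.1.1 y.1.1), if x.2.2 + y.2.2 = x.2.1 * y.2.1 + (σ : ZMod q) then 1 else 0

lemma sc_val (t : ZMod q) (a : ℕ) (ha : a ≤ q) :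
    (∑ σ ∈ Finset.range a, if t = (σ : ZMod q) then (1:ℝ) else 0) = 0 ∨ (∑ σ ∈ Finset.range a, if t = (σ : ZMod q) then (1:ℝ) else 0) = 1 := by
  by_cases h : t.val < a
  · right
    rw [Finset.sum_eq_single t.val]
    · rw [if_pos (ZMod.natCast_zmod_val t).symm]
    · intro b hb hne
      rw [if_neg]
      rintro rfl
      apply hne
      rw [ZMod.val_natCast_of_lt (lt_of_lt_of_le (Finset.mem_range.1 hb) ha)]
    · intro h'; exact absurd (Finset.mem_range.2 h) h'
  · left
    refine Finset.sum_eq_zero fun b hb => ?_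
    rw [if_neg]
    rintro rfl
    apply h
    rw [ZMod.val_natCast_of_lt (lt_of_lt_of_le (Finset.mem_range.1 hb) ha)]
    exact Finset.mem_range.1 hb

lemma sc_B_01 (A : V → V → ℕ) (hA : ∀ u v, A u v ≤ q) (x y : (V × Fin 4) × (ZMod q × ZMod q)) :
    sc_B A x y = 0 ∨ sc_B A x y = 1 := by
  unfold sc_B
  split_ifs with h
  · left; rfl
  · have := sc_val (x.2.2 + y.2.2 - x.2.1 * y.2.1) (A x.1.1 y.1.1) (hA _ _)
    simp only [sub_eq_iff_eq_add, add_comm _ (x.2.1 * y.2.1)] at this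
    exact this

lemma sc_B_symm (A : V → V → ℕ) (hs : ∀ u v, A u v = A v u) (x y : (V × Fin 4) × (ZMod q × ZMod q)) :
    sc_B A x y = sc_B A y x := by
  unfold sc_B
  rw [hs, add_comm x.2.2, mul_comm x.2.1]
  simp only [eq_comm]

lemma sc_B_diag (A : V → V → ℕ) (x : (V × Fin 4) × (ZMod q × ZMod q)) : sc_B A x x = 0 := by
  simp [sc_B]

lemma sc_B_apply (A : V → V → ℕ) (f : (V × Fin 4) × (ZMod q × ZMod q) → ℝ) (x : (V × Fin 4) × (ZMod q × ZMod q)) :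
    ∑ y, sc_B A x y * f y = ∑ v, ∑ j, if x.1.2 = j then 0 else ∑ σ ∈ Finset.range (A x.1.1 v), sc_Q (σ : ZMod q) (fun w => f ((v, j), w)) x.2 := by
  rw [Fintype.sum_prod_type, Fintype.sum_prod_type]
  refine Finset.sum_congr rfl fun v _ => Finset.sum_congr rfl fun j _ => ?_
  unfold sc_B
  by_cases h : x.1.2 = j
  · simp [h]
  · simp only [if_neg h, Finset.sum_mul]
    rw [Finset.sum_comm]
    refine Finset.sum_congr rfl fun σ _ => ?_
    unfold sc_Q
    rw [Fintype.sum_prod_type]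
    refine Finset.sum_congr rfl fun b _ => ?_
    simp only [ite_mul, one_mul, zero_mul]
    have : ∀ c : ZMod q, (x.2.2 + c = x.2.1 * b + (σ:ZMod q)) ↔ c = x.2.1 * b + σ - x.2.2 := by
      intro c; rw [eq_sub_iff_add_eq, add_comm]
    simp [this]

lemma sc_B_lift (A : V → V → ℕ) (e : V → ℝ) (x : (V × Fin 4) × (ZMod q × ZMod q)) :
    ∑ y, sc_B A x y * e y.1.1 = 3 * q * ∑ v, (A x.1.1 v : ℝ) * e v := by
  rw [sc_B_apply A (fun y => e y.1.1)]
  simp only [sc_Q, Finset.sum_const, Finset.card_univ, ZMod.card, Finset.card_range, nsmul_eq_mul]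
  rw [Finset.mul_sum]
  refine Finset.sum_congr rfl fun v _ => ?_
  rw [← Finset.sum_erase_add _ _ (Finset.mem_univ x.1.2)]
  rw [if_pos rfl, add_zero, Finset.sum_congr rfl (g := fun _ => (A x.1.1 v : ℝ) * (q * e v))]
  · simp
    ring
  · intro j hj
    rw [if_neg (Ne.symm (Finset.ne_of_mem_erase hj))]

lemma sc_B_quad (A : V → V → ℕ) (hs : ∀ u v, A u v = A v u) (d : ℕ) (hr : ∀ u, ∑ v, A u v = d)
    (l : ℝ) (hl : (d:ℝ) ≤ 3 * l) (hq : 9 ≤ q)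
    (hA : ∀ f : V → ℝ, ∑ u, f u = 0 → ∑ u, ∑ v, (A u v : ℝ) * f u * f v ≤ l * ∑ u, f u ^ 2)
    (f : (V × Fin 4) × (ZMod q × ZMod q) → ℝ) (hf : ∑ x, f x = 0) :
    ∑ x, ∑ y, sc_B A x y * f x * f y ≤ 3 * q * l * ∑ x, f x ^ 2 := by
  have hq0 : (0:ℝ) < q := by exact_mod_cast (Fact.out : q.Prime).pos
  have hr' : ∀ u, ∑ v, (A u v : ℝ) = d := fun u => by exact_mod_cast hr u
  set F : V → Fin 4 → ℝ := fun u i => ∑ w, f ((u, i), w) with hF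
  set N : V → Fin 4 → ℝ := fun u i => ∑ w, f ((u, i), w) ^ 2 - (F u i) ^ 2 / q ^ 2 with hN
  have hF0 : ∑ u, ∑ i, F u i = 0 := by
    rw [← hf, Fintype.sum_prod_type, Fintype.sum_prod_type]
  have hN0 : ∀ u i, 0 ≤ N u i := by
    intro u i
    have : (F u i) ^ 2 ≤ (Finset.univ : Finset (ZMod q × ZMod q)).card * ∑ w, f ((u, i), w) ^ 2 := sq_sum_le_card_mul_sum_sq
    rw [Finset.card_univ, Fintype.card_prod, ZMod.card] at this
    push_cast at this
    simp only [hN]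
    rw [sub_nonneg, div_le_iff₀ (by positivity)]
    linarith
  have e1 : ∑ x, ∑ y, sc_B A x y * f x * f y = ∑ u, ∑ i, ∑ v, ∑ j, if i = j then 0 else 
      ∑ σ ∈ Finset.range (A u v), ∑ w, f ((u, i), w) * sc_Q (σ : ZMod q) (fun w => f ((v, j), w)) w := by
    have h : ∀ x, ∑ y, sc_B A x y * f x * f y = f x * ∑ y, sc_B A x y * f y := by
      intro x; rw [Finset.mul_sum]; refine Finset.sum_congr rfl fun y _ => by ring
    simp only [h, sc_B_apply]
    rw [Fintype.sum_prod_type, Fintype.sum_prod_type]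
    refine Finset.sum_congr rfl fun u _ => Finset.sum_congr rfl fun i _ => ?_
    simp only [Finset.mul_sum]
    rw [Finset.sum_comm]
    refine Finset.sum_congr rfl fun v _ => ?_
    rw [Finset.sum_comm]
    refine Finset.sum_congr rfl fun j _ => ?_
    by_cases hij : i = j
    · simp [hij]
    · simp only [if_neg hij]
      simp only [Finset.mul_sum]
      rw [Finset.sum_comm]
  have e2 : ∑ x, ∑ y, sc_B A x y * f x * f y ≤ ∑ u, ∑ i, ∑ v, ∑ j, if i = j then 0 else 
      (A u v : ℝ) * (F u i * F v j / q + Real.sqrt q / 2 * (N u i + N v j)) := by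
    rw [e1]
    refine Finset.sum_le_sum fun u _ => Finset.sum_le_sum fun i _ => Finset.sum_le_sum fun v _ => Finset.sum_le_sum fun j _ => ?_
    split_ifs
    · exact le_rfl
    · calc _ ≤ ∑ σ ∈ Finset.range (A u v), (F u i * F v j / q + Real.sqrt q / 2 * (N u i + N v j)) :=
            Finset.sum_le_sum fun σ _ => sc_Q_pair (σ : ZMod q) (fun w => f ((u, i), w)) (fun w => f ((v, j), w))
        _ = _ := by rw [Finset.sum_const, Finset.card_range, nsmul_eq_mul]
  refine e2.trans ?_
  have h4 : ∀ (u v : V), ∑ i, ∑ j, (if i = j then 0 else (A u v : ℝ) * (F u i * F v j / q + Real.sqrt q / 2 * (N u i + N v j)))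
      = 1 / q * ((A u v : ℝ) * ∑ i, ∑ j, (if i = j then 0 else F u i * F v j)) + 3 * (Real.sqrt q / 2) * ((A u v : ℝ) * ∑ i, N u i)
       + 3 * (Real.sqrt q / 2) * ((A u v : ℝ) * ∑ i, N v i) := by
    intro u v
    simp only [Fin.sum_univ_four]
    simp
    ring
  have e3 : ∑ u, ∑ i, ∑ v, ∑ j, (if i = j then 0 else 
      (A u v : ℝ) * (F u i * F v j / q + Real.sqrt q / 2 * (N u i + N v j))) = 
      1 / q * (∑ u, ∑ v, (A u v : ℝ) * ∑ i, ∑ j, (if i = j then 0 else F u i * F v j)) + 3 * Real.sqrt q * d * ∑ u, ∑ i, N u i := by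
    have hc : ∀ u, ∑ i, ∑ v, ∑ j, (if i = j then 0 else 
      (A u v : ℝ) * (F u i * F v j / q + Real.sqrt q / 2 * (N u i + N v j))) = ∑ v, ∑ i, ∑ j, (if i = j then 0 else 
      (A u v : ℝ) * (F u i * F v j / q + Real.sqrt q / 2 * (N u i + N v j))) := fun u => Finset.sum_comm
    simp only [hc, h4, Finset.sum_add_distrib, ← Finset.mul_sum]
    have h6 : ∑ u, ∑ v, (A u v : ℝ) * ∑ i, N v i = d * ∑ u, ∑ i, N u i := by
      rw [Finset.sum_comm]
      simp only [hs _, ← Finset.sum_mul, hr', ← Finset.mul_sum]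
    rw [h6]
    simp only [← Finset.sum_mul, hr', ← Finset.mul_sum]
    ring
  rw [e3]
  have h7 := sc_K4 A hs d hr l hl hA F hF0
  have hl0 : 0 ≤ l := by
    have : (0:ℝ) ≤ d := Nat.cast_nonneg _
    linarith
  have hsq : 3 ≤ Real.sqrt q := by
    apply Real.le_sqrt_of_sq_le
    have : (9:ℝ) ≤ q := by exact_mod_cast hq
    linarith
  have hsq2 : Real.sqrt q ^ 2 = q := Real.sq_sqrt hq0.le
  have hNs : 0 ≤ ∑ u, ∑ i, N u i := Finset.sum_nonneg fun u _ => Finset.sum_nonneg fun i _ => hN0 u i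
  have h8 : 3 * Real.sqrt q * d * ∑ u, ∑ i, N u i ≤ 3 * q * l * ∑ u, ∑ i, N u i := by
    refine mul_le_mul_of_nonneg_right ?_ hNs
    have : Real.sqrt q * d ≤ Real.sqrt q * (Real.sqrt q * l) := by
      refine mul_le_mul_of_nonneg_left ?_ (by positivity)
      nlinarith
    nlinarith
  have e4 : ∑ x, f x ^ 2 = ∑ u, ∑ i, N u i + (∑ u, ∑ i, F u i ^ 2) / q ^ 2 := by
    rw [Fintype.sum_prod_type, Fintype.sum_prod_type]
    simp only [hN, Finset.sum_sub_distrib, ← Finset.sum_div]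
    ring
  rw [e4]
  have h9 : 1 / (q:ℝ) * (∑ u, ∑ v, (A u v : ℝ) * ∑ i, ∑ j, (if i = j then 0 else F u i * F v j)) ≤ 1 / q * (3 * l * ∑ u, ∑ i, F u i ^ 2) := by
    gcongr
  have h10 : 1 / (q:ℝ) * (3 * l * ∑ u, ∑ i, F u i ^ 2) = 3 * q * l * ((∑ u, ∑ i, F u i ^ 2) / q ^ 2) := by
    field_simp
  linarith
end StC

/-- Stage C summary -/
lemma stageC : ∃ p : ℕ, 0 < p ∧ ∀ q : ℕ, q.Prime → 14 * p ^ 2 + 9 ≤ q → ∀ m j : ℕ, 0 < j →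
    ∃ (V : Type) (_ : Fintype V) (B : V → V → ℝ) (e : Fin m → V → ℝ),
    Fintype.card V = 4 * q ^ 2 * (245 ^ m * j ^ 2) ∧ (∀ u v, B u v = B v u) ∧ (∀ u v, B u v = 0 ∨ B u v = 1) ∧
    (∀ u, B u u = 0) ∧ (∀ u, ∑ v, B u v = 42 * q * p ^ 2) ∧
    (∀ f : V → ℝ, ∑ u, f u = 0 → ∑ u, ∑ v, B u v * f u * f v ≤ (3 * q * p ^ 2 : ℝ) * (3 * Real.sqrt 5 - 1) * ∑ u, f u ^ 2) ∧
    LinearIndependent ℝ e ∧ (∀ i u, ∑ v, B u v * e i v = (3 * q * p ^ 2 : ℝ) * (3 * Real.sqrt 5 - 1) * e i u) := by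
  obtain ⟨p, hp, h⟩ := stageB
  refine ⟨p, hp, fun q hq hpq m j hj => ?_⟩
  obtain ⟨V, _, _, A, e, h1, h2, h3, h4, h5, h6⟩ := h m j hj
  haveI : Fact q.Prime := ⟨hq⟩
  have h5' := sb_sqrt5
  have hAle : ∀ u v, A u v ≤ q := by
    intro u v
    have : A u v ≤ ∑ v, A u v := Finset.single_le_sum (fun _ _ => Nat.zero_le _) (Finset.mem_univ v)
    rw [h3] at this
    omega
  refine ⟨(V × Fin 4) × (ZMod q × ZMod q), inferInstance, sc_B A, fun i x => e i x.1.1, ?_, sc_B_symm A h2, sc_B_01 A hAle, sc_B_diag A, ?_, ?_, ?_, ?_⟩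
  · simp only [Fintype.card_prod, h1, ZMod.card, Fintype.card_fin]; ring
  · intro u
    have := sc_B_lift A (fun _ => 1) u
    simp only [mul_one] at this
    rw [this]
    have h3' : ∑ v, (A u.1.1 v : ℝ) = 14 * p ^ 2 := by exact_mod_cast h3 u.1.1
    rw [h3']; ring
  · intro f hf
    have := sc_B_quad A h2 _ h3 ((p:ℝ) ^ 2 * (3 * Real.sqrt 5 - 1)) (by push_cast; nlinarith [sq_nonneg (p:ℝ)]) (by omega) h4 f hf
    refine this.trans (le_of_eq (by ring))
  · have := h5.map' (LinearMap.funLeft ℝ ℝ (fun x : (V × Fin 4) × (ZMod q × ZMod q) => x.1.1)) (by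
      rw [LinearMap.ker_eq_bot]
      exact LinearMap.funLeft_injective_of_surjective _ _ _ (fun v => ⟨((v, 0), 0), rfl⟩))
    exact this
  · intro i u
    rw [sc_B_lift A (e i), h6]; ring


lemma sp_entry {W : Type*} [Fintype W] [DecidableEq W] {M : Matrix W W ℝ} (hM : M.IsHermitian) (u v : W) :
    M u v = ∑ k, hM.eigenvalues k * (hM.eigenvectorBasis k u * hM.eigenvectorBasis k v) := by
  have h := congrFun (congrFun hM.spectral_theorem u) v
  rw [Unitary.conjStarAlgAut_apply] at h
  rw [h]
  rw [Matrix.mul_apply]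
  simp only [Matrix.mul_diagonal, Matrix.star_apply, Matrix.IsHermitian.eigenvectorUnitary_apply]
  simp
  refine Finset.sum_congr rfl fun k _ => by ring

lemma gram_lemma {W : Type*} [Fintype W] [DecidableEq W] (M : Matrix W W ℝ) (hs : ∀ u v, M u v = M v u)
    (hpsd : ∀ x : W → ℝ, 0 ≤ ∑ u, ∑ v, M u v * x u * x v) (m n : ℕ) (hn : Fintype.card W ≤ n + m)
    (e : Fin m → W → ℝ) (he : LinearIndependent ℝ e) (hk : ∀ i u, ∑ v, M u v * e i v = 0) :
    ∃ v : W → EuclideanSpace ℝ (Fin n), ∀ a b, ⟪v a, v b⟫ = M a b := by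
  have hH : M.IsHermitian := by
    ext u v; simp [hs u v]
  have hP : M.PosSemidef := by
    refine Matrix.PosSemidef.of_dotProduct_mulVec_nonneg hH fun x => ?_
    refine (hpsd x).trans (le_of_eq ?_)
    simp only [dotProduct, Matrix.mulVec, Finset.mul_sum, star_trivial]
    refine Finset.sum_congr rfl fun u _ => Finset.sum_congr rfl fun v _ => by ring
  have hnn := fun i => hP.eigenvalues_nonneg i
  have hrank : M.rank ≤ n := by
    have h1 := LinearMap.finrank_range_add_finrank_ker M.mulVecLin
    have h2 : m ≤ Module.finrank ℝ (LinearMap.ker M.mulVecLin) := by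
      have h3 := finrank_span_eq_card he
      rw [Fintype.card_fin] at h3
      rw [← h3]
      refine Submodule.finrank_mono ?_
      rw [Submodule.span_le]
      rintro _ ⟨i, rfl⟩
      simp only [SetLike.mem_coe, LinearMap.mem_ker, Matrix.mulVecLin_apply]
      ext u
      exact hk i u
    rw [Module.finrank_fintype_fun_eq_card] at h1
    have : M.rank = Module.finrank ℝ (LinearMap.range M.mulVecLin) := rfl
    omega
  rw [hH.rank_eq_card_non_zero_eigs] at hrank
  have : Nonempty ({i // hH.eigenvalues i ≠ 0} ↪ Fin n) := by
    apply Function.Embedding.nonempty_of_card_le; simpa using hrank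
  obtain ⟨ι⟩ := this
  refine ⟨fun a => WithLp.toLp 2 (Function.extend ι (fun k => Real.sqrt (hH.eigenvalues k) * hH.eigenvectorBasis k.1 a) 0), fun a b => ?_⟩
  rw [sp_entry hH a b]
  simp only [PiLp.inner_apply, RCLike.inner_apply, conj_trivial]
  rw [← Fintype.sum_of_injective ι ι.injective (fun k => hH.eigenvalues k * (hH.eigenvectorBasis k.1 a * hH.eigenvectorBasis k.1 b))]
  · refine Fintype.sum_of_injective Subtype.val Subtype.val_injective _ _ ?_ ?_
    · intro i hi
      have : hH.eigenvalues i = 0 := by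
        by_contra h; exact hi ⟨⟨i, h⟩, rfl⟩
      rw [this, zero_mul]
    · intro i; rfl
  · intro i hi
    rw [Function.extend_apply' _ _ _ hi]; simp
  · intro k
    rw [ι.injective.extend_apply, ι.injective.extend_apply]
    have := Real.mul_self_sqrt (hnn k.1)
    linear_combination (hH.eigenvectorBasis k.1 a * hH.eigenvectorBasis k.1 b) * (-this)

lemma stageD {V : Type} [Fintype V] (B : V → V → ℝ) (hs : ∀ u v, B u v = B v u) (h01 : ∀ u v, B u v = 0 ∨ B u v = 1)
    (hd0 : ∀ u, B u u = 0) (d l : ℝ) (hl : 0 < l) (hdl : l < d) (hr : ∀ u, ∑ v, B u v = d)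
    (hB : ∀ f : V → ℝ, ∑ u, f u = 0 → ∑ u, ∑ v, B u v * f u * f v ≤ l * ∑ u, f u ^ 2)
    (m : ℕ) (e : Fin m → V → ℝ) (he : LinearIndependent ℝ e) (hk : ∀ i u, ∑ v, B u v * e i v = l * e i u)
    (M n : ℕ) (h1 : 4 * (d - l) ≤ Fintype.card V) (h2 : 2 * (d - l) * M ≤ l * Fintype.card V)
    (hn : Fintype.card V + M = n + m) : HasEquiangularLines (1 / (2 * l + 1)) n (n + m) := by
  classical
  set N0 : ℝ := (Fintype.card V : ℝ) with hN0
  have hN0p : 0 < N0 := by linarith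
  set a := (d - l) / N0 with ha
  have ha0 : 0 ≤ a := by have : 0 ≤ d - l := by linarith
                         positivity
  have ha1 : a ≤ 1 / 4 := by rw [ha, div_le_iff₀ hN0p]; linarith
  -- quadratic form bound
  have hquad : ∀ g : V → ℝ, ∑ u, ∑ v, B u v * g u * g v ≤ l * ∑ u, g u ^ 2 + a * (∑ u, g u) ^ 2 := by
    intro g
    set G := ∑ u, g u with hG
    set g' : V → ℝ := fun u => g u - G / N0 with hg'
    have s0 : ∑ u, g' u = 0 := by
      simp only [hg', Finset.sum_sub_distrib, Finset.sum_const, Finset.card_univ, nsmul_eq_mul, ← hN0, ← hG]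
      field_simp; ring
    have h3 := hB g' s0
    have e1 : ∑ u, g' u ^ 2 = ∑ u, g u ^ 2 - G ^ 2 / N0 := by
      have : ∀ u, g' u ^ 2 = g u ^ 2 - 2 * (G / N0) * g u + (G / N0) ^ 2 := fun u => by simp only [hg']; ring
      simp only [this, Finset.sum_add_distrib, Finset.sum_sub_distrib, ← Finset.mul_sum, Finset.sum_const, Finset.card_univ, nsmul_eq_mul, ← hN0, ← hG]
      field_simp; ring
    have e2 : ∑ u, ∑ v, B u v * g' u * g' v = ∑ u, ∑ v, B u v * g u * g v - d * G ^ 2 / N0 := by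
      have : ∀ u v, B u v * g' u * g' v = B u v * g u * g v - G / N0 * (B u v * g u) - G / N0 * (B v u * g v) + (G / N0) ^ 2 * B u v := by
        intro u v; simp only [hg']; rw [hs v u]; ring
      have h5 : ∑ u, ∑ v, B u v * g u = d * G := by
        simp only [← Finset.sum_mul, hr, ← Finset.mul_sum]; rfl
      have h6 : ∑ u, ∑ v, B v u * g v = d * G := by
        rw [Finset.sum_comm]; exact h5
      simp only [this, Finset.sum_add_distrib, Finset.sum_sub_distrib, ← Finset.mul_sum, h5, h6, hr, Finset.sum_const, Finset.card_univ, nsmul_eq_mul, ← hN0]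
      field_simp; ring
    rw [e1, e2] at h3
    have : a * G ^ 2 = d * G ^ 2 / N0 - l * (G ^ 2 / N0) := by rw [ha]; ring
    linarith
  -- eigenvectors are orthogonal to the all-ones vector
  have he0 : ∀ i, ∑ u, e i u = 0 := by
    intro i
    have h3 : ∑ u, ∑ v, B u v * e i v = l * ∑ u, e i u := by simp only [hk, ← Finset.mul_sum]
    rw [Finset.sum_comm] at h3
    simp only [hs _, ← Finset.sum_mul, hr, ← Finset.mul_sum] at h3
    have : (d - l) * ∑ u, e i u = 0 := by linarith
    rcases mul_eq_zero.1 this with h | h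
    · linarith
    · exact h
  set K : Matrix (V ⊕ Fin M) (V ⊕ Fin M) ℝ := fun x y => (if x = y then l else 0) - (Sum.elim (fun u => Sum.elim (fun v => B u v) (fun _ => 0) y) (fun _ => 0) x) + 1 / 2 with hK
  have hKa : ∀ (f : V ⊕ Fin M → ℝ) x, ∑ y, K x y * f y = l * f x - (Sum.elim (fun u => ∑ v, B u v * f (Sum.inl v)) (fun _ => 0) x) + (∑ y, f y) / 2 := by
    intro f x
    simp only [hK, add_mul, sub_mul, Finset.sum_add_distrib, Finset.sum_sub_distrib, ite_mul, zero_mul, Finset.sum_ite_eq, Finset.mem_univ, if_true, ← Finset.mul_sum]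
    congr 1
    · congr 1
      cases x with
      | inl u => simp [Fintype.sum_sum_type]
      | inr i => simp
    · ring
  have hKs : ∀ x y, K x y = K y x := by
    intro x y
    simp only [hK, eq_comm (a := x)]
    congr 2
    cases x <;> cases y <;> simp [hs]
  have hKpsd : ∀ x : V ⊕ Fin M → ℝ, 0 ≤ ∑ u, ∑ v, K u v * x u * x v := by
    intro f
    have h3 : ∀ u, ∑ v, K u v * f u * f v = f u * ∑ v, K u v * f v := by
      intro u; rw [Finset.mul_sum]; refine Finset.sum_congr rfl fun v _ => by ring
    simp only [h3, hKa]
    set g : V → ℝ := fun v => f (Sum.inl v) with hg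
    set h : Fin M → ℝ := fun v => f (Sum.inr v) with hh
    set G := ∑ u, g u with hG
    set H := ∑ i, h i with hH
    have e1 : ∑ y, f y = G + H := by rw [Fintype.sum_sum_type]
    have e2 : ∑ u, f u * (l * f u - (Sum.elim (fun u => ∑ v, B u v * f (Sum.inl v)) (fun _ => 0) u) + (∑ y, f y) / 2) =
        l * ∑ u, g u ^ 2 + l * ∑ i, h i ^ 2 - ∑ u, ∑ v, B u v * g u * g v + (G + H) ^ 2 / 2 := by
      rw [e1, Fintype.sum_sum_type]
      have h5 : ∀ u, ∑ v, B u v * g u * g v = g u * ∑ v, B u v * g v := by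
        intro u; rw [Finset.mul_sum]; refine Finset.sum_congr rfl fun v _ => by ring
      simp only [h5, Sum.elim_inl, Sum.elim_inr, sub_zero, mul_add, mul_sub, Finset.sum_add_distrib, Finset.sum_sub_distrib, ← Finset.sum_mul]
      have h6 : ∑ u, f (Sum.inl u) * (l * f (Sum.inl u)) = l * ∑ u, g u ^ 2 := by
        rw [Finset.mul_sum]; refine Finset.sum_congr rfl fun v _ => by simp only [hg]; ring
      have h7 : ∑ u, f (Sum.inr u) * (l * f (Sum.inr u)) = l * ∑ u, h u ^ 2 := by
        rw [Finset.mul_sum]; refine Finset.sum_congr rfl fun v _ => by simp only [hh]; ring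
      rw [h6, h7]
      have h8 : ∑ x, f (Sum.inl x) = G := rfl
      have h9 : ∑ x, f (Sum.inr x) = H := rfl
      rw [h8, h9]
      ring
    rw [e2]
    have h4 := hquad g
    have h5 : H ^ 2 ≤ M * ∑ i, h i ^ 2 := by
      have : H ^ 2 ≤ (Finset.univ : Finset (Fin M)).card * ∑ i, h i ^ 2 := sq_sum_le_card_mul_sum_sq
      simpa using this
    have h6 : 2 * a * H ^ 2 ≤ l * ∑ i, h i ^ 2 := by
      have h7 : 0 ≤ ∑ i, h i ^ 2 := Finset.sum_nonneg fun _ _ => sq_nonneg _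
      calc 2 * a * H ^ 2 ≤ 2 * a * (M * ∑ i, h i ^ 2) := by gcongr
        _ = (2 * (d - l) * M) / N0 * ∑ i, h i ^ 2 := by rw [ha]; ring
        _ ≤ l * ∑ i, h i ^ 2 := by
          refine mul_le_mul_of_nonneg_right ?_ h7
          rw [div_le_iff₀ hN0p]; exact h2
    have h7 : 0 ≤ (1 - 4 * a) * ((G + H) ^ 2 / 2) + 4 * a * (G / 2 + H) ^ 2 := by
      have : 0 ≤ 1 - 4 * a := by linarith
      positivity
    have h8 : (1 - 4 * a) * ((G + H) ^ 2 / 2) + 4 * a * (G / 2 + H) ^ 2 = (G + H) ^ 2 / 2 + 2 * a * H ^ 2 - a * G ^ 2 := by ring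
    linarith
  obtain ⟨v, hv⟩ := gram_lemma ((2 / (2 * l + 1)) • K) (by intro u v; simp only [Matrix.smul_apply, hKs u v])
    (by
      intro x
      have := hKpsd x
      simp only [Matrix.smul_apply, smul_eq_mul, mul_assoc, ← Finset.mul_sum] at this ⊢
      have h3 : 0 ≤ 2 / (2 * l + 1) := by positivity
      exact mul_nonneg h3 this) m n (by rw [Fintype.card_sum, Fintype.card_fin, hn])
    (fun i => Sum.elim (e i) 0) (by
      rw [Fintype.linearIndependent_iff] at he ⊢
      intro g hg
      apply he g
      ext u
      have := congrFun hg (Sum.inl u)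
      simpa using this) (by
      intro i u
      simp only [Matrix.smul_apply, smul_eq_mul, mul_assoc, ← Finset.mul_sum]
      rw [hKa]
      rw [Fintype.sum_sum_type]
      simp only [Sum.elim_inl, Sum.elim_inr, he0, Pi.zero_apply]
      cases u with
      | inl u => simp [hk]
      | inr u => simp)
  have hcard : Fintype.card (V ⊕ Fin M) = n + m := by rw [Fintype.card_sum, Fintype.card_fin, hn]
  set eqv := (Fintype.equivFinOfCardEq hcard).symm with heqv
  have hlp : 0 < 2 * l + 1 := by linarith
  have hdiag : ∀ x, K x x = l + 1 / 2 := by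
    intro x
    simp only [hK, if_true]
    cases x <;> simp [hd0]
  have hoff : ∀ x y, x ≠ y → K x y = 1 / 2 ∨ K x y = - (1 / 2) := by
    intro x y hxy
    simp only [hK, if_neg hxy]
    cases x with
    | inl u => cases y with
      | inl v => rcases h01 u v with h | h <;> simp [h]; norm_num
      | inr v => simp
    | inr u => simp
  refine ⟨fun i => v (eqv i), fun i => ?_, fun i j hij => ?_⟩
  · have := hv (eqv i) (eqv i)
    rw [real_inner_self_eq_norm_sq, Matrix.smul_apply, hdiag, smul_eq_mul] at this
    have h3 : 2 / (2 * l + 1) * (l + 1 / 2) = 1 := by field_simp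
    rw [h3] at this
    have h4 := norm_nonneg (v (eqv i))
    show ‖v (eqv i)‖ = 1
    nlinarith
  · rw [hv, Matrix.smul_apply, smul_eq_mul, abs_mul, abs_of_pos (by positivity)]
    have : |K (eqv i) (eqv j)| = 1 / 2 := by
      rcases hoff _ _ (eqv.injective.ne hij) with h | h <;> rw [h] <;> norm_num [abs_of_pos]
    rw [this]; ring


lemma lower_bound : ∃ p : ℕ, 0 < p ∧ ∀ q : ℕ, q.Prime → 14 * p ^ 2 + 9 ≤ q → ∃ c > (0:ℝ), ∃ n0 : ℕ, ∀ n : ℕ, n0 ≤ n →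
    ∃ m : ℕ, c * Real.log (Real.log n) ≤ m ∧
      HasEquiangularLines (1 / (2 * ((3 * q * p ^ 2 : ℝ) * (3 * Real.sqrt 5 - 1)) + 1)) n (n + m) := by
  obtain ⟨p, hp, h⟩ := stageC
  refine ⟨p, hp, fun q hq hpq => ?_⟩
  have h5 := sb_sqrt5
  have hlog : 0 < Real.log 245 := Real.log_pos (by norm_num)
  refine ⟨1 / Real.log 245, by positivity, ?_⟩
  have hq0 : (0:ℝ) < q := by exact_mod_cast hq.pos
  have hev : ∀ᶠ n : ℕ in Filter.atTop, 245 * 400 * (q:ℝ) ^ 2 * Real.log n ≤ (n:ℝ) := by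
    have h1 := Real.isLittleO_log_id_atTop.def (c := 1 / (245 * 400 * (q:ℝ) ^ 2)) (by positivity)
    have h2 := tendsto_natCast_atTop_atTop (R := ℝ) |>.eventually h1
    filter_upwards [h2, Filter.eventually_ge_atTop 1] with n hn hn1
    have hn1' : (1:ℝ) ≤ n := by exact_mod_cast hn1
    simp only [id, Real.norm_eq_abs] at hn
    rw [abs_of_nonneg (Real.log_nonneg hn1'), abs_of_nonneg (by linarith)] at hn
    calc 245 * 400 * (q:ℝ) ^ 2 * Real.log n ≤ 245 * 400 * (q:ℝ) ^ 2 * (1 / (245 * 400 * (q:ℝ) ^ 2) * (n:ℝ)) := by gcongr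
      _ = (n:ℝ) := by field_simp
  obtain ⟨n0, hn0⟩ := Filter.eventually_atTop.1 hev
  refine ⟨max n0 3, fun n hn => ?_⟩
  have hn1 := hn0 n (le_trans (le_max_left _ _) hn)
  have hn3 : (3:ℝ) ≤ n := by exact_mod_cast le_trans (le_max_right _ _) hn
  have hlogn : 1 < Real.log n := by
    rw [Real.lt_log_iff_exp_lt (by linarith)]
    exact lt_of_lt_of_le Real.exp_one_lt_d9 (by linarith)
  set m := ⌈1 / Real.log 245 * Real.log (Real.log n)⌉₊ with hm
  refine ⟨m, Nat.le_ceil _, ?_⟩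
  have hll : 0 ≤ Real.log (Real.log n) := Real.log_nonneg hlogn.le
  have hm1 : (m:ℝ) < 1 / Real.log 245 * Real.log (Real.log n) + 1 := Nat.ceil_lt_add_one (by positivity)
  have h245 : (245:ℝ) ^ m ≤ 245 * Real.log n := by
    rw [← Real.rpow_natCast, ← Real.log_le_log_iff (by positivity) (by positivity), Real.log_rpow (by norm_num), Real.log_mul (by norm_num) (by linarith)]
    have : (m:ℝ) * Real.log 245 ≤ (1 / Real.log 245 * Real.log (Real.log n) + 1) * Real.log 245 := by gcongr
    refine this.trans (le_of_eq ?_)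
    field_simp
    ring
  set D := 4 * q ^ 2 * 245 ^ m with hD
  have hqp := hq.pos
  have hDp : 0 < D := by positivity
  have hDn : D * 100 ≤ n := by
    have : ((D * 100 : ℕ) : ℝ) ≤ n := by
      rw [hD]; push_cast
      calc 4 * (q:ℝ) ^ 2 * 245 ^ m * 100 = 400 * (q:ℝ) ^ 2 * 245 ^ m := by ring
        _ ≤ 400 * (q:ℝ) ^ 2 * (245 * Real.log n) := by gcongr
        _ = 245 * 400 * (q:ℝ) ^ 2 * Real.log n := by ring
        _ ≤ n := hn1
    exact_mod_cast this
  set j := Nat.sqrt (n / D) with hj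
  have hj10 : 10 ≤ j := by
    rw [hj, Nat.le_sqrt', Nat.le_div_iff_mul_le hDp]; omega
  have hj1 : D * j ^ 2 ≤ n := by
    have h1 : j ^ 2 ≤ n / D := Nat.sqrt_le' _
    calc D * j ^ 2 ≤ D * (n / D) := Nat.mul_le_mul_left _ h1
      _ ≤ n := Nat.mul_div_le _ _
  have hj2 : n < D * (j + 1) ^ 2 := by
    have h1 : n / D < (j + 1) ^ 2 := Nat.lt_succ_sqrt' _
    rw [mul_comm]
    exact (Nat.div_lt_iff_lt_mul hDp).1 h1
  obtain ⟨V, _, B, e, hc, hs, h01, hd, hr, hB, he, hk⟩ := h q hq hpq m j (by omega)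
  have hc' : Fintype.card V = D * j ^ 2 := by rw [hc, hD]; ring
  have hmD : m ≤ D := by
    have : m < 245 ^ m := Nat.lt_pow_self (by norm_num)
    have h2 : 245 ^ m ≤ D := by
      rw [hD]; exact Nat.le_mul_of_pos_left _ (by positivity)
    omega
  have hM : ((n + m - D * j ^ 2 : ℕ) : ℝ) ≤ 0.22 * (D * j ^ 2 : ℕ) := by
    rw [Nat.cast_sub (by omega)]
    push_cast
    have a1 : (n:ℝ) ≤ D * (j + 1) ^ 2 := by exact_mod_cast hj2.le
    have a2 : (m:ℝ) ≤ D := by exact_mod_cast hmD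
    have a3 : (10:ℝ) ≤ j := by exact_mod_cast hj10
    have a4 : (0:ℝ) < D := by exact_mod_cast hDp
    have a5 : (0:ℝ) ≤ 0.22 * j ^ 2 - 2 * j - 2 := by nlinarith
    nlinarith [mul_nonneg a4.le a5]
  have hp0 : (0:ℝ) < p := by exact_mod_cast hp
  set L : ℝ := 3 * q * p ^ 2 with hL
  have hLp : 0 < L := by positivity
  refine stageD B hs h01 hd (42 * q * p ^ 2) (L * (3 * Real.sqrt 5 - 1)) (by nlinarith) ?_ hr hB m e he hk (n + m - D * j ^ 2) n ?_ ?_ ?_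
  · have : (42 * q * p ^ 2 : ℝ) = L * 14 := by rw [hL]; ring
    rw [this]
    exact mul_lt_mul_of_pos_left (by linarith) hLp
  · have : (42 * q * p ^ 2 : ℝ) = L * 14 := by rw [hL]; ring
    rw [this, hc']
    have b1 : 4 * (L * 14 - L * (3 * Real.sqrt 5 - 1)) ≤ 40 * L := by nlinarith
    have b2 : 40 * L ≤ 400 * q ^ 2 := by
      have : (14 * p ^ 2 + 9 : ℝ) ≤ q := by exact_mod_cast hpq
      rw [hL]
      nlinarith
    have b3 : (400 * q ^ 2 : ℝ) ≤ ((D * j ^ 2 : ℕ) : ℝ) := by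
      have : 400 * q ^ 2 ≤ D * j ^ 2 := by
        have c1 : 4 * q ^ 2 ≤ D := by rw [hD]; exact Nat.le_mul_of_pos_right _ (by positivity)
        have c2 : 10 ^ 2 ≤ j ^ 2 := Nat.pow_le_pow_left hj10 2
        calc 400 * q ^ 2 = 4 * q ^ 2 * 10 ^ 2 := by ring
          _ ≤ _ := Nat.mul_le_mul c1 c2
      exact_mod_cast this
    linarith
  · have : (42 * q * p ^ 2 : ℝ) = L * 14 := by rw [hL]; ring
    rw [this, hc']
    set X : ℝ := ((D * j ^ 2 : ℕ) : ℝ) with hX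
    have hX0 : 0 ≤ X := Nat.cast_nonneg _
    have b1 : 2 * (L * 14 - L * (3 * Real.sqrt 5 - 1)) ≤ 17 * L := by nlinarith
    calc _ ≤ 17 * L * (0.22 * X) := by
            refine mul_le_mul b1 hM (Nat.cast_nonneg _) (by positivity)
      _ ≤ L * X * (3 * Real.sqrt 5 - 1) := by
            have : 0 ≤ L * X := by positivity
            nlinarith
      _ = _ := by ring
  · rw [hc']; omega


lemma ub_ramsey (s : ℕ) : ∀ t : ℕ, ∃ R : ℕ, ∀ (N : ℕ) (r : Fin N → Fin N → Prop), (∀ i j, r i j → r j i) →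
    ∀ X : Finset (Fin N), R ≤ X.card →
    (∃ Y ⊆ X, Y.card = s ∧ ∀ i ∈ Y, ∀ j ∈ Y, i ≠ j → r i j) ∨
    (∃ Y ⊆ X, Y.card = t ∧ ∀ i ∈ Y, ∀ j ∈ Y, i ≠ j → ¬ r i j) := by
  classical
  induction s with
  | zero => exact fun t => ⟨0, fun N r _ X _ => Or.inl ⟨∅, by simp, by simp, by simp⟩⟩
  | succ s ihs =>
    intro t
    induction t with
    | zero => exact ⟨0, fun N r _ X _ => Or.inr ⟨∅, by simp, by simp, by simp⟩⟩
    | succ t iht =>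
      obtain ⟨R1, h1⟩ := ihs (t + 1)
      obtain ⟨R2, h2⟩ := iht
      refine ⟨R1 + R2 + 1, fun N r hr X hX => ?_⟩
      obtain ⟨x, hx⟩ := Finset.card_pos.1 (show 0 < X.card by omega)
      have hc := Finset.card_filter_add_card_filter_not (s := X.erase x) (r x)
      have hce := Finset.card_erase_of_mem hx
      have key : ∀ (q : Fin N → Fin N → Prop), (∀ i j, q i j → q j i) → ∀ Y ⊆ (X.erase x).filter (q x), (∀ i ∈ Y, ∀ j ∈ Y, i ≠ j → q i j) →
          insert x Y ⊆ X ∧ (insert x Y).card = Y.card + 1 ∧ (∀ i ∈ insert x Y, ∀ j ∈ insert x Y, i ≠ j → q i j) := by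
        intro q hq Y hY hYq
        have hxY : x ∉ Y := fun h => by simpa using hY h
        refine ⟨?_, Finset.card_insert_of_notMem hxY, ?_⟩
        · intro y hy
          rcases Finset.mem_insert.1 hy with rfl | hy
          · exact hx
          · exact Finset.mem_of_mem_erase (Finset.mem_filter.1 (hY hy)).1
        · intro i hi j hj hij
          rcases Finset.mem_insert.1 hi with hi | hi <;> rcases Finset.mem_insert.1 hj with hj | hj
          · exact absurd (hi.trans hj.symm) hij
          · rw [hi]; exact (Finset.mem_filter.1 (hY hj)).2
          · rw [hj]; exact hq _ _ (Finset.mem_filter.1 (hY hi)).2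
          · exact hYq i hi j hj hij
      have hsub : ∀ (q : Fin N → Prop) [DecidablePred q], (X.erase x).filter q ⊆ X := fun q _ =>
        (Finset.filter_subset _ _).trans (Finset.erase_subset _ _)
      by_cases hA : R1 ≤ ((X.erase x).filter (r x)).card
      · rcases h1 N r hr _ hA with ⟨Y, hY, hYc, hYr⟩ | ⟨Y, hY, hYc, hYr⟩
        · obtain ⟨a, b, c⟩ := key r hr Y hY hYr
          exact Or.inl ⟨insert x Y, a, by omega, c⟩
        · exact Or.inr ⟨Y, hY.trans (hsub _), hYc, hYr⟩
      · have hB : R2 ≤ ((X.erase x).filter (fun y => ¬ r x y)).card := by omega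
        rcases h2 N r hr _ hB with ⟨Y, hY, hYc, hYr⟩ | ⟨Y, hY, hYc, hYr⟩
        · exact Or.inl ⟨Y, hY.trans (hsub _), hYc, hYr⟩
        · obtain ⟨a, b, c⟩ := key (fun i j => ¬ r i j) (fun i j h h' => h (hr _ _ h')) Y (by convert hY) hYr
          exact Or.inr ⟨insert x Y, a, by omega, c⟩

/-- an equiangular family -/
def EqF (α : ℝ) {n N : ℕ} (w : Fin N → EuclideanSpace ℝ (Fin n)) : Prop :=
  (∀ i, ⟪w i, w i⟫ = (1:ℝ)) ∧ ∀ i j, i ≠ j → |⟪w i, w j⟫| = α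

lemma ub_cases {α : ℝ} {n N : ℕ} {w : Fin N → EuclideanSpace ℝ (Fin n)} (hα : 0 < α) (h : EqF α w) {i j : Fin N} (hij : i ≠ j) :
    (⟪w i, w j⟫ < (0:ℝ) → ⟪w i, w j⟫ = -α) ∧ (¬ ⟪w i, w j⟫ < (0:ℝ) → ⟪w i, w j⟫ = α) := by
  have := h.2 i j hij
  constructor
  · intro h1; rw [abs_of_neg h1] at this; linarith
  · intro h1; rw [abs_of_nonneg (not_lt.1 h1)] at this; exact this

/-- squared norm of a sum over a set with all off-diagonal inner products equal to b -/
lemma ub_sq {α b : ℝ} {n N : ℕ} {w : Fin N → EuclideanSpace ℝ (Fin n)} (h : EqF α w) (S : Finset (Fin N))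
    (hS : ∀ i ∈ S, ∀ j ∈ S, i ≠ j → ⟪w i, w j⟫ = b) :
    ⟪∑ i ∈ S, w i, ∑ i ∈ S, w i⟫ = b * S.card ^ 2 + (1 - b) * S.card := by
  classical
  simp only [sum_inner, inner_sum]
  have : ∀ i ∈ S, ∑ j ∈ S, ⟪w i, w j⟫ = b * S.card + (1 - b) := by
    intro i hi
    have : ∀ j ∈ S, ⟪w i, w j⟫ = b + if i = j then (1 - b) else 0 := by
      intro j hj
      split_ifs with hij
      · subst hij; rw [h.1]; ring
      · rw [hS i hi j hj hij]; ring
    rw [Finset.sum_congr rfl this, Finset.sum_add_distrib, Finset.sum_ite_eq]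
    simp [hi, mul_comm]
  rw [Finset.sum_comm]
  rw [Finset.sum_congr rfl this]
  simp; ring

lemma ub_sq_le {α : ℝ} {n N : ℕ} {w : Fin N → EuclideanSpace ℝ (Fin n)} (h : EqF α w) (S : Finset (Fin N)) :
    ⟪∑ i ∈ S, w i, ∑ i ∈ S, w i⟫ ≤ α * S.card ^ 2 + (1 - α) * S.card := by
  classical
  simp only [sum_inner, inner_sum]
  have : ∀ i ∈ S, ∑ j ∈ S, ⟪w i, w j⟫ ≤ α * S.card + (1 - α) := by
    intro i hi
    have : ∀ j ∈ S, ⟪w i, w j⟫ ≤ α + if i = j then (1 - α) else 0 := by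
      intro j hj
      split_ifs with hij
      · subst hij; rw [h.1]; linarith
      · have := h.2 i j hij
        have := le_abs_self ⟪w i, w j⟫
        linarith
    refine (Finset.sum_le_sum this).trans (le_of_eq ?_)
    rw [Finset.sum_add_distrib, Finset.sum_ite_eq]
    simp [hi, mul_comm]
  rw [Finset.sum_comm]
  refine (Finset.sum_le_sum this).trans (le_of_eq ?_)
  simp; ring

lemma ub_clique {α : ℝ} {n N : ℕ} {w : Fin N → EuclideanSpace ℝ (Fin n)} (h : EqF α w) (S : Finset (Fin N))
    (hS : ∀ i ∈ S, ∀ j ∈ S, i ≠ j → ⟪w i, w j⟫ = -α) (hα : 0 < α) : (S.card : ℝ) ≤ 1 / α + 1 := by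
  have h1 := ub_sq h S hS
  have h2 : (0:ℝ) ≤ ⟪∑ i ∈ S, w i, ∑ i ∈ S, w i⟫ := real_inner_self_nonneg
  rcases S.card.eq_zero_or_pos with h0 | h0
  · rw [h0]; simp; positivity
  have h0' : (0:ℝ) < S.card := by exact_mod_cast h0
  rw [h1] at h2
  have h3 : 0 ≤ S.card * (1 + α - α * S.card) := by linarith
  have h4 := nonneg_of_mul_nonneg_right h3 h0'
  have h5 : (1 / α + 1) = (1 + α) / α := by field_simp
  rw [h5, le_div_iff₀ hα]; linarith

open Classical in
lemma ub_few {lam : ℝ} (hl : 0 < lam) {n N : ℕ} {w : Fin N → EuclideanSpace ℝ (Fin n)} (h : EqF (1 / (2 * lam + 1)) w) (S : Finset (Fin N))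
    (hS : ∀ i ∈ S, ∀ j ∈ S, i ≠ j → ¬ ⟪w i, w j⟫ < (0:ℝ)) (v : Fin N) (hv : v ∉ S)
    (hm : 2 * (S.filter (fun i => ⟪w v, w i⟫ < (0:ℝ))).card ≤ S.card) :
    ((S.filter (fun i => ⟪w v, w i⟫ < (0:ℝ))).card : ℝ) ≤ 9 * lam ^ 2 := by
  set α := 1 / (2 * lam + 1) with hα
  have hα0 : 0 < α := by positivity
  set M := S.filter (fun i => ⟪w v, w i⟫ < (0:ℝ)) with hM
  set Q := S.filter (fun i => ¬ ⟪w v, w i⟫ < (0:ℝ)) with hQ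
  have hcard : M.card + Q.card = S.card := Finset.card_filter_add_card_filter_not _
  have hpos : ∀ i ∈ S, ∀ j ∈ S, i ≠ j → ⟪w i, w j⟫ = α := fun i hi j hj hij => (ub_cases hα0 h hij).2 (hS i hi j hj hij)
  have hMS : M ⊆ S := Finset.filter_subset _ _
  have hQS : Q ⊆ S := Finset.filter_subset _ _
  have e1 := ub_sq h M (fun i hi j hj => hpos i (hMS hi) j (hMS hj))
  have e2 := ub_sq h Q (fun i hi j hj => hpos i (hQS hi) j (hQS hj))
  have e3 : ⟪∑ i ∈ M, w i, ∑ i ∈ Q, w i⟫ = α * M.card * Q.card := by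
    simp only [sum_inner, inner_sum]
    have : ∀ i ∈ Q, ∀ j ∈ M, ⟪w j, w i⟫ = α := by
      intro i hi j hj
      refine hpos j (hMS hj) i (hQS hi) ?_
      rintro rfl
      exact (Finset.mem_filter.1 hi).2 (Finset.mem_filter.1 hj).2
    first
      | rw [Finset.sum_congr rfl (fun i hi => Finset.sum_congr rfl (this i hi))]
      | rw [Finset.sum_comm, Finset.sum_congr rfl (fun i hi => Finset.sum_congr rfl (this i hi))]
    simp; ring
  have hne : ∀ i ∈ S, v ≠ i := by rintro i hi rfl; exact hv hi
  have e4 : ⟪w v, ∑ i ∈ M, w i⟫ = -α * M.card := by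
    rw [inner_sum, Finset.sum_congr rfl (fun i hi => (ub_cases hα0 h (hne i (hMS hi))).1 (Finset.mem_filter.1 hi).2)]
    simp; ring
  have e5 : ⟪w v, ∑ i ∈ Q, w i⟫ = α * Q.card := by
    rw [inner_sum, Finset.sum_congr rfl (fun i hi => (ub_cases hα0 h (hne i (hQS hi))).2 (Finset.mem_filter.1 hi).2)]
    simp; ring
  rcases M.card.eq_zero_or_pos with h0 | h0
  · rw [h0]; simp; positivity
  set a : ℝ := (M.card : ℝ) with ha
  set r : ℝ := (Q.card : ℝ) with hr
  have ha1 : 1 ≤ a := by rw [ha]; exact_mod_cast h0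
  have har : a ≤ r := by
    have : M.card ≤ Q.card := by omega
    rw [ha, hr]; exact_mod_cast this
  set s := Real.sqrt a with hs
  have hss : s * s = a := Real.mul_self_sqrt (by linarith)
  have hs1 : 1 ≤ s := by rw [hs]; exact Real.one_le_sqrt.2 ha1
  have hr0 : 0 < r := by linarith
  set c := (a + s) / r with hc
  have hcr : c * r = a + s := by rw [hc]; field_simp
  have hn : (0:ℝ) ≤ ⟪s • w v + ∑ i ∈ M, w i - c • ∑ i ∈ Q, w i, s • w v + ∑ i ∈ M, w i - c • ∑ i ∈ Q, w i⟫ := real_inner_self_nonneg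
  simp only [inner_add_left, inner_add_right, inner_sub_left, inner_sub_right, real_inner_smul_left, real_inner_smul_right] at hn
  rw [real_inner_comm (w v) (∑ i ∈ M, w i), real_inner_comm (w v) (∑ i ∈ Q, w i), real_inner_comm (∑ i ∈ M, w i) (∑ i ∈ Q, w i), e1, e2, e3, e4, e5, h.1] at hn
  have hl1 : 1 = α * (2 * lam + 1) := by rw [hα]; field_simp
  have hl2 : 1 - α = α * (2 * lam) := by linarith
  have hn2 : 0 ≤ α * (-4 * s * a + 2 * lam * (2 * a + c * (a + s))) := by
    refine hn.trans (le_of_eq ?_)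
    rw [hl2]
    linear_combination s * s * hl1 + α * (2 * lam) * hss + (α * (c * r + a + s) + α * (2 * lam) * c - 2 * α * (s + a)) * hcr
  have hn3 := nonneg_of_mul_nonneg_right hn2 hα0
  have hsa : s ≤ a := by nlinarith
  have hc1 : c * (a + s) ≤ 4 * a := by
    rw [hc, div_mul_eq_mul_div, div_le_iff₀ hr0]
    nlinarith
  have hn4 : 2 * lam * (2 * a + c * (a + s)) ≤ 2 * lam * (6 * a) := by gcongr; linarith
  have hn5 : 0 ≤ a * (12 * lam - 4 * s) := by linarith
  have hn6 := nonneg_of_mul_nonneg_right hn5 (by linarith)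
  have : s ≤ 3 * lam := by linarith
  nlinarith

open Classical in
lemma ub_deg {lam : ℝ} (hl : 0 < lam) {n N : ℕ} {w : Fin N → EuclideanSpace ℝ (Fin n)} (h : EqF (1 / (2 * lam + 1)) w) (S T : Finset (Fin N))
    (hS : ∀ i ∈ S, ∀ j ∈ S, i ≠ j → ¬ ⟪w i, w j⟫ < (0:ℝ)) (v : Fin N) (hv : v ∉ S) (hTS : Disjoint T S) (a0 : ℝ)
    (hT : ∀ i ∈ T, ⟪w v, w i⟫ < (0:ℝ))
    (hm : ∀ i ∈ insert v T, ((S.filter (fun j => ⟪w i, w j⟫ < (0:ℝ))).card : ℝ) ≤ a0)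
    (hc : ((T.card : ℝ) + 1) ^ 2 * 4 ≤ S.card) :
    4 * Real.sqrt T.card * T.card ≤ 4 * a0 + 2 * lam * (2 * T.card + 1) := by
  set α := 1 / (2 * lam + 1) with hα
  have hα0 : 0 < α := by positivity
  have hpos : ∀ i ∈ S, ∀ j ∈ S, i ≠ j → ⟪w i, w j⟫ = α := fun i hi j hj hij => (ub_cases hα0 h hij).2 (hS i hi j hj hij)
  have e1 := ub_sq_le h T
  have e2 := ub_sq h S hpos
  have hvS : ∀ i, i ∉ S → ((S.filter (fun j => ⟪w i, w j⟫ < (0:ℝ))).card : ℝ) ≤ a0 → α * (S.card - 2 * a0) ≤ ⟪w i, ∑ j ∈ S, w j⟫ := by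
    intro i hi hi2
    have : ∀ j ∈ S, ⟪w i, w j⟫ = α + if ⟪w i, w j⟫ < (0:ℝ) then -2 * α else 0 := by
      intro j hj
      have hij : i ≠ j := by rintro rfl; exact hi hj
      split_ifs with hh
      · rw [(ub_cases hα0 h hij).1 hh]; ring
      · rw [(ub_cases hα0 h hij).2 hh]; ring
    rw [inner_sum, Finset.sum_congr rfl this, Finset.sum_add_distrib, ← Finset.sum_filter]
    simp only [Finset.sum_const, nsmul_eq_mul]
    nlinarith
  have e5 := hvS v hv (hm v (Finset.mem_insert_self _ _))
  have e3 : T.card * (α * (S.card - 2 * a0)) ≤ ⟪∑ i ∈ T, w i, ∑ j ∈ S, w j⟫ := by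
    rw [sum_inner, ← nsmul_eq_mul]
    refine Finset.card_nsmul_le_sum _ _ _ fun i hi => ?_
    exact hvS i (Finset.disjoint_left.1 hTS hi) (hm i (Finset.mem_insert_of_mem hi))
  have e4 : ⟪w v, ∑ i ∈ T, w i⟫ = -α * T.card := by
    rw [inner_sum, Finset.sum_congr rfl (fun i hi => (ub_cases hα0 h (show v ≠ i from ?_)).1 (hT i hi))]
    · simp; ring
    · rintro rfl
      have := hT v hi
      rw [h.1] at this; linarith
  set D : ℝ := (T.card : ℝ) with hD
  have hD0 : 0 ≤ D := Nat.cast_nonneg _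
  set p : ℝ := (S.card : ℝ) with hp
  have hp0 : 0 < p := by nlinarith
  have ha0 : 0 ≤ a0 := le_trans (Nat.cast_nonneg _) (hm v (Finset.mem_insert_self _ _))
  set s := Real.sqrt D with hs
  have hss : s * s = D := Real.mul_self_sqrt hD0
  have hs0 : 0 ≤ s := Real.sqrt_nonneg _
  set c := (D + s) / p with hc'
  have hc0 : 0 ≤ c := by positivity
  have hcr : c * p = D + s := by rw [hc']; field_simp
  have hn : (0:ℝ) ≤ ⟪s • w v + ∑ i ∈ T, w i - c • ∑ i ∈ S, w i, s • w v + ∑ i ∈ T, w i - c • ∑ i ∈ S, w i⟫ := real_inner_self_nonneg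
  simp only [inner_add_left, inner_add_right, inner_sub_left, inner_sub_right, real_inner_smul_left, real_inner_smul_right] at hn
  rw [real_inner_comm (w v) (∑ i ∈ T, w i), real_inner_comm (w v) (∑ i ∈ S, w i), real_inner_comm (∑ i ∈ T, w i) (∑ i ∈ S, w i), e2, e4, h.1] at hn
  have hl1 : 1 = α * (2 * lam + 1) := by rw [hα]; field_simp
  have hl2 : 1 - α = α * (2 * lam) := by linarith
  rw [hl2] at hn e1
  have f5 := mul_le_mul_of_nonneg_left e5 (mul_nonneg hs0 hc0)
  have f3 := mul_le_mul_of_nonneg_left e3 hc0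
  have hn2 : 0 ≤ α * (-4 * s * D + 4 * a0 * (c * (D + s)) + 2 * lam * (2 * D + c * (D + s))) := by
    have e : α * (-4 * s * D + 4 * a0 * (c * (D + s)) + 2 * lam * (2 * D + c * (D + s))) =
       s * s * 1 + 2 * s * (-α * D) + (α * D ^ 2 + α * (2 * lam) * D) - 2 * (s * c * (α * (p - 2 * a0))) - 2 * (c * (D * (α * (p - 2 * a0)))) + c * c * (α * p ^ 2 + α * (2 * lam) * p) := by
      linear_combination (-1) * (s * s * hl1 + α * (2 * lam) * hss + (α * (c * p + D + s) + α * (2 * lam) * c - 2 * α * (s + D)) * hcr)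
    rw [e]
    linarith
  have hn3 := nonneg_of_mul_nonneg_right hn2 hα0
  have hsD : s ≤ D + 1 := by nlinarith
  have hc1 : c * (D + s) ≤ 1 := by
    rw [hc', div_mul_eq_mul_div, div_le_iff₀ hp0]
    nlinarith
  have g1 : 4 * a0 * (c * (D + s)) ≤ 4 * a0 * 1 := by gcongr
  have g2 : 2 * lam * (2 * D + c * (D + s)) ≤ 2 * lam * (2 * D + 1) := by gcongr
  linarith


open Classical in
lemma ub_flip {α : ℝ} (hα : 0 < α) {n N : ℕ} {v : Fin N → EuclideanSpace ℝ (Fin n)} (h : EqF α v) (S : Finset (Fin N)) 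
    (hS : ∀ i ∈ S, ∀ j ∈ S, i ≠ j → ¬ ⟪v i, v j⟫ < (0:ℝ)) :
    ∃ w : Fin N → EuclideanSpace ℝ (Fin n), EqF α w ∧ (∀ i ∈ S, ∀ j ∈ S, i ≠ j → ¬ ⟪w i, w j⟫ < (0:ℝ)) ∧
      ∀ i, i ∉ S → 2 * (S.filter (fun j => ⟪w i, w j⟫ < (0:ℝ))).card ≤ S.card := by
  let s : Fin N → ℝ := fun i => if i ∈ S then 1 else if 2 * (S.filter (fun j => ⟪v i, v j⟫ < (0:ℝ))).card ≤ S.card then 1 else -1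
  have hs : ∀ i, s i = 1 ∨ s i = -1 := by
    intro i; simp only [s]; split_ifs <;> simp
  have hsS : ∀ i ∈ S, s i = 1 := by intro i hi; simp only [s, if_pos hi]
  refine ⟨fun i => s i • v i, ⟨fun i => ?_, fun i j hij => ?_⟩, fun i hi j hj hij => ?_, fun i hi => ?_⟩
  · rw [real_inner_smul_left, real_inner_smul_right, h.1]
    rcases hs i with e | e <;> rw [e] <;> norm_num
  · rw [real_inner_smul_left, real_inner_smul_right]
    have := h.2 i j hij
    rcases hs i with e | e <;> rcases hs j with e' | e' <;> rw [e, e'] <;> simpa using this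
  · simp only [hsS i hi, hsS j hj, one_smul]
    exact hS i hi j hj hij
  · have e : S.filter (fun j => ⟪s i • v i, s j • v j⟫ < (0:ℝ)) = S.filter (fun j => s i * ⟪v i, v j⟫ < (0:ℝ)) := by
      refine Finset.filter_congr fun j hj => ?_
      rw [hsS j hj, one_smul, real_inner_smul_left]
    rw [e]
    by_cases hc : 2 * (S.filter (fun j => ⟪v i, v j⟫ < (0:ℝ))).card ≤ S.card
    · have : s i = 1 := by simp only [s, if_neg hi, if_pos hc]
      simpa only [this, one_mul] using hc
    · have : s i = -1 := by simp only [s, if_neg hi, if_neg hc]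
      have h2 : S.filter (fun j => s i * ⟪v i, v j⟫ < (0:ℝ)) ⊆ S.filter (fun j => ¬ ⟪v i, v j⟫ < (0:ℝ)) := by
        intro j hj
        rw [Finset.mem_filter] at hj ⊢
        refine ⟨hj.1, ?_⟩
        have := hj.2
        rw [‹s i = -1›] at this
        linarith
      have h3 := Finset.card_le_card h2
      have h4 := Finset.card_filter_add_card_filter_not (s := S) (fun j => ⟪v i, v j⟫ < (0:ℝ))
      omega

open Classical in
lemma ub_bounded {lam : ℝ} (hl : 0 < lam) : ∃ R Δ : ℕ, ∀ n N : ℕ, R ≤ N → HasEquiangularLines (1 / (2 * lam + 1)) n N →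
    ∃ w : Fin N → EuclideanSpace ℝ (Fin n), EqF (1 / (2 * lam + 1)) w ∧
      ∀ i, (Finset.univ.filter (fun j => ⟪w i, w j⟫ < (0:ℝ))).card ≤ Δ := by
  have hα0 : 0 < 1 / (2 * lam + 1) := by positivity
  obtain ⟨s0, hs0⟩ := exists_nat_gt (9 * (lam + 1))
  set D := s0 ^ 2 with hD
  set p := 4 * (D + 1) ^ 2 + 1 with hp
  obtain ⟨t, ht⟩ := exists_nat_gt (1 / (1 / (2 * lam + 1)) + 1)
  obtain ⟨R, hR⟩ := ub_ramsey t p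
  refine ⟨R, p + D, fun n N hN hE => ?_⟩
  obtain ⟨v, hv1, hv2⟩ := hE
  have hv : EqF (1 / (2 * lam + 1)) v := ⟨fun i => by rw [real_inner_self_eq_norm_sq, hv1]; norm_num, hv2⟩
  have hSx : ∃ S : Finset (Fin N), S.card = p ∧ ∀ i ∈ S, ∀ j ∈ S, i ≠ j → ¬ ⟪v i, v j⟫ < (0:ℝ) := by
    rcases hR N (fun i j => ⟪v i, v j⟫ < (0:ℝ)) (fun i j h => by rw [real_inner_comm]; exact h) Finset.univ (by simpa using hN) with ⟨Y, _, hY, hY2⟩ | ⟨Y, _, hY, hY2⟩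
    · exfalso
      have := ub_clique hv Y (fun i hi j hj hij => (ub_cases hα0 hv hij).1 (hY2 i hi j hj hij)) hα0
      rw [hY] at this
      linarith
    · exact ⟨Y, hY, hY2⟩
  obtain ⟨S, hSc, hSv⟩ := hSx
  obtain ⟨w, hw, hS, hfew⟩ := ub_flip hα0 hv S hSv
  refine ⟨w, hw, fun i => ?_⟩
  by_contra hcon
  push Not at hcon
  set F := Finset.univ.filter (fun j => ⟪w i, w j⟫ < (0:ℝ)) with hF
  have hd : D ≤ (F \ S).card := by
    have := Finset.le_card_sdiff S F
    omega
  obtain ⟨T, hTF, hTc⟩ := Finset.exists_subset_card_eq hd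
  have hTS : Disjoint T (S.erase i) := by
    rw [Finset.disjoint_left]
    intro x hx hx2
    exact (Finset.mem_sdiff.1 (hTF hx)).2 (Finset.mem_of_mem_erase hx2)
  have hs1 : (1:ℝ) ≤ s0 := by linarith
  have key := ub_deg hl hw (S.erase i) T (fun a ha b hb => hS a (Finset.mem_of_mem_erase ha) b (Finset.mem_of_mem_erase hb))
    i (Finset.notMem_erase _ _) hTS (9 * lam ^ 2) (fun j hj => (Finset.mem_filter.1 (Finset.mem_sdiff.1 (hTF hj)).1).2) ?_ ?_
  · rw [hTc, hD] at key
    push_cast at key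
    rw [Real.sqrt_sq (by linarith)] at key
    have q1 : 4 * (s0:ℝ) ^ 2 * (s0 - lam) ≤ 36 * lam ^ 2 + 2 * lam := by nlinarith
    have q2 : 4 * (s0:ℝ) ^ 2 * 1 ≤ 4 * (s0:ℝ) ^ 2 * (s0 - lam) := by gcongr; linarith
    nlinarith
  · intro j hj
    by_cases hjS : j ∈ S
    · have : (S.erase i).filter (fun k => ⟪w j, w k⟫ < (0:ℝ)) = ∅ := by
        rw [Finset.filter_eq_empty_iff]
        intro k hk
        have hji : j = i := by
          rcases Finset.mem_insert.1 hj with h | h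
          · exact h
          · exact absurd hjS (Finset.mem_sdiff.1 (hTF h)).2
        exact hS j hjS k (Finset.mem_of_mem_erase hk) (by rw [hji]; exact (Finset.ne_of_mem_erase hk).symm)
      rw [this]; simp; positivity
    · have h1 := ub_few hl hw S hS j hjS (hfew j hjS)
      refine le_trans ?_ h1
      exact_mod_cast Finset.card_le_card (Finset.filter_subset_filter _ (Finset.erase_subset _ _))
  · have h1 : p - 1 ≤ (S.erase i).card := by
      have := Finset.pred_card_le_card_erase (s := S) (a := i)
      omega
    have h2 : (D + 1) ^ 2 * 4 ≤ (S.erase i).card := by omega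
    rw [hTc]
    exact_mod_cast h2


open Polynomial in
lemma ub_conj (L : ℕ) (hL : 0 < L) (P : ℚ[X]) (h : aeval ((L:ℝ) * (3 * Real.sqrt 5 - 1)) P = 0) :
    aeval (-((L:ℝ) * (3 * Real.sqrt 5 + 1))) P = 0 := by
  have h5 : Real.sqrt 5 ^ 2 = 5 := Real.sq_sqrt (by norm_num)
  have hirr : Irrational (Real.sqrt 5) := by
    have := Nat.Prime.irrational_sqrt (show Nat.Prime 5 by norm_num)
    exact_mod_cast this
  set m : ℚ[X] := X ^ 2 + C (2 * (L:ℚ)) * X - C (44 * (L:ℚ) ^ 2) with hm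
  have hmm : m.Monic := by rw [hm]; monicity!
  have hmd : m.natDegree = 2 := by rw [hm]; compute_degree!
  have hdiv := modByMonic_add_div P m
  have hlt : (P %ₘ m).natDegree < m.natDegree := natDegree_modByMonic_lt P hmm (by
    intro h; rw [h] at hmd; simp at hmd)
  obtain ⟨b, c, hbc⟩ := exists_eq_X_add_C_of_natDegree_le_one (show (P %ₘ m).natDegree ≤ 1 by omega)
  have hev : ∀ x : ℝ, x ^ 2 + 2 * L * x - 44 * L ^ 2 = 0 → aeval x P = b * x + c := by
    intro x hx
    rw [← hdiv, hbc]
    simp only [map_add, map_mul, aeval_C, aeval_X]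
    have : aeval x m = 0 := by
      rw [hm]; simp; linarith
    rw [this]; simp
  have hL0 : (L:ℝ) ≠ 0 := by positivity
  have h1 := hev _ (show ((L:ℝ) * (3 * Real.sqrt 5 - 1)) ^ 2 + 2 * L * ((L:ℝ) * (3 * Real.sqrt 5 - 1)) - 44 * L ^ 2 = 0 by
    linear_combination 9 * (L:ℝ) ^ 2 * h5)
  have h2 := hev _ (show (-((L:ℝ) * (3 * Real.sqrt 5 + 1))) ^ 2 + 2 * L * (-((L:ℝ) * (3 * Real.sqrt 5 + 1))) - 44 * L ^ 2 = 0 by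
    linear_combination 9 * (L:ℝ) ^ 2 * h5)
  rw [h] at h1
  have hb : b = 0 := by
    by_contra hb
    have hb' : (b:ℝ) ≠ 0 := by exact_mod_cast hb
    apply hirr
    refine ⟨(b * L - c) / (3 * b * L), ?_⟩
    push_cast
    rw [div_eq_iff (by positivity)]
    linear_combination h1
  have hc : c = 0 := by
    rw [hb] at h1
    have : (c:ℝ) = 0 := by simpa using h1.symm
    exact_mod_cast this
  rw [h2, hb, hc]; simp

open Polynomial in
lemma ub_mult (L : ℕ) (hL : 0 < L) (P : ℚ[X]) (hP : P ≠ 0) :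
    (P.map (algebraMap ℚ ℝ)).rootMultiplicity ((L:ℝ) * (3 * Real.sqrt 5 - 1)) ≤
    (P.map (algebraMap ℚ ℝ)).rootMultiplicity (-((L:ℝ) * (3 * Real.sqrt 5 + 1))) := by
  have hP' : P.map (algebraMap ℚ ℝ) ≠ 0 := by
    rwa [Ne, Polynomial.map_eq_zero]
  refine le_of_forall_lt fun k hk => ?_
  rw [lt_rootMultiplicity_iff_isRoot_iterate_derivative hP'] at hk ⊢
  intro j hj
  have := hk j hj
  rw [iterate_derivative_map, IsRoot.def, eval_map_algebraMap] at this ⊢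
  exact ub_conj L hL _ this

open Polynomial in
lemma ub_count {N : ℕ} (A : Matrix (Fin N) (Fin N) ℝ) (hA : A.IsHermitian) (t : ℝ) :
    A.charpoly.rootMultiplicity t = (Finset.univ.filter (fun i => hA.eigenvalues i = t)).card := by
  classical
  rw [← count_roots, hA.roots_charpoly_eq_eigenvalues, Multiset.count_map, Finset.card_def, Finset.filter_val]
  congr 1
  refine Multiset.filter_congr fun i _ => ?_
  simp [eq_comm]

lemma ub_trace {N : ℕ} (A : Matrix (Fin N) (Fin N) ℝ) (hA : A.IsHermitian) (k : ℕ) :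
    (A ^ k).trace = ∑ i, hA.eigenvalues i ^ k := by
  conv_lhs => rw [hA.spectral_theorem, ← map_pow, Unitary.conjStarAlgAut_apply, Matrix.diagonal_pow]
  rw [Matrix.trace_mul_cycle]
  simp [Matrix.trace_diagonal]

lemma ub_spec {N : ℕ} (A : Matrix (Fin N) (Fin N) ℝ) (hA : A.IsHermitian) (h01 : ∀ i j, A i j = 0 ∨ A i j = 1)
    (L : ℕ) (hL : 0 < L) (Δ : ℕ) (hdeg : ∀ i, ∑ j, A i j ≤ Δ)
    (hq : ∀ x : Fin N → ℝ, x ⬝ᵥ A.mulVec x ≤ ((L:ℝ) * (3 * Real.sqrt 5 - 1)) * (x ⬝ᵥ x) + (∑ i, x i) ^ 2 / 2)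
    (r : ℕ) (hr : (((L:ℝ) * (3 * Real.sqrt 5 - 1)) • (1 : Matrix (Fin N) (Fin N) ℝ) - A).rank ≤ r) (k : ℕ) (hk : Odd k) :
    ((N:ℝ) - r) * ((L:ℝ) * (3 * Real.sqrt 5 + 1)) ^ k ≤ (Δ:ℝ) ^ k + N * ((L:ℝ) * (3 * Real.sqrt 5 - 1)) ^ k := by
  classical
  have h5 := sb_sqrt5
  have hL0 : (0:ℝ) < L := by exact_mod_cast hL
  have hmult : A.charpoly.rootMultiplicity ((L:ℝ) * (3 * Real.sqrt 5 - 1)) ≤ A.charpoly.rootMultiplicity (-((L:ℝ) * (3 * Real.sqrt 5 + 1))) := by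
    let Aq : Matrix (Fin N) (Fin N) ℚ := fun i j => if A i j = 1 then 1 else 0
    have hAq : A = Aq.map (algebraMap ℚ ℝ) := by
      ext i j
      have e : (Aq.map (algebraMap ℚ ℝ)) i j = algebraMap ℚ ℝ (if A i j = 1 then 1 else 0) := rfl
      rw [e]
      rcases h01 i j with h | h <;> simp [h]
    have hch : A.charpoly = Aq.charpoly.map (algebraMap ℚ ℝ) := by
      rw [hAq, Matrix.charpoly_map]
    rw [hch]
    exact ub_mult L hL _ (Matrix.charpoly_monic _).ne_zero
  rw [ub_count A hA, ub_count A hA] at hmult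
  set lam := (L:ℝ) * (3 * Real.sqrt 5 - 1) with hlam
  set lam' := (L:ℝ) * (3 * Real.sqrt 5 + 1) with hlam'
  have hlam0 : 0 < lam := mul_pos hL0 (by linarith)
  have hlam0' : 0 < lam' := mul_pos hL0 (by linarith)
  set μ := hA.eigenvalues with hμ
  let f : Fin N → Fin N → ℝ := fun i => WithLp.ofLp (hA.eigenvectorBasis i)
  have hf : ∀ i, A.mulVec (f i) = μ i • f i := fun i => hA.mulVec_eigenvectorBasis i
  have hff : ∀ i j, f i ⬝ᵥ f j = if i = j then 1 else 0 := by
    intro i j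
    have := (orthonormal_iff_ite.1 hA.eigenvectorBasis.orthonormal) j i
    rw [EuclideanSpace.inner_eq_star_dotProduct] at this
    simp only [f]
    rw [star_trivial] at this
    rw [this]
    simp [eq_comm]
  -- rank
  have hcnt : N - r ≤ (Finset.univ.filter (fun i => μ i = lam)).card := by
    have h1 : (Finset.univ.filter (fun i => ¬ μ i = lam)).card ≤ r := by
      refine le_trans ?_ hr
      have hli : LinearIndependent ℝ (fun i : {i // i ∈ Finset.univ.filter (fun i => ¬ μ i = lam)} => f i) := by
        have h0 : LinearIndependent ℝ f := by
          rw [linearIndependent_iff']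
          intro s g hg i hi
          have := congrArg (fun x => f i ⬝ᵥ x) hg
          simpa [dotProduct_sum, dotProduct_smul, hff, hi] using this
        exact h0.comp _ Subtype.val_injective
      have hmem : ∀ i : {i // i ∈ Finset.univ.filter (fun i => ¬ μ i = lam)}, f i ∈ LinearMap.range ((lam • (1 : Matrix (Fin N) (Fin N) ℝ) - A).mulVecLin) := by
        rintro ⟨i, hi⟩
        have hi' : lam - μ i ≠ 0 := fun h => (Finset.mem_filter.1 hi).2 (by linarith)
        refine ⟨(lam - μ i)⁻¹ • f i, ?_⟩
        rw [map_smul, Matrix.mulVecLin_apply, Matrix.sub_mulVec, Matrix.smul_mulVec, Matrix.one_mulVec, hf, ← sub_smul, smul_smul, inv_mul_cancel₀ hi', one_smul]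
      have hli2 : LinearIndependent ℝ (fun i : {i // i ∈ Finset.univ.filter (fun i => ¬ μ i = lam)} => (⟨f i, hmem i⟩ : LinearMap.range ((lam • (1 : Matrix (Fin N) (Fin N) ℝ) - A).mulVecLin))) :=
        LinearIndependent.of_comp (Submodule.subtype _) hli
      have := hli2.fintype_card_le_finrank
      rw [Fintype.card_coe] at this
      exact this
    have h2 := Finset.card_filter_add_card_filter_not (s := (Finset.univ : Finset (Fin N))) (fun i => μ i = lam)
    simp only [Finset.card_univ, Fintype.card_fin] at h2
    omega
  -- top eigenvalue
  have hgt : (Finset.univ.filter (fun i => lam < μ i)).card ≤ 1 := by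
    rw [Finset.card_le_one]
    intro i hi j hj
    by_contra hij
    have hi := (Finset.mem_filter.1 hi).2
    have hj := (Finset.mem_filter.1 hj).2
    set a := ∑ u, f i u with ha
    set b := ∑ u, f j u with hb
    have h1 := hq (b • f i - a • f j)
    have h2 := hq (f j)
    rw [hf, dotProduct_smul, hff, if_pos rfl, ← hb] at h2
    rw [Matrix.mulVec_sub, Matrix.mulVec_smul, Matrix.mulVec_smul, hf, hf] at h1
    have h3 : ∑ u, (b • f i - a • f j) u = 0 := by
      simp only [Pi.sub_apply, Pi.smul_apply, smul_eq_mul, Finset.sum_sub_distrib, ← Finset.mul_sum, ← ha, ← hb]; ring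
    rw [h3] at h1
    simp only [dotProduct_sub, sub_dotProduct, dotProduct_smul, smul_dotProduct, hff, smul_eq_mul, if_pos, hij, Ne.symm hij, if_neg, not_false_eq_true, if_false, if_true] at h1
    have h4 : (μ i - lam) * b ^ 2 + (μ j - lam) * a ^ 2 ≤ 0 := by nlinarith
    have h5 : 0 ≤ (μ j - lam) * a ^ 2 := mul_nonneg (by linarith) (sq_nonneg _)
    have h6 : b ^ 2 ≤ 0 := by
      by_contra hbb
      push Not at hbb
      have := mul_pos (sub_pos.2 hi) hbb
      linarith
    simp only [smul_eq_mul] at h2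
    linarith
  have hle : ∀ i, μ i ≤ Δ := by
    intro i
    have h1 : f i ⬝ᵥ A.mulVec (f i) = μ i := by rw [hf, dotProduct_smul, hff, if_pos rfl]; simp
    have h2 : f i ⬝ᵥ f i = 1 := by rw [hff, if_pos rfl]
    have hA' : ∀ u v, A u v = A v u := fun u v => by have := hA.apply v u; simpa using this
    calc μ i = ∑ u, ∑ v, A u v * (f i u * f i v) := by
          rw [← h1]; simp only [dotProduct, Matrix.mulVec, Finset.mul_sum]
          refine Finset.sum_congr rfl fun u _ => Finset.sum_congr rfl fun v _ => by ring
      _ ≤ ∑ u, ∑ v, A u v * (f i u ^ 2 / 2 + f i v ^ 2 / 2) := by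
          refine Finset.sum_le_sum fun u _ => Finset.sum_le_sum fun v _ => ?_
          refine mul_le_mul_of_nonneg_left ?_ (by rcases h01 u v with h | h <;> rw [h]; norm_num)
          nlinarith [sq_nonneg (f i u - f i v)]
      _ = ∑ u, (∑ v, A u v) * f i u ^ 2 := by
          simp only [mul_add, Finset.sum_add_distrib]
          rw [Finset.sum_comm (f := fun u v => A u v * (f i v ^ 2 / 2)), ← Finset.sum_add_distrib]
          refine Finset.sum_congr rfl fun u _ => ?_
          rw [← Finset.sum_add_distrib, Finset.sum_mul]
          refine Finset.sum_congr rfl fun v _ => ?_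
          rw [hA' v u]; ring
      _ ≤ ∑ u, (Δ:ℝ) * f i u ^ 2 := Finset.sum_le_sum fun u _ => mul_le_mul_of_nonneg_right (hdeg u) (sq_nonneg _)
      _ = Δ := by
          rw [← Finset.mul_sum]
          have : ∑ u, f i u ^ 2 = 1 := by rw [← h2]; simp [dotProduct, sq]
          rw [this, mul_one]
  have htr : 0 ≤ ∑ i, μ i ^ k := by
    rw [← ub_trace A hA k]
    have hnn : ∀ k i j, 0 ≤ (A ^ k) i j := by
      intro k
      induction k with
      | zero => intro i j; rw [pow_zero, Matrix.one_apply]; split_ifs <;> norm_num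
      | succ k ih =>
        intro i j
        rw [pow_succ, Matrix.mul_apply]
        exact Finset.sum_nonneg fun l _ => mul_nonneg (ih i l) (by rcases h01 l j with h | h <;> rw [h]; norm_num)
    exact Finset.sum_nonneg fun i _ => hnn k i i
  have hpt : ∀ i, μ i ^ k ≤ (if μ i = -lam' then -lam' ^ k else 0) + lam ^ k + (if lam < μ i then (Δ:ℝ) ^ k else 0) := by
    intro i
    have hp1 : 0 < lam ^ k := by positivity
    have hp2 : (0:ℝ) ≤ (Δ:ℝ) ^ k := by positivity
    by_cases c1 : μ i = -lam'
    · have : ¬ lam < μ i := by linarith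
      rw [if_pos c1, if_neg this, c1, hk.neg_pow]; linarith
    · rw [if_neg c1]
      by_cases c2 : lam < μ i
      · rw [if_pos c2]
        have := hk.pow_le_pow.2 (hle i)
        linarith
      · rw [if_neg c2]
        have := hk.pow_le_pow.2 (not_lt.1 c2)
        linarith
  have hsum := htr.trans (Finset.sum_le_sum fun i _ => hpt i)
  rw [Finset.sum_add_distrib, Finset.sum_add_distrib, ← Finset.sum_filter, ← Finset.sum_filter] at hsum
  simp only [Finset.sum_const, nsmul_eq_mul, Finset.card_univ, Fintype.card_fin] at hsum
  have g1 : ((N:ℝ) - r) ≤ ((Finset.univ.filter (fun i => μ i = -lam')).card : ℝ) := by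
    have : N ≤ (Finset.univ.filter (fun i => μ i = -lam')).card + r := by omega
    have : (N:ℝ) ≤ (Finset.univ.filter (fun i => μ i = -lam')).card + r := by exact_mod_cast this
    linarith
  have g2 : ((Finset.univ.filter (fun i => lam < μ i)).card : ℝ) ≤ 1 := by exact_mod_cast hgt
  have g3 := mul_le_mul_of_nonneg_right g1 (show 0 ≤ lam' ^ k by positivity)
  have g4 := mul_le_mul_of_nonneg_right g2 (show (0:ℝ) ≤ (Δ:ℝ) ^ k by positivity)
  linarith


lemma ub_ineq (L : ℕ) (hL : 0 < L) : ∃ R Δ : ℕ, ∀ n N : ℕ, R ≤ N →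
    HasEquiangularLines (1 / (2 * ((L:ℝ) * (3 * Real.sqrt 5 - 1)) + 1)) n N → ∀ k : ℕ, Odd k →
    ((N:ℝ) - (n + 1)) * ((L:ℝ) * (3 * Real.sqrt 5 + 1)) ^ k ≤ (Δ:ℝ) ^ k + N * ((L:ℝ) * (3 * Real.sqrt 5 - 1)) ^ k := by
  classical
  have h5 := sb_sqrt5
  have hL0 : (0:ℝ) < L := by exact_mod_cast hL
  have hlam0 : 0 < (L:ℝ) * (3 * Real.sqrt 5 - 1) := mul_pos hL0 (by linarith)
  obtain ⟨R, Δ, hR⟩ := ub_bounded hlam0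
  refine ⟨R, Δ, fun n N hN hE k hk => ?_⟩
  obtain ⟨w, hw, hd⟩ := hR n N hN hE
  let A : Matrix (Fin N) (Fin N) ℝ := Matrix.of fun i j => if ⟪w i, w j⟫ < (0:ℝ) then 1 else 0
  have hAe : ∀ i j, A i j = if ⟪w i, w j⟫ < (0:ℝ) then 1 else 0 := fun i j => rfl
  have hAH : A.IsHermitian := by
    ext i j
    rw [Matrix.conjTranspose_apply, hAe, hAe, real_inner_comm, star_trivial]
  have hα0 : 0 < 1 / (2 * ((L:ℝ) * (3 * Real.sqrt 5 - 1)) + 1) := by positivity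
  set lam := (L:ℝ) * (3 * Real.sqrt 5 - 1) with hlam
  have hent : ∀ i j, (lam + 1 / 2) * ⟪w i, w j⟫ = lam * (1 : Matrix (Fin N) (Fin N) ℝ) i j + 1 / 2 - A i j := by
    intro i j
    rw [hAe]
    by_cases hij : i = j
    · subst hij
      rw [hw.1, Matrix.one_apply_eq, if_neg (by norm_num)]; ring
    · rw [Matrix.one_apply_ne hij]
      split_ifs with hh
      · rw [(ub_cases hα0 hw hij).1 hh]; field_simp; ring
      · rw [(ub_cases hα0 hw hij).2 hh]; field_simp; ring
  have key := ub_spec A hAH (fun i j => by rw [hAe]; split_ifs <;> simp) L hL Δ ?_ ?_ (n + 1) ?_ k hk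
  · push_cast at key
    exact key
  · intro i
    simp only [hAe]
    rw [Finset.sum_boole]
    exact_mod_cast hd i
  · intro x
    have h0 : (0:ℝ) ≤ (lam + 1 / 2) * ⟪∑ i, x i • w i, ∑ i, x i • w i⟫ := mul_nonneg (by linarith) real_inner_self_nonneg
    have h1 : (lam + 1 / 2) * ⟪∑ i, x i • w i, ∑ i, x i • w i⟫ = ∑ i, ∑ j, x i * x j * (lam * (1 : Matrix (Fin N) (Fin N) ℝ) i j + 1 / 2 - A i j) := by
      rw [sum_inner, Finset.mul_sum]
      refine Finset.sum_congr rfl fun i _ => ?_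
      rw [inner_sum, Finset.mul_sum]
      refine Finset.sum_congr rfl fun j _ => ?_
      rw [real_inner_smul_left, real_inner_smul_right, ← hent]; ring
    have h2 : ∑ i, ∑ j, x i * x j * (lam * (1 : Matrix (Fin N) (Fin N) ℝ) i j + 1 / 2 - A i j) = lam * (x ⬝ᵥ x) + (∑ i, x i) ^ 2 / 2 - x ⬝ᵥ A.mulVec x := by
      have e1 : x ⬝ᵥ x = ∑ i, ∑ j, x i * x j * (1 : Matrix (Fin N) (Fin N) ℝ) i j := by
        simp [dotProduct, Matrix.one_apply]
      have e2 : (∑ i, x i) ^ 2 = ∑ i, ∑ j, x i * x j := by rw [sq, Finset.sum_mul_sum]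
      have e3 : x ⬝ᵥ A.mulVec x = ∑ i, ∑ j, x i * x j * A i j := by
        simp only [dotProduct, Matrix.mulVec, Finset.mul_sum]
        refine Finset.sum_congr rfl fun i _ => Finset.sum_congr rfl fun j _ => by ring
      rw [e1, e2, e3, Finset.mul_sum, Finset.sum_div, ← Finset.sum_add_distrib, ← Finset.sum_sub_distrib]
      refine Finset.sum_congr rfl fun i _ => ?_
      rw [Finset.mul_sum, Finset.sum_div, ← Finset.sum_add_distrib, ← Finset.sum_sub_distrib]
      refine Finset.sum_congr rfl fun j _ => by ring
    rw [h1, h2] at h0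
    linarith
  · let B : Matrix (Fin N) (Fin n ⊕ Unit) ℝ := Matrix.of fun i s => Sum.elim (fun a => w i a) (fun _ => 1) s
    let C : Matrix (Fin n ⊕ Unit) (Fin N) ℝ := Matrix.of fun s j => Sum.elim (fun a => (lam + 1 / 2) * w j a) (fun _ => -(1 / 2)) s
    have hBC : lam • (1 : Matrix (Fin N) (Fin N) ℝ) - A = B * C := by
      ext i j
      rw [Matrix.mul_apply, Fintype.sum_sum_type]
      have h1 : ∑ a : Fin n, B i (Sum.inl a) * C (Sum.inl a) j = (lam + 1 / 2) * ⟪w i, w j⟫ := by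
        simp only [B, C, Matrix.of_apply, Sum.elim_inl, PiLp.inner_apply, RCLike.inner_apply, conj_trivial, Finset.mul_sum]
        refine Finset.sum_congr rfl fun a _ => by ring
      rw [h1, hent]
      simp [B, C]
      ring
    rw [hBC]
    refine (Matrix.rank_mul_le_left _ _).trans ((Matrix.rank_le_card_width _).trans ?_)
    simp

set_option maxHeartbeats 1000000 in
lemma ub_final (L : ℕ) (hL : 0 < L) : ∃ C > (0:ℝ), ∃ n0 : ℕ, ∀ n : ℕ, n0 ≤ n → ∀ N : ℕ,
    HasEquiangularLines (1 / (2 * ((L:ℝ) * (3 * Real.sqrt 5 - 1)) + 1)) n N →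
    (N:ℝ) ≤ n + C * n / Real.log (Real.log n) := by
  have h5 := sb_sqrt5
  have hL0 : (0:ℝ) < L := by exact_mod_cast hL
  obtain ⟨R, Δ, hR⟩ := ub_ineq L hL
  set lam := (L:ℝ) * (3 * Real.sqrt 5 - 1) with hlam
  set lam' := (L:ℝ) * (3 * Real.sqrt 5 + 1) with hlam'
  have hlam0 : 0 < lam := mul_pos hL0 (by linarith)
  have hlt : lam < lam' := mul_lt_mul_of_pos_left (by linarith) hL0
  have hlam0' : 0 < lam' := by linarith
  set δ := lam' / lam - 1 with hδ
  have hδ0 : 0 < δ := by rw [hδ, sub_pos, one_lt_div hlam0]; exact hlt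
  set K : ℝ := Δ / lam' + 2 with hK
  have hK2 : 2 ≤ K := by
    have : 0 ≤ (Δ:ℝ) / lam' := by positivity
    linarith
  have hlK : 0 < Real.log K := Real.log_pos (by linarith)
  set c1 := 4 * Real.log K / δ with hc1
  have hc10 : 0 < c1 := by positivity
  set C := 2 * (1 + K) + 2 * c1 * (2 + K) with hC
  have hC0 : 0 < C := by positivity
  have hev : ∀ᶠ n : ℕ in Filter.atTop, 2 * c1 + 3 ≤ Real.log n :=
    (Real.tendsto_log_atTop.comp tendsto_natCast_atTop_atTop).eventually_ge_atTop _
  obtain ⟨n0, hn0⟩ := Filter.eventually_atTop.1 hev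
  refine ⟨C, hC0, max (max n0 R) 3, fun n hn N hE => ?_⟩
  have hl := hn0 n (by omega)
  have hnR : R ≤ n := by omega
  have hn3 : (3:ℝ) ≤ n := by exact_mod_cast (show 3 ≤ n by omega)
  set l := Real.log n with hl'
  have hl0 : 3 < l := by linarith
  have hll0 : 0 < Real.log l := Real.log_pos (by linarith)
  have hll : Real.log l ≤ l := (Real.log_le_sub_one_of_pos (by linarith)).trans (by linarith)
  have hfin : C * n / l ≤ C * n / Real.log l := by gcongr
  have hpos : 0 ≤ C * n / Real.log l := by positivity
  by_cases hNR : N < R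
  · have : (N:ℝ) ≤ n := by exact_mod_cast (by omega : N ≤ n)
    linarith
  push Not at hNR
  set j := ⌊l / (4 * Real.log K)⌋₊ with hj
  have hj1 : (j:ℝ) ≤ l / (4 * Real.log K) := Nat.floor_le (by positivity)
  have hj2 : l / (4 * Real.log K) < j + 1 := Nat.lt_floor_add_one _
  have h1 := hR n N hNR hE (2 * j + 1) ⟨j, rfl⟩
  set k := 2 * j + 1 with hk
  have hkl : l / (4 * Real.log K) ≤ k := by rw [hk]; push_cast; linarith [Nat.cast_nonneg (α := ℝ) j]
  set s := Real.sqrt n with hs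
  have hss : s * s = n := Real.mul_self_sqrt (by linarith)
  have hs1 : 1 ≤ s := by rw [hs]; exact Real.one_le_sqrt.2 (by linarith)
  have hKk : K ^ k ≤ K * s := by
    rw [hk, pow_succ, mul_comm]
    refine mul_le_mul_of_nonneg_left ?_ (by linarith)
    rw [← Real.log_le_log_iff (by positivity) (by linarith), Real.log_pow, hs, Real.log_sqrt (by linarith)]
    push_cast
    rw [← hl']
    rw [le_div_iff₀ (by positivity)] at hj1
    linarith
  have hθ : (lam / lam') ^ k ≤ c1 / l := by
    have hb := one_add_mul_le_pow (show (-2:ℝ) ≤ δ by linarith) k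
    have e : 1 + δ = (lam / lam')⁻¹ := by rw [hδ, inv_div]; ring
    rw [e, inv_pow] at hb
    have hx : 0 < (lam / lam') ^ k := by positivity
    have h2 : l / c1 ≤ ((lam / lam') ^ k)⁻¹ := by
      refine le_trans ?_ hb
      have : l / c1 = l / (4 * Real.log K) * δ := by rw [hc1]; field_simp
      rw [this]
      have := mul_le_mul_of_nonneg_right hkl hδ0.le
      linarith
    have h3 := inv_anti₀ (by positivity) h2
    rw [inv_inv, inv_div] at h3
    exact h3
  have h2 : (N:ℝ) - (n + 1) ≤ K * s + N * (c1 / l) := by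
    have hp : 0 < lam' ^ k := by positivity
    have e1 : (N:ℝ) - (n + 1) ≤ ((Δ:ℝ) ^ k + N * lam ^ k) / lam' ^ k := by rwa [le_div_iff₀ hp]
    have e2 : ((Δ:ℝ) ^ k + N * lam ^ k) / lam' ^ k = (Δ / lam') ^ k + N * (lam / lam') ^ k := by
      rw [div_pow, div_pow]; ring
    have e3 : ((Δ:ℝ) / lam') ^ k ≤ K ^ k := by
      refine pow_le_pow_left₀ (by positivity) ?_ k
      linarith
    have e4 : N * (lam / lam') ^ k ≤ N * (c1 / l) := by gcongr
    linarith
  set x := c1 / l with hx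
  have hx0 : 0 < x := by positivity
  have hx2 : x ≤ 1 / 2 := by rw [hx, div_le_iff₀ (by linarith)]; linarith
  have h3 : (N:ℝ) * (1 - x) ≤ n + 1 + K * s := by linarith
  have h4 : (N:ℝ) ≤ (n + 1 + K * s) * (1 + 2 * x) := by
    have hm := mul_le_mul_of_nonneg_right h3 (show 0 ≤ 1 + 2 * x by linarith)
    have : (N:ℝ) ≤ N * (1 - x) * (1 + 2 * x) := by
      have : 0 ≤ (N:ℝ) * (x * (1 - 2 * x)) := mul_nonneg (Nat.cast_nonneg _) (mul_nonneg hx0.le (by linarith))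
      linarith
    linarith
  have hsl : s ≤ 2 * (n / l) := by
    have : l ≤ 2 * s := by
      have := Real.log_le_sub_one_of_pos (show 0 < s by linarith)
      rw [hs, Real.log_sqrt (by linarith), ← hl', ← hs] at this
      linarith
    rw [← mul_div_assoc, le_div_iff₀ (by linarith), ← hss]
    have := mul_le_mul_of_nonneg_left this (show 0 ≤ s by linarith)
    linarith
  have hsn : s ≤ n := by
    have := mul_le_mul_of_nonneg_left hs1 (show 0 ≤ s by linarith)
    linarith
  have hKs : K * s ≤ K * n := by gcongr
  have h6 : (n + 1 + K * s) * (2 * x) ≤ ((2 + K) * n) * (2 * x) := by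
    refine mul_le_mul_of_nonneg_right ?_ (by linarith)
    linarith
  have h7 : ((2 + K) * n) * (2 * x) = 2 * c1 * (2 + K) * (n / l) := by rw [hx]; ring
  have h8 : 1 + K * s ≤ (1 + K) * (2 * (n / l)) := by
    have : (1 + K) * s ≤ (1 + K) * (2 * (n / l)) := by gcongr
    linarith
  have h9 : C * n / l = C * (n / l) := by ring
  rw [h9] at hfin
  have h10 : C * (n / l) = 2 * (1 + K) * (n / l) + 2 * c1 * (2 + K) * (n / l) := by rw [hC]; ring
  linarith


lemma fin_inj : Function.Injective (fun x : ℝ => 1 / x) := by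
  intro a b h
  simpa using h

theorem stmt_0 :
    {α : ℝ | α ∈ Set.Ioo (0 : ℝ) 1 ∧
      ∃ c > (0 : ℝ), ∃ C > (0 : ℝ), ∃ n₀ : ℕ, ∀ n : ℕ, n₀ ≤ n →
        (n : ℝ) + c * Real.log (Real.log n) ≤ (maxEquiangularLines α n : ℝ) ∧
        (maxEquiangularLines α n : ℝ) ≤ (n : ℝ) + C * n / Real.log (Real.log n)}.Infinite := by
  obtain ⟨p, hp, hlow⟩ := lower_bound
  have h5 := sb_sqrt5
  have hp0 : (0:ℝ) < p := by exact_mod_cast hp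
  have hinf : {q : ℕ | q.Prime ∧ 14 * p ^ 2 + 9 ≤ q}.Infinite := by
    refine Set.infinite_of_not_bddAbove ?_
    rintro ⟨b, hb⟩
    obtain ⟨q, hq, hqp⟩ := Nat.exists_infinite_primes (b + 1 + (14 * p ^ 2 + 9))
    have := hb (show q ∈ {q : ℕ | q.Prime ∧ 14 * p ^ 2 + 9 ≤ q} from ⟨hqp, by omega⟩)
    omega
  refine Set.infinite_of_injOn_mapsTo (f := fun q : ℕ => (1 / (2 * ((3 * q * p ^ 2 : ℝ) * (3 * Real.sqrt 5 - 1)) + 1))) ?_ ?_ hinf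
  · intro a _ b _ hab
    have h1 := fin_inj hab
    have h2 : (3 * (p:ℝ) ^ 2 * (3 * Real.sqrt 5 - 1)) * 2 * ((a:ℝ) - b) = 0 := by linear_combination h1
    have h3 : (3 * (p:ℝ) ^ 2 * (3 * Real.sqrt 5 - 1)) * 2 ≠ 0 := by
      have : 0 < 3 * Real.sqrt 5 - 1 := by linarith
      positivity
    have h4 := (mul_eq_zero.1 h2).resolve_left h3
    have : (a:ℝ) = b := by linarith
    exact_mod_cast this
  · rintro q ⟨hq, hqp⟩
    have hq0 : (0:ℝ) < q := by exact_mod_cast hq.pos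
    obtain ⟨c, hc, n1, h1⟩ := hlow q hq hqp
    obtain ⟨C, hC, n2, h2⟩ := ub_final (3 * q * p ^ 2) (by have := hq.pos; positivity)
    have e : ((3 * q * p ^ 2 : ℕ) : ℝ) = 3 * q * p ^ 2 := by push_cast; ring
    rw [e] at h2
    set α : ℝ := 1 / (2 * ((3 * q * p ^ 2 : ℝ) * (3 * Real.sqrt 5 - 1)) + 1) with hα
    have hx : 0 < 2 * ((3 * q * p ^ 2 : ℝ) * (3 * Real.sqrt 5 - 1)) := by
      have : 0 < 3 * Real.sqrt 5 - 1 := by linarith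
      positivity
    refine ⟨⟨by positivity, ?_⟩, c, hc, C, hC, max n1 n2, fun n hn => ?_⟩
    · show α < 1
      rw [hα, div_lt_one (by linarith)]; linarith
    obtain ⟨m, hm, hE⟩ := h1 n (by omega)
    have hub := h2 n (by omega)
    have hbdd : BddAbove {N | HasEquiangularLines α n N} := by
      refine ⟨⌈(n:ℝ) + C * n / Real.log (Real.log n)⌉₊, fun N hN => ?_⟩
      have := (hub N hN).trans (Nat.le_ceil _)
      exact_mod_cast this
    have hmem : sSup {N | HasEquiangularLines α n N} ∈ {N | HasEquiangularLines α n N} :=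
      Nat.sSup_mem ⟨_, hE⟩ hbdd
    refine ⟨?_, hub _ hmem⟩
    have h3 : n + m ≤ maxEquiangularLines α n := le_csSup hbdd hE
    have h4 : ((n + m : ℕ) : ℝ) ≤ (maxEquiangularLines α n : ℝ) := by exact_mod_cast h3
    push_cast at h4
    linarith
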